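/- For any x,y ∈ K and any s ∈ (0,3]: (1/16)·Ψᴹ(s) ≤ m(B_d(x,s)) ≤ 12·Ψᴹ(s) and (1/12)·Ψᴿ(s) ≤ Ψ(s)/m(B_d(x,s)) ≤ 16·Ψᴿ(s); moreover 2⁻¹⁴·Ψᴿ(d(x,y)) ≤ R_E(x,y) ≤ 2¹²·Ψᴿ(d(x,y)). -/

import Mathlib

open scoped BigOperators ENNReal
open Set Filter MeasureTheory

noncomputable section

abbrev E2 : Type := EuclideanSpace ℝ (Fin 2)

/-- The index set `S_l` of the level-`l` thin Sierpinski gasket. -/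
def Sset (l : ℕ) : Set (ℕ × ℕ) :=
  {p | p.1 + p.2 ≤ l - 1 ∧ p.1 * p.2 * (l - 1 - p.1 - p.2) = 0}

/-- The contraction `f^l_i`. -/
def fmap (q : Fin 3 → E2) (l : ℕ) (i : ℕ × ℕ) (x : E2) : E2 :=
  q 0 + ((i.1 : ℝ) / l) • (q 1 - q 0) + ((i.2 : ℝ) / l) • (q 2 - q 0)
    + (l : ℝ)⁻¹ • (x - q 0)

/-- The closed equilateral triangle `△`. -/
def Tri (q : Fin 3 → E2) : Set E2 := convexHull ℝ (Set.range q)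

def V0 (q : Fin 3 → E2) : Set E2 := Set.range q

/-- Words of length `n` (padded by `(0,0)` beyond position `n`). -/
def Wn (l : ℕ → ℕ) (n : ℕ) : Set (ℕ → ℕ × ℕ) :=
  {w | (∀ k, k < n → w k ∈ Sset (l k)) ∧ ∀ k, n ≤ k → w k = (0, 0)}

/-- `wordMap q l w n = f^{l_1}_{w_1} ∘ ⋯ ∘ f^{l_n}_{w_n}` (0-indexed). -/
def wordMap (q : Fin 3 → E2) (l : ℕ → ℕ) (w : ℕ → ℕ × ℕ) : ℕ → E2 → E2
  | 0 => id
  | n + 1 => wordMap q l w n ∘ fmap q (l n) (w n)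

/-- The thin scale irregular Sierpinski gasket `K`. -/
def Gasket (q : Fin 3 → E2) (l : ℕ → ℕ) : Set E2 :=
  ⋂ n, ⋃ w ∈ Wn l n, wordMap q l w n '' Tri q

/-- The cell `K_w = K ∩ f_w(△)`. -/
def Cell (q : Fin 3 → E2) (l : ℕ → ℕ) (n : ℕ) (w : ℕ → ℕ × ℕ) : Set E2 :=
  Gasket q l ∩ wordMap q l w n '' Tri q

def Vn (q : Fin 3 → E2) (l : ℕ → ℕ) (n : ℕ) : Set E2 :=
  ⋃ w ∈ Wn l n, wordMap q l w n '' V0 q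

def Vstar (q : Fin 3 → E2) (l : ℕ → ℕ) : Set E2 := ⋃ n, Vn q l n

def Ln (l : ℕ → ℕ) (n : ℕ) : ℕ := ∏ k ∈ Finset.range n, l k

def Mn (l : ℕ → ℕ) (n : ℕ) : ℕ := ∏ k ∈ Finset.range n, (3 * l k - 3)

def rl (l : ℕ) : ℝ := (2 * (l : ℝ) / 3 + 1 / 9)⁻¹

def Rn (l : ℕ → ℕ) (n : ℕ) : ℝ := ∏ k ∈ Finset.range n, rl (l k)

def Tn (l : ℕ → ℕ) (n : ℕ) : ℝ := (Mn l n : ℝ) / Rn l n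

/-- The basic energy form `E⁰` on `ℝ^{V₀}`. -/
def E0 (q : Fin 3 → E2) (u v : E2 → ℝ) : ℝ :=
  (1 / 2) * ∑ j : Fin 3, ∑ k : Fin 3, (u (q j) - u (q k)) * (v (q j) - v (q k))

/-- The level-`n` energy form `Eⁿ`. -/
def En (q : Fin 3 → E2) (l : ℕ → ℕ) (n : ℕ) (u v : E2 → ℝ) : ℝ :=
  (Rn l n)⁻¹ * ∑ᶠ w ∈ Wn l n, E0 q (u ∘ wordMap q l w n) (v ∘ wordMap q l w n)

/-- The domain `F` of the limit resistance form. -/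
def FDom (q : Fin 3 → E2) (l : ℕ → ℕ) : Set (E2 → ℝ) :=
  {u | ∃ C : ℝ, ∀ n, En q l n u u ≤ C}

/-- The limit form `E(u,v) = lim_n Eⁿ(u,v)`. -/
def EForm (q : Fin 3 → E2) (l : ℕ → ℕ) (u v : E2 → ℝ) : ℝ :=
  limUnder atTop fun n => En q l n u v

/-- The intrinsic (geodesic) distance on `K`, with values in `ℝ≥0∞`. -/
def pdist (q : Fin 3 → E2) (l : ℕ → ℕ) (x y : E2) : ℝ≥0∞ :=
  ⨅ (γ : ℝ → E2) (_ : ContinuousOn γ (Set.Icc 0 1))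
    (_ : Set.MapsTo γ (Set.Icc 0 1) (Gasket q l)) (_ : γ 0 = x) (_ : γ 1 = y),
    eVariationOn γ (Set.Icc 0 1)

def gdist (q : Fin 3 → E2) (l : ℕ → ℕ) (x y : E2) : ℝ := (pdist q l x y).toReal

/-- The set of resistance quotients used to define `R_E`. -/
def REset (q : Fin 3 → E2) (l : ℕ → ℕ) (x y : E2) : Set ℝ :=
  {t | ∃ u ∈ FDom q l, 0 < EForm q l u u ∧ t = (u x - u y) ^ 2 / EForm q l u u}

/-- The resistance metric `R_E`. -/
def RE (q : Fin 3 → E2) (l : ℕ → ℕ) (x y : E2) : ℝ := sSup (REset q l x y)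

/-- Resistance quotients over continuous representatives (i.e. `F` viewed in `C(K)`). -/
def REcSet (q : Fin 3 → E2) (l : ℕ → ℕ) (x y : E2) : Set ℝ :=
  {t | ∃ u ∈ FDom q l, ContinuousOn u (Gasket q l) ∧ 0 < EForm q l u u ∧
    t = (u x - u y) ^ 2 / EForm q l u u}

def REc (q : Fin 3 → E2) (l : ℕ → ℕ) (x y : E2) : ℝ := sSup (REcSet q l x y)

/-- The open `d`-ball in `K`. -/
def Bd (q : Fin 3 → E2) (l : ℕ → ℕ) (x : E2) (s : ℝ) : Set E2 :=
  {y ∈ Gasket q l | gdist q l x y < s}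

/-- The open `R_E`-ball in `K`. -/
def BRc (q : Fin 3 → E2) (l : ℕ → ℕ) (x : E2) (s : ℝ) : Set E2 :=
  {y ∈ Gasket q l | REc q l x y < s}

/-- `Λ^{(k)}_{n,w}`: words within `k` cell-steps of `w`. -/
def Lam (q : Fin 3 → E2) (l : ℕ → ℕ) (n : ℕ) (w : ℕ → ℕ × ℕ) (k : ℕ) :
    Set (ℕ → ℕ × ℕ) :=
  {v ∈ Wn l n | ∃ c : ℕ → ℕ → ℕ × ℕ, c 0 = w ∧ c k = v ∧ (∀ j ≤ k, c j ∈ Wn l n) ∧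
    ∀ j < k, (Cell q l n (c j) ∩ Cell q l n (c (j + 1))).Nonempty}

/-- `U^{(k)}_{n,w}`. -/
def Unwk (q : Fin 3 → E2) (l : ℕ → ℕ) (n : ℕ) (w : ℕ → ℕ × ℕ) (k : ℕ) : Set E2 :=
  ⋃ v ∈ Lam q l n w k, Cell q l n v

def betaZero (l : ℕ → ℕ) : ℝ :=
  ⨅ n : ℕ, Real.logb (l n) (2 * (l n : ℝ) ^ 2 - (5 / 3) * (l n : ℝ) - 1 / 3)

def betaOne (l : ℕ → ℕ) : ℝ :=
  ⨆ n : ℕ, Real.logb (l n) (2 * (l n : ℝ) ^ 2 - (5 / 3) * (l n : ℝ) - 1 / 3)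

def betaM (l : ℕ → ℕ) : ℝ := ⨅ n : ℕ, Real.logb (l n) (3 * (l n : ℝ) - 3)

def betaR (l : ℕ → ℕ) : ℝ := ⨆ n : ℕ, Real.logb (l n) ((rl (l n))⁻¹)

/-- The value of `Ψ` on the interval `[1/L_{n+1}, 1/L_n]`. -/
def psiPiece (l : ℕ → ℕ) (n : ℕ) (s : ℝ) : ℝ :=
  (Tn l (n + 1))⁻¹
    * (1 + ((3 * (l n : ℝ) - 4) / ((l n : ℝ) - 1)) * ((Ln l (n + 1) : ℝ) * s - 1))
    * (1 + (((2 / 3) * (l n : ℝ) - 8 / 9) / ((l n : ℝ) - 1)) * ((Ln l (n + 1) : ℝ) * s - 1))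

/-- `Ψ = Ψ_𝒍` is characterized by these defining clauses. -/
def IsPsi (l : ℕ → ℕ) (Psi : ℝ → ℝ) : Prop :=
  (∀ n : ℕ, ∀ s : ℝ, ((Ln l (n + 1) : ℝ))⁻¹ ≤ s → s ≤ ((Ln l n : ℝ))⁻¹ →
      Psi s = psiPiece l n s) ∧
  (∀ s : ℝ, 1 ≤ s → Psi s = s ^ betaZero l) ∧ Psi 0 = 0

def psiMPiece (l : ℕ → ℕ) (n : ℕ) (s : ℝ) : ℝ :=
  ((Mn l (n + 1) : ℝ))⁻¹
    * (1 + ((3 * (l n : ℝ) - 4) / ((l n : ℝ) - 1)) * ((Ln l (n + 1) : ℝ) * s - 1))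

def IsPsiM (l : ℕ → ℕ) (PsiM : ℝ → ℝ) : Prop :=
  (∀ n : ℕ, ∀ s : ℝ, ((Ln l (n + 1) : ℝ))⁻¹ ≤ s → s ≤ ((Ln l n : ℝ))⁻¹ →
      PsiM s = psiMPiece l n s) ∧
  (∀ s : ℝ, 1 ≤ s → PsiM s = s ^ betaM l) ∧ PsiM 0 = 0

def psiRPiece (l : ℕ → ℕ) (n : ℕ) (s : ℝ) : ℝ :=
  Rn l (n + 1)
    * (1 + (((2 / 3) * (l n : ℝ) - 8 / 9) / ((l n : ℝ) - 1)) * ((Ln l (n + 1) : ℝ) * s - 1))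

def IsPsiR (l : ℕ → ℕ) (PsiR : ℝ → ℝ) : Prop :=
  (∀ n : ℕ, ∀ s : ℝ, ((Ln l (n + 1) : ℝ))⁻¹ ≤ s → s ≤ ((Ln l n : ℝ))⁻¹ →
      PsiR s = psiRPiece l n s) ∧
  (∀ s : ℝ, 1 ≤ s → PsiR s = s ^ betaR l) ∧ PsiR 0 = 0

/-- `μ` is the uniform distribution on `K`: a Borel measure carried by `K`
with `μ(K_w) = 1/M_{|w|}` for every word `w`. -/
def IsUnif (q : Fin 3 → E2) (l : ℕ → ℕ) (μ : Measure E2) : Prop :=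
  μ (Gasket q l)ᶜ = 0 ∧ ∀ n : ℕ, ∀ w ∈ Wn l n, μ (Cell q l n w) = ((Mn l n : ℝ≥0∞))⁻¹

/-- `μ` is the energy measure of `u`: a Borel measure carried by `K` with
`μ(K_w) = R_{|w|}⁻¹ E^{𝒍^{|w|}}(u∘F_w, u∘F_w)` for every word `w`. -/
def IsEnergyMeasure (q : Fin 3 → E2) (l : ℕ → ℕ) (u : E2 → ℝ) (μ : Measure E2) : Prop :=
  μ (Gasket q l)ᶜ = 0 ∧ ∀ n : ℕ, ∀ w ∈ Wn l n,
    μ (Cell q l n w) = ENNReal.ofReal ((Rn l n)⁻¹ *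
      EForm q (fun k => l (k + n)) (u ∘ wordMap q l w n) (u ∘ wordMap q l w n))



variable {q : Fin 3 → E2} {l : ℕ → ℕ}

/-! ### Coordinates -/

/-- The point with affine coordinates `(a,b)`. -/
def pt (q : Fin 3 → E2) (a b : ℝ) : E2 := q 0 + a • (q 1 - q 0) + b • (q 2 - q 0)

def Equi (q : Fin 3 → E2) : Prop := ∀ j k : Fin 3, j ≠ k → dist (q j) (q k) = 1

lemma equi_gram {q : Fin 3 → E2} (hq : Equi q) :
    inner ℝ (q 1 - q 0) (q 1 - q 0) = (1 : ℝ) ∧ inner ℝ (q 2 - q 0) (q 2 - q 0) = (1 : ℝ) ∧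
    inner ℝ (q 1 - q 0) (q 2 - q 0) = (1 / 2 : ℝ) := by
  have h1 := hq 1 0 (by decide)
  have h2 := hq 2 0 (by decide)
  have h3 := hq 1 2 (by decide)
  rw [dist_eq_norm] at h1 h2 h3
  have e : q 1 - q 2 = (q 1 - q 0) - (q 2 - q 0) := by abel
  rw [e] at h3
  have h4 := @norm_sub_sq_real E2 _ _ (q 1 - q 0) (q 2 - q 0)
  rw [h1, h2, h3] at h4
  refine ⟨?_, ?_, ?_⟩
  · rw [real_inner_self_eq_norm_sq, h1]; norm_num
  · rw [real_inner_self_eq_norm_sq, h2]; norm_num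
  · linarith

lemma dist_pt_sq {q : Fin 3 → E2} (hq : Equi q) (a b a' b' : ℝ) :
    dist (pt q a b) (pt q a' b') ^ 2 = (a - a') ^ 2 + (a - a') * (b - b') + (b - b') ^ 2 := by
  obtain ⟨h1, h2, h3⟩ := equi_gram hq
  have e : pt q a b - pt q a' b' = (a - a') • (q 1 - q 0) + (b - b') • (q 2 - q 0) := by
    unfold pt; module
  rw [dist_eq_norm, e, ← real_inner_self_eq_norm_sq]
  rw [inner_add_left, inner_add_right, inner_add_right]
  simp only [real_inner_smul_left, real_inner_smul_right]
  rw [real_inner_comm (q 1 - q 0) (q 2 - q 0), h1, h2, h3]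
  ring

lemma pt_inj {q : Fin 3 → E2} (hq : Equi q) {a b a' b' : ℝ} (h : pt q a b = pt q a' b') :
    a = a' ∧ b = b' := by
  have := dist_pt_sq hq a b a' b'
  rw [h, dist_self] at this
  have h1 : a - a' = 0 := by nlinarith [sq_nonneg (a - a' + (b - b') * 2), sq_nonneg (a-a' + (b-b')/2), sq_nonneg (b-b' + (a-a')/2), sq_nonneg (a-a'), sq_nonneg (b-b')]
  have h2 : b - b' = 0 := by nlinarith [sq_nonneg (a - a' + (b - b') * 2), sq_nonneg (a-a' + (b-b')/2), sq_nonneg (b-b' + (a-a')/2), sq_nonneg (a-a'), sq_nonneg (b-b')]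
  constructor <;> linarith

lemma continuous_pt (q : Fin 3 → E2) : Continuous (fun p : ℝ × ℝ => pt q p.1 p.2) := by
  unfold pt; fun_prop

lemma pt_comb (q : Fin 3 → E2) (a b a' b' s t : ℝ) (h : s + t = 1) :
    s • pt q a b + t • pt q a' b' = pt q (s * a + t * a') (s * b + t * b') := by
  have : s = 1 - t := by linarith
  subst this
  unfold pt; module

lemma pt_zero (q : Fin 3 → E2) : pt q 0 0 = q 0 := by simp [pt]
lemma pt_one (q : Fin 3 → E2) : pt q 1 0 = q 1 := by simp [pt]
lemma pt_two (q : Fin 3 → E2) : pt q 0 1 = q 2 := by simp [pt]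

lemma tri_eq (q : Fin 3 → E2) :
    Tri q = {x | ∃ a b : ℝ, 0 ≤ a ∧ 0 ≤ b ∧ a + b ≤ 1 ∧ x = pt q a b} := by
  apply Subset.antisymm
  · apply convexHull_min
    · rintro _ ⟨j, rfl⟩
      fin_cases j
      · exact ⟨0, 0, by norm_num, by norm_num, by norm_num, (pt_zero q).symm⟩
      · exact ⟨1, 0, by norm_num, by norm_num, by norm_num, (pt_one q).symm⟩
      · exact ⟨0, 1, by norm_num, by norm_num, by norm_num, (pt_two q).symm⟩
    · rintro _ ⟨a, b, ha, hb, hab, rfl⟩ _ ⟨a', b', ha', hb', hab', rfl⟩ s t hs ht hst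
      refine ⟨_, _, ?_, ?_, ?_, pt_comb q a b a' b' s t hst⟩
      · positivity
      · positivity
      · nlinarith
  · rintro _ ⟨a, b, ha, hb, hab, rfl⟩
    have hc := convex_convexHull ℝ (Set.range q)
    have h := hc.sum_mem (t := Finset.univ) (w := ![1 - a - b, a, b]) (z := q)
      (by intro i _; fin_cases i <;> simp <;> linarith)
      (by simp [Fin.sum_univ_three]; ring)
      (fun i _ => subset_convexHull ℝ _ ⟨i, rfl⟩)
    have e : ∑ i : Fin 3, (![1 - a - b, a, b] i) • q i = pt q a b := by
      rw [Fin.sum_univ_three]; simp [pt]; module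
    rw [e] at h; exact h

/-! ### Cells -/

def SF (l : ℕ) : Finset (ℕ × ℕ) :=
  (Finset.range l ×ˢ Finset.range l).filter
    (fun p => p.1 + p.2 ≤ l - 1 ∧ p.1 * p.2 * (l - 1 - p.1 - p.2) = 0)

lemma mem_SF {l : ℕ} (hl : 5 ≤ l) (p : ℕ × ℕ) : p ∈ SF l ↔ p ∈ Sset l := by
  simp only [SF, Sset, Finset.mem_filter, Finset.mem_product, Finset.mem_range, mem_ofPred_eq]
  constructor
  · exact fun h => h.2
  · intro h; refine ⟨⟨?_, ?_⟩, h⟩ <;> have := h.1 <;> omega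

lemma mem_SF' {l : ℕ} (hl : 5 ≤ l) (p : ℕ × ℕ) :
    p ∈ SF l ↔ p.1 + p.2 ≤ l - 1 ∧ (p.1 = 0 ∨ p.2 = 0 ∨ p.1 + p.2 = l - 1) := by
  rw [mem_SF hl]
  simp only [Sset, mem_ofPred_eq, Nat.mul_eq_zero]
  constructor
  · rintro ⟨h1, h2⟩; refine ⟨h1, ?_⟩; omega
  · rintro ⟨h1, h2⟩; refine ⟨h1, ?_⟩; omega

/-- child position -/
def ch (l : ℕ) (P i : ℕ × ℕ) : ℕ × ℕ := (l * P.1 + i.1, l * P.2 + i.2)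

lemma ch_inj {l : ℕ} (hl : 5 ≤ l) {P i P' i' : ℕ × ℕ} (hi : i ∈ SF l) (hi' : i' ∈ SF l)
    (h : ch l P i = ch l P' i') : P = P' ∧ i = i' := by
  rw [mem_SF' hl] at hi hi'
  simp only [ch, Prod.mk.injEq] at h
  obtain ⟨h1, h2⟩ := h
  have a1 : i.1 < l := by omega
  have a2 : i.2 < l := by omega
  have a1' : i'.1 < l := by omega
  have a2' : i'.2 < l := by omega
  have hl0 : 0 < l := by omega
  have d1 : P.1 = P'.1 := by
    have := congrArg (· / l) h1
    simpa [Nat.mul_add_div hl0, Nat.div_eq_of_lt a1, Nat.div_eq_of_lt a1'] using this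
  have d2 : P.2 = P'.2 := by
    have := congrArg (· / l) h2
    simpa [Nat.mul_add_div hl0, Nat.div_eq_of_lt a2, Nat.div_eq_of_lt a2'] using this
  rw [d1] at h1; rw [d2] at h2
  exact ⟨Prod.ext d1 d2, Prod.ext (by omega) (by omega)⟩

def CF (l : ℕ → ℕ) : ℕ → Finset (ℕ × ℕ)
  | 0 => {(0, 0)}
  | n + 1 => (CF l n ×ˢ SF (l n)).image (fun z => ch (l n) z.1 z.2)

lemma mem_CF_succ {l : ℕ → ℕ} {n : ℕ} {p : ℕ × ℕ} :
    p ∈ CF l (n + 1) ↔ ∃ P ∈ CF l n, ∃ i ∈ SF (l n), ch (l n) P i = p := by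
  rw [CF, Finset.mem_image]
  constructor
  · rintro ⟨⟨P, i⟩, h, h3⟩
    rw [Finset.mem_product] at h
    exact ⟨P, h.1, i, h.2, h3⟩
  · rintro ⟨P, h1, i, h2, h3⟩
    exact ⟨(P, i), Finset.mem_product.2 ⟨h1, h2⟩, h3⟩

lemma ch_mem {l : ℕ → ℕ} {n : ℕ} {P i : ℕ × ℕ} (hP : P ∈ CF l n) (hi : i ∈ SF (l n)) :
    ch (l n) P i ∈ CF l (n + 1) := mem_CF_succ.2 ⟨P, hP, i, hi, rfl⟩

lemma sum_CF_succ {l : ℕ → ℕ} (hl : ∀ m, 5 ≤ l m) (n : ℕ) (f : ℕ × ℕ → ℝ) :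
    ∑ p ∈ CF l (n + 1), f p = ∑ P ∈ CF l n, ∑ i ∈ SF (l n), f (ch (l n) P i) := by
  rw [CF, Finset.sum_image, Finset.sum_product]
  rintro ⟨P, i⟩ h ⟨P', i'⟩ h' he
  simp only [Finset.coe_product, mem_prod, Finset.mem_coe] at h h'
  obtain ⟨rfl, rfl⟩ := ch_inj (hl n) h.2 h'.2 he
  rfl

/-- the closed triangle of a cell -/
def tri (q : Fin 3 → E2) (l : ℕ → ℕ) (n : ℕ) (p : ℕ × ℕ) : Set E2 :=
  {x | ∃ a b : ℝ, 0 ≤ a ∧ 0 ≤ b ∧ a + b ≤ 1 ∧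
    x = pt q ((p.1 + a) / Ln l n) ((p.2 + b) / Ln l n)}

/-- perimeter of a cell -/
def per (q : Fin 3 → E2) (l : ℕ → ℕ) (n : ℕ) (p : ℕ × ℕ) : Set E2 :=
  {x | ∃ a b : ℝ, 0 ≤ a ∧ 0 ≤ b ∧ a + b ≤ 1 ∧ (a = 0 ∨ b = 0 ∨ a + b = 1) ∧
    x = pt q ((p.1 + a) / Ln l n) ((p.2 + b) / Ln l n)}

/-- lattice point -/
def lpt (q : Fin 3 → E2) (l : ℕ → ℕ) (n : ℕ) (v : ℕ × ℕ) : E2 :=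
  pt q ((v.1 : ℝ) / Ln l n) ((v.2 : ℝ) / Ln l n)

def IsV (v p : ℕ × ℕ) : Prop := v = p ∨ v = (p.1 + 1, p.2) ∨ v = (p.1, p.2 + 1)

lemma Ln_pos {l : ℕ → ℕ} (hl : ∀ m, 5 ≤ l m) (n : ℕ) : (0 : ℝ) < Ln l n := by
  unfold Ln; exact_mod_cast Finset.prod_pos (fun k _ => by have := hl k; omega)

lemma Ln_succ (l : ℕ → ℕ) (n : ℕ) : (Ln l (n + 1) : ℝ) = Ln l n * l n := by
  unfold Ln; rw [Finset.prod_range_succ]; push_cast; ring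

lemma Ln_zero (l : ℕ → ℕ) : (Ln l 0 : ℝ) = 1 := by simp [Ln]

lemma l_ge {l : ℕ → ℕ} (hl : ∀ m, 5 ≤ l m) (n : ℕ) : (5 : ℝ) ≤ l n := by exact_mod_cast hl n

def pos (l : ℕ → ℕ) (w : ℕ → ℕ × ℕ) : ℕ → ℕ × ℕ
  | 0 => (0, 0)
  | n + 1 => ch (l n) (pos l w n) (w n)

lemma fmap_pt (q : Fin 3 → E2) (m : ℕ) (i : ℕ × ℕ) (a b : ℝ) :
    fmap q m i (pt q a b) = pt q ((i.1 + a) / m) ((i.2 + b) / m) := by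
  unfold fmap pt
  have e1 : ((i.1 : ℝ) + a) / m = (i.1 : ℝ) / m + (m : ℝ)⁻¹ * a := by ring
  have e2 : ((i.2 : ℝ) + b) / m = (i.2 : ℝ) / m + (m : ℝ)⁻¹ * b := by ring
  rw [e1, e2]; module

lemma wordMap_pt (q : Fin 3 → E2) {l : ℕ → ℕ} (hl : ∀ m, 5 ≤ l m) (w : ℕ → ℕ × ℕ) (n : ℕ) :
    ∀ a b : ℝ, wordMap q l w n (pt q a b) =
      pt q (((pos l w n).1 + a) / Ln l n) (((pos l w n).2 + b) / Ln l n) := by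
  induction n with
  | zero => intro a b; simp [wordMap, pos, Ln]
  | succ n ih =>
    intro a b
    have h1 := Ln_pos hl n
    have h2 := l_ge hl n
    simp only [wordMap, Function.comp, fmap_pt, ih, pos, ch, Ln_succ]
    congr 1
    · push_cast; field_simp; ring
    · push_cast; field_simp; ring

lemma wordMap_image (q : Fin 3 → E2) {l : ℕ → ℕ} (hl : ∀ m, 5 ≤ l m) (w : ℕ → ℕ × ℕ) (n : ℕ) :
    wordMap q l w n '' Tri q = tri q l n (pos l w n) := by
  rw [tri_eq]
  ext x; constructor
  · rintro ⟨_, ⟨a, b, ha, hb, hab, rfl⟩, rfl⟩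
    exact ⟨a, b, ha, hb, hab, wordMap_pt q hl w n a b⟩
  · rintro ⟨a, b, ha, hb, hab, rfl⟩
    exact ⟨_, ⟨a, b, ha, hb, hab, rfl⟩, wordMap_pt q hl w n a b⟩

lemma pos_congr (l : ℕ → ℕ) (w w' : ℕ → ℕ × ℕ) (n : ℕ) (h : ∀ k < n, w k = w' k) :
    pos l w n = pos l w' n := by
  induction n with
  | zero => rfl
  | succ n ih => simp only [pos]; rw [ih (fun k hk => h k (by omega)), h n (by omega)]

lemma pos_bij {l : ℕ → ℕ} (hl : ∀ m, 5 ≤ l m) (n : ℕ) :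
    BijOn (fun w => pos l w n) (Wn l n) (CF l n : Set (ℕ × ℕ)) := by
  induction n with
  | zero =>
    refine ⟨?_, ?_, ?_⟩
    · intro w _; simp [pos, CF]
    · intro w hw w' hw' _
      funext k; rw [hw.2 k (by omega), hw'.2 k (by omega)]
    · intro p hp
      simp [CF] at hp
      exact ⟨fun _ => (0, 0), ⟨fun k hk => absurd hk (by omega), fun _ _ => rfl⟩, by simp [pos, hp]⟩
  | succ n ih =>
    have trunc : ∀ w ∈ Wn l (n + 1), (fun k => if k < n then w k else (0, 0)) ∈ Wn l n := by
      intro w hw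
      refine ⟨fun k hk => by simp [hk]; exact hw.1 k (by omega), fun k hk => ?_⟩
      simp [not_lt.2 hk]
    have tpos : ∀ w, pos l (fun k => if k < n then w k else (0, 0)) n = pos l w n := by
      intro w; apply pos_congr; intro k hk; simp [hk]
    refine ⟨?_, ?_, ?_⟩
    · intro w hw
      simp only [pos, Finset.mem_coe]
      apply ch_mem
      · have := ih.1 (trunc w hw); simp only [tpos] at this; exact this
      · exact (mem_SF (hl n) _).2 (hw.1 n (by omega))
    · intro w hw w' hw' he
      simp only [pos] at he
      obtain ⟨h1, h2⟩ := ch_inj (hl n) ((mem_SF (hl n) _).2 (hw.1 n (by omega)))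
        ((mem_SF (hl n) _).2 (hw'.1 n (by omega))) he
      have h3 := ih.2.1 (trunc w hw) (trunc w' hw') (by simp only [tpos]; exact h1)
      funext k
      rcases lt_trichotomy k n with hk | hk | hk
      · have := congrFun h3 k; simpa [hk] using this
      · rw [hk]; exact h2
      · rw [hw.2 k (by omega), hw'.2 k (by omega)]
    · intro p hp
      obtain ⟨P, hP, i, hi, rfl⟩ := mem_CF_succ.1 (Finset.mem_coe.1 hp)
      obtain ⟨w, hw, hwP⟩ := ih.2.2 (Finset.mem_coe.2 hP)
      simp only at hwP
      refine ⟨fun k => if k = n then i else w k, ⟨fun k hk => ?_, fun k hk => ?_⟩, ?_⟩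
      · by_cases h : k = n
        · subst h; simp; exact (mem_SF (hl _) _).1 hi
        · simp [h]; exact hw.1 k (by omega)
      · have h : k ≠ n := by omega
        simp [h]; exact hw.2 k (by omega)
      · simp only [pos]
        rw [pos_congr l _ w n (fun k hk => by simp [hk.ne]), hwP]; simp

lemma mem_K {q : Fin 3 → E2} {l : ℕ → ℕ} (hl : ∀ m, 5 ≤ l m) (x : E2) :
    x ∈ Gasket q l ↔ ∀ n, ∃ p ∈ CF l n, x ∈ tri q l n p := by
  simp only [Gasket, mem_iInter, mem_iUnion, exists_prop]
  apply forall_congr'; intro n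
  constructor
  · rintro ⟨w, hw, hx⟩
    rw [wordMap_image q hl] at hx
    exact ⟨_, (pos_bij hl n).1 hw, hx⟩
  · rintro ⟨p, hp, hx⟩
    obtain ⟨w, hw, rfl⟩ := (pos_bij hl n).2.2 (Finset.mem_coe.2 hp)
    exact ⟨w, hw, by rw [wordMap_image q hl]; exact hx⟩

lemma unif_cell {q : Fin 3 → E2} {l : ℕ → ℕ} (hl : ∀ m, 5 ≤ l m) {μ : Measure E2}
    (hμ : IsUnif q l μ) {n : ℕ} {p : ℕ × ℕ} (hp : p ∈ CF l n) :
    μ (Gasket q l ∩ tri q l n p) = ((Mn l n : ℝ≥0∞))⁻¹ := by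
  obtain ⟨w, hw, rfl⟩ := (pos_bij hl n).2.2 (Finset.mem_coe.2 hp)
  have := hμ.2 n w hw
  rw [Cell, wordMap_image q hl] at this
  exact this

def ed (a b c : ℝ) : ℝ := (a - b) ^ 2 + (b - c) ^ 2 + (c - a) ^ 2

/-- energy of a cell -/
def edc (q : Fin 3 → E2) (l : ℕ → ℕ) (u : E2 → ℝ) (n : ℕ) (p : ℕ × ℕ) : ℝ :=
  ed (u (lpt q l n p)) (u (lpt q l n (p.1 + 1, p.2))) (u (lpt q l n (p.1, p.2 + 1)))

lemma En_eq {q : Fin 3 → E2} {l : ℕ → ℕ} (hl : ∀ m, 5 ≤ l m) (n : ℕ) (u : E2 → ℝ) :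
    En q l n u u = (Rn l n)⁻¹ * ∑ p ∈ CF l n, edc q l u n p := by
  unfold En
  congr 1
  rw [finsum_mem_eq_of_bijOn (fun w => pos l w n) (pos_bij hl n)
    (g := fun p => edc q l u n p), finsum_mem_coe_finset]
  intro w _
  have h0 := wordMap_pt q hl w n 0 0
  have h1 := wordMap_pt q hl w n 1 0
  have h2 := wordMap_pt q hl w n 0 1
  rw [pt_zero] at h0; rw [pt_one] at h1; rw [pt_two] at h2
  simp only [E0, Fin.sum_univ_three, Function.comp, h0, h1, h2, edc, ed, lpt]
  push_cast
  simp only [add_zero]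
  ring

lemma per_sub_tri {n : ℕ} {p : ℕ × ℕ} : per q l n p ⊆ tri q l n p := by
  rintro _ ⟨a, b, h1, h2, h3, _, rfl⟩; exact ⟨a, b, h1, h2, h3, rfl⟩

lemma coord_child (hl : ∀ m, 5 ≤ l m) (n A i : ℕ) (a : ℝ) :
    (((l n * A + i : ℕ) : ℝ) + a) / Ln l (n + 1) = (A + (i + a) / l n) / Ln l n := by
  have h1 := Ln_pos hl n
  have h2 := l_ge hl n
  rw [Ln_succ]; push_cast; field_simp; ring

lemma tri_child_sub (hl : ∀ m, 5 ≤ l m) {n : ℕ} {P i : ℕ × ℕ} (hi : i ∈ SF (l n)) :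
    tri q l (n + 1) (ch (l n) P i) ⊆ tri q l n P := by
  rintro _ ⟨a, b, ha, hb, hab, rfl⟩
  have h2 := l_ge hl n
  rw [mem_SF' (hl n)] at hi
  have h3 : (i.1 : ℝ) + i.2 + 1 ≤ l n := by
    have := hl n; exact_mod_cast (by omega : i.1 + i.2 + 1 ≤ l n)
  refine ⟨(i.1 + a) / l n, (i.2 + b) / l n, by positivity, by positivity, ?_, ?_⟩
  · rw [← add_div, div_le_one (by linarith)]; linarith
  · simp only [ch, coord_child hl]

lemma anc (hl : ∀ m, 5 ≤ l m) {x : E2} {n : ℕ} : ∀ k, (∃ p ∈ CF l (n + k), x ∈ tri q l (n + k) p) →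
    ∃ p ∈ CF l n, x ∈ tri q l n p := by
  intro k
  induction k with
  | zero => exact fun h => h
  | succ k ih =>
    rintro ⟨p, hp, hx⟩
    obtain ⟨P, hP, i, hi, rfl⟩ := mem_CF_succ.1 hp
    exact ih ⟨P, hP, tri_child_sub hl hi hx⟩

/-- floor-type splitting -/
lemma split_unit (m : ℕ) (hm : 5 ≤ m) (a : ℝ) (h0 : 0 ≤ a) (h1 : a ≤ 1) :
    ∃ k : ℕ, k ≤ m - 1 ∧ ∃ c : ℝ, 0 ≤ c ∧ c ≤ 1 ∧ a = (k + c) / m := by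
  have hm' : (5 : ℝ) ≤ m := by exact_mod_cast hm
  have hm0 : (m : ℝ) ≠ 0 := by positivity
  by_cases h : a = 1
  · refine ⟨m - 1, le_rfl, 1, by norm_num, le_rfl, ?_⟩
    have : ((m - 1 : ℕ) : ℝ) = m - 1 := by rw [Nat.cast_sub (by omega)]; simp
    rw [this, h]; field_simp; ring
  · have h1' : a < 1 := lt_of_le_of_ne h1 h
    have hn : 0 ≤ a * m := by positivity
    refine ⟨⌊a * m⌋₊, ?_, a * m - ⌊a * m⌋₊, ?_, ?_, ?_⟩
    · have : ⌊a * m⌋₊ < m := by rw [Nat.floor_lt hn]; nlinarith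
      omega
    · linarith [Nat.floor_le hn]
    · linarith [Nat.lt_floor_add_one (a * m)]
    · field_simp; ring

lemma per_child (hl : ∀ m, 5 ≤ l m) {n : ℕ} {P : ℕ × ℕ} {x : E2} (hx : x ∈ per q l n P) :
    ∃ i ∈ SF (l n), x ∈ per q l (n + 1) (ch (l n) P i) := by
  obtain ⟨a, b, ha, hb, hab, hs, rfl⟩ := hx
  have h2 := l_ge hl n
  have hm0 : (l n : ℝ) ≠ 0 := by positivity
  have hln := hl n
  rcases hs with rfl | rfl | h
  · obtain ⟨k, hk, c, hc0, hc1, rfl⟩ := split_unit (l n) (hl n) b hb (by linarith)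
    refine ⟨(0, k), (mem_SF' (hl n) _).2 ⟨by simpa using hk, by simp⟩,
      0, c, le_rfl, hc0, by linarith, Or.inl rfl, ?_⟩
    simp only [ch, coord_child hl]; simp
  · obtain ⟨k, hk, c, hc0, hc1, rfl⟩ := split_unit (l n) (hl n) a ha (by linarith)
    refine ⟨(k, 0), (mem_SF' (hl n) _).2 ⟨by simpa using hk, by simp⟩,
      c, 0, hc0, le_rfl, by linarith, Or.inr (Or.inl rfl), ?_⟩
    simp only [ch, coord_child hl]; simp
  · obtain ⟨k, hk, c, hc0, hc1, rfl⟩ := split_unit (l n) (hl n) b hb (by linarith)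
    refine ⟨(l n - 1 - k, k), (mem_SF' (hl n) _).2 ⟨by simp only; omega, by
      right; right; simp only; omega⟩,
      1 - c, c, by linarith, hc0, by linarith, Or.inr (Or.inr (by ring)), ?_⟩
    simp only [ch, coord_child hl]
    have : ((l n - 1 - k : ℕ) : ℝ) = l n - 1 - k := by
      rw [Nat.cast_sub (by omega), Nat.cast_sub (by omega)]; simp
    rw [this]
    have e : a = (l n - 1 - k + (1 - c)) / l n := by
      have : a = 1 - (k + c) / l n := by linarith
      rw [this]; field_simp; ring
    rw [← e]

lemma per_sub_K (hl : ∀ m, 5 ≤ l m) {n : ℕ} {P : ℕ × ℕ} (hP : P ∈ CF l n) :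
    per q l n P ⊆ Gasket q l := by
  intro x hx
  have key : ∀ k, ∃ p ∈ CF l (n + k), x ∈ per q l (n + k) p := by
    intro k
    induction k with
    | zero => exact ⟨P, hP, hx⟩
    | succ k ih =>
      obtain ⟨p, hp, hxp⟩ := ih
      obtain ⟨i, hi, h⟩ := per_child hl hxp
      exact ⟨_, ch_mem hp hi, h⟩
  rw [mem_K hl]
  intro m
  obtain ⟨p, hp, hxp⟩ := key m
  rw [add_comm] at hp hxp
  exact anc hl n ⟨p, hp, per_sub_tri hxp⟩

lemma isV_per {n : ℕ} {v p : ℕ × ℕ} (h : IsV v p) : lpt q l n v ∈ per q l n p := by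
  rcases h with rfl | rfl | rfl
  · exact ⟨0, 0, by norm_num, by norm_num, by norm_num, by norm_num, by simp [lpt]⟩
  · exact ⟨1, 0, by norm_num, by norm_num, by norm_num, by norm_num, by simp [lpt]⟩
  · exact ⟨0, 1, by norm_num, by norm_num, by norm_num, by norm_num, by simp [lpt]⟩

lemma lpt_ch (hl : ∀ m, 5 ≤ l m) (n : ℕ) (v : ℕ × ℕ) :
    lpt q l (n + 1) (l n * v.1, l n * v.2) = lpt q l n v := by
  have h1 := Ln_pos hl n
  have h2 := l_ge hl n
  unfold lpt; rw [Ln_succ]; push_cast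
  congr 1 <;> field_simp

lemma lpt_inj (hq : Equi q) (hl : ∀ m, 5 ≤ l m) {n : ℕ} {v w : ℕ × ℕ}
    (h : lpt q l n v = lpt q l n w) : v = w := by
  have h1 := Ln_pos hl n
  obtain ⟨h2, h3⟩ := pt_inj hq h
  rw [div_left_inj' h1.ne'] at h2 h3
  exact Prod.ext (by exact_mod_cast h2) (by exact_mod_cast h3)

lemma tri_coord (hq : Equi q) (hl : ∀ m, 5 ≤ l m) {n : ℕ} {p : ℕ × ℕ} {a b : ℝ}
    (h : pt q (a / Ln l n) (b / Ln l n) ∈ tri q l n p) :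
    p.1 ≤ a ∧ p.2 ≤ b ∧ a + b ≤ p.1 + p.2 + 1 := by
  have h1 := Ln_pos hl n
  obtain ⟨c, d, hc, hd, hcd, he⟩ := h
  obtain ⟨h2, h3⟩ := pt_inj hq he
  rw [div_left_inj' h1.ne'] at h2 h3
  refine ⟨by linarith, by linarith, by linarith⟩

lemma isV_of_lpt_mem (hq : Equi q) (hl : ∀ m, 5 ≤ l m) {n : ℕ} {v p : ℕ × ℕ}
    (h : lpt q l n v ∈ tri q l n p) : IsV v p := by
  obtain ⟨h1, h2, h3⟩ := tri_coord hq hl h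
  have h1' : p.1 ≤ v.1 := by exact_mod_cast h1
  have h2' : p.2 ≤ v.2 := by exact_mod_cast h2
  have h3' : v.1 + v.2 ≤ p.1 + p.2 + 1 := by exact_mod_cast h3
  unfold IsV
  simp only [Prod.ext_iff]
  omega

/-- Two distinct cells meet at most in a common vertex. -/
lemma tri_inter (hq : Equi q) (hl : ∀ m, 5 ≤ l m) {n : ℕ} {p p' : ℕ × ℕ} {x : E2} (hne : p ≠ p')
    (h : x ∈ tri q l n p) (h' : x ∈ tri q l n p') :
    ∃ v, IsV v p ∧ IsV v p' ∧ x = lpt q l n v := by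
  obtain ⟨a, b, ha, hb, hab, rfl⟩ := h
  obtain ⟨h1, h2, h3⟩ := tri_coord hq hl h'
  obtain ⟨a', b', ha', hb', hab', he⟩ := h'
  obtain ⟨e1, e2⟩ := pt_inj hq he
  have hL := Ln_pos hl n
  rw [div_left_inj' hL.ne'] at e1 e2
  -- integer differences
  have i1 : p'.1 ≤ p.1 + 1 := by exact_mod_cast (by linarith : (p'.1 : ℝ) ≤ p.1 + 1)
  have i2 : p'.2 ≤ p.2 + 1 := by exact_mod_cast (by linarith : (p'.2 : ℝ) ≤ p.2 + 1)
  have i3 : p.1 ≤ p'.1 + 1 := by exact_mod_cast (by linarith : (p.1 : ℝ) ≤ p'.1 + 1)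
  have i4 : p.2 ≤ p'.2 + 1 := by exact_mod_cast (by linarith : (p.2 : ℝ) ≤ p'.2 + 1)
  have i5 : p.1 + p.2 ≤ p'.1 + p'.2 + 1 := by
    exact_mod_cast (by linarith : (p.1 : ℝ) + p.2 ≤ p'.1 + p'.2 + 1)
  have i6 : p'.1 + p'.2 ≤ p.1 + p.2 + 1 := by
    exact_mod_cast (by linarith : (p'.1 : ℝ) + p'.2 ≤ p.1 + p.2 + 1)
  have hcases : (p.1 = p'.1 + 1 ∧ p.2 = p'.2) ∨ (p.1 = p'.1 ∧ p.2 = p'.2 + 1) ∨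
      (p.1 = p'.1 + 1 ∧ p'.2 = p.2 + 1) ∨ (p'.1 = p.1 + 1 ∧ p.2 = p'.2) ∨
      (p.1 = p'.1 ∧ p'.2 = p.2 + 1) ∨ (p'.1 = p.1 + 1 ∧ p.2 = p'.2 + 1) := by
    have : ¬ (p.1 = p'.1 ∧ p.2 = p'.2) := fun h => hne (Prod.ext h.1 h.2)
    omega
  have conv : ∀ {A A' B B' : ℕ}, A = A' → (A : ℝ) = A' := by intro A A' _ _ h; rw [h]
  rcases hcases with ⟨c, d⟩ | ⟨c, d⟩ | ⟨c, d⟩ | ⟨c, d⟩ | ⟨c, d⟩ | ⟨c, d⟩ <;>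
    have c' := congrArg (Nat.cast : ℕ → ℝ) c <;> have d' := congrArg (Nat.cast : ℕ → ℝ) d <;>
    push_cast at c' d'
  · refine ⟨p, Or.inl rfl, Or.inr (Or.inl (Prod.ext c d)), ?_⟩
    have : a = 0 := by linarith
    have : b = 0 := by linarith
    simp [lpt, *]
  · refine ⟨p, Or.inl rfl, Or.inr (Or.inr (Prod.ext c d)), ?_⟩
    have : a = 0 := by linarith
    have : b = 0 := by linarith
    simp [lpt, *]
  · refine ⟨(p.1, p.2 + 1), Or.inr (Or.inr rfl), Or.inr (Or.inl (Prod.ext c d.symm)), ?_⟩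
    have : a = 0 := by linarith
    have : b = 1 := by linarith
    subst a b; simp [lpt]
  · refine ⟨p', Or.inr (Or.inl (Prod.ext c d.symm)), Or.inl rfl, ?_⟩
    have : a = 1 := by linarith
    have : b = 0 := by linarith
    subst a b; simp [lpt, c, d]
  · refine ⟨p', Or.inr (Or.inr (Prod.ext c.symm d)), Or.inl rfl, ?_⟩
    have : a = 0 := by linarith
    have : b = 1 := by linarith
    subst a b; simp [lpt, c, d]
  · refine ⟨(p.1 + 1, p.2), Or.inr (Or.inl rfl), Or.inr (Or.inr (Prod.ext c.symm d)), ?_⟩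
    have : a = 1 := by linarith
    have : b = 0 := by linarith
    subst a b; simp [lpt]

lemma CF_divmod (hl : ∀ m, 5 ≤ l m) {n : ℕ} {p : ℕ × ℕ} (h : p ∈ CF l (n + 1)) :
    (p.1 / l n, p.2 / l n) ∈ CF l n ∧ (p.1 % l n, p.2 % l n) ∈ SF (l n) := by
  obtain ⟨P, hP, i, hi, rfl⟩ := mem_CF_succ.1 h
  have hi' := (mem_SF' (hl n) _).1 hi
  have := hl n
  have h1 : i.1 < l n := by omega
  have h2 : i.2 < l n := by omega
  have h0 : 0 < l n := by omega
  simp only [ch, Nat.mul_add_div h0, Nat.div_eq_of_lt h1, Nat.div_eq_of_lt h2,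
    Nat.mul_add_mod, Nat.mod_eq_of_lt h1, Nat.mod_eq_of_lt h2]
  exact ⟨hP, hi⟩

lemma not_three_aux (hl : ∀ m, 5 ≤ l m) (n : ℕ) : ∀ A B : ℕ,
    ¬ ((A + 1, B + 1) ∈ CF l n ∧ (A, B + 1) ∈ CF l n ∧ (A + 1, B) ∈ CF l n) := by
  induction n with
  | zero => intro A B h; simp [CF] at h
  | succ n ih =>
    rintro A B ⟨h1, h2, h3⟩
    obtain ⟨d1, m1⟩ := CF_divmod hl h1
    obtain ⟨d2, m2⟩ := CF_divmod hl h2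
    obtain ⟨d3, m3⟩ := CF_divmod hl h3
    rw [mem_SF' (hl n)] at m1 m2 m3
    simp only at d1 d2 d3 m1 m2 m3
    have hln := hl n
    have key : ∀ X : ℕ, ((X + 1) % l n = 0 ∧ X % l n = l n - 1 ∧ (X + 1) / l n = X / l n + 1) ∨
        ((X + 1) % l n = X % l n + 1 ∧ (X + 1) / l n = X / l n) := by
      intro X
      have hX := Nat.div_add_mod X (l n)
      have hlt := Nat.mod_lt X (show l n > 0 by omega)
      by_cases hc : X % l n + 1 = l n
      · left
        have : X + 1 = l n * (X / l n + 1) := by rw [Nat.mul_add]; omega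
        refine ⟨by rw [this]; simp, by omega, ?_⟩
        rw [this]; rw [Nat.mul_div_cancel_left _ (by omega)]
      · right
        have e : X + 1 = l n * (X / l n) + (X % l n + 1) := by omega
        have lt : X % l n + 1 < l n := by omega
        constructor
        · conv_lhs => rw [e]
          rw [Nat.mul_add_mod, Nat.mod_eq_of_lt lt]
        · conv_lhs => rw [e]
          rw [Nat.mul_add_div (by omega), Nat.div_eq_of_lt lt, add_zero]
    rcases key A with ⟨a1, a2, a3⟩ | ⟨a1, a3⟩ <;> rcases key B with ⟨b1, b2, b3⟩ | ⟨b1, b3⟩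
    · rw [a3, b3] at d1; rw [b3] at d2; rw [a3] at d3
      exact ih _ _ ⟨d1, d2, d3⟩
    · omega
    · omega
    · omega

/-- a lattice point belongs to at most two cells -/
lemma not_three (hl : ∀ m, 5 ≤ l m) {n : ℕ} {p1 p2 p3 v : ℕ × ℕ} (h1 : p1 ∈ CF l n)
    (h2 : p2 ∈ CF l n) (h3 : p3 ∈ CF l n) (v1 : IsV v p1) (v2 : IsV v p2) (v3 : IsV v p3)
    (h12 : p1 ≠ p2) (h13 : p1 ≠ p3) (h23 : p2 ≠ p3) : False := by
  obtain ⟨a1, b1⟩ := p1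
  obtain ⟨a2, b2⟩ := p2
  obtain ⟨a3, b3⟩ := p3
  obtain ⟨a, b⟩ := v
  have key := not_three_aux hl n
  unfold IsV at v1 v2 v3
  simp only [Prod.mk.injEq, ne_eq] at v1 v2 v3 h12 h13 h23
  rcases v1 with ⟨rfl, rfl⟩ | ⟨rfl, rfl⟩ | ⟨rfl, rfl⟩ <;>
  rcases v2 with ⟨e1, e2⟩ | ⟨e1, e2⟩ | ⟨e1, e2⟩ <;>
  rcases v3 with ⟨f1, f2⟩ | ⟨f1, f2⟩ | ⟨f1, f2⟩ <;>
  first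
    | (exfalso; omega)
    | (subst_vars
       first
        | exact key _ _ ⟨h1, h2, h3⟩ | exact key _ _ ⟨h1, h3, h2⟩ | exact key _ _ ⟨h2, h1, h3⟩
        | exact key _ _ ⟨h2, h3, h1⟩ | exact key _ _ ⟨h3, h1, h2⟩ | exact key _ _ ⟨h3, h2, h1⟩)

/-- points of `K` in a cell lie in a child of that cell -/
lemma desc (hq : Equi q) (hl : ∀ m, 5 ≤ l m) {n : ℕ} {P : ℕ × ℕ} {x : E2}
    (hx : x ∈ Gasket q l) (hxP : x ∈ tri q l n P) :
    ∃ i ∈ SF (l n), x ∈ tri q l (n + 1) (ch (l n) P i) := by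
  obtain ⟨p, hp, hxp⟩ := (mem_K hl x).1 hx (n + 1)
  obtain ⟨P', hP', i, hi, rfl⟩ := mem_CF_succ.1 hp
  by_cases h : P = P'
  · subst h; exact ⟨i, hi, hxp⟩
  · obtain ⟨v, hv, -, rfl⟩ := tri_inter hq hl h hxP (tri_child_sub hl hi hxp)
    obtain ⟨i, hi, h⟩ := per_child hl (isV_per (q := q) (l := l) (n := n) hv)
    exact ⟨i, hi, per_sub_tri h⟩

lemma isClosed_tri (n : ℕ) (p : ℕ × ℕ) : IsClosed (tri q l n p) := by
  have hc : IsCompact {z : ℝ × ℝ | 0 ≤ z.1 ∧ 0 ≤ z.2 ∧ z.1 + z.2 ≤ 1} := by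
    apply (isCompact_Icc (a := ((0 : ℝ), (0 : ℝ))) (b := ((1 : ℝ), (1 : ℝ)))).of_isClosed_subset
    · exact (isClosed_le continuous_const continuous_fst).inter
        ((isClosed_le continuous_const continuous_snd).inter
          (isClosed_le (continuous_fst.add continuous_snd) continuous_const))
    · rintro ⟨a, b⟩ ⟨h1, h2, h3⟩
      simp only at h1 h2 h3
      exact ⟨⟨h1, h2⟩, ⟨by simp only; linarith, by simp only; linarith⟩⟩
  have : tri q l n p = (fun z : ℝ × ℝ => pt q ((p.1 + z.1) / Ln l n) ((p.2 + z.2) / Ln l n)) ''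
      {z : ℝ × ℝ | 0 ≤ z.1 ∧ 0 ≤ z.2 ∧ z.1 + z.2 ≤ 1} := by
    ext x; constructor
    · rintro ⟨a, b, h1, h2, h3, rfl⟩; exact ⟨(a, b), ⟨h1, h2, h3⟩, rfl⟩
    · rintro ⟨⟨a, b⟩, ⟨h1, h2, h3⟩, rfl⟩; exact ⟨a, b, h1, h2, h3, rfl⟩
  rw [this]
  refine (hc.image ?_).isClosed
  exact (continuous_pt q).comp (by fun_prop : Continuous (fun z : ℝ × ℝ =>
    (((p.1 + z.1) / Ln l n : ℝ), ((p.2 + z.2) / Ln l n : ℝ))))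

lemma isClosed_K (hl : ∀ m, 5 ≤ l m) : IsClosed (Gasket q l) := by
  have : Gasket q l = ⋂ n, ⋃ p ∈ CF l n, tri q l n p := by
    ext x; rw [mem_K hl]; simp
  rw [this]
  exact isClosed_iInter fun n => Set.Finite.isClosed_biUnion (CF l n).finite_toSet
    (fun p _ => isClosed_tri n p)

lemma tri_diam (hq : Equi q) (hl : ∀ m, 5 ≤ l m) {n : ℕ} {p : ℕ × ℕ} {x y : E2}
    (hx : x ∈ tri q l n p) (hy : y ∈ tri q l n p) : dist x y ≤ 1 / Ln l n := by
  have hL := Ln_pos hl n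
  obtain ⟨a, b, ha, hb, hab, rfl⟩ := hx
  obtain ⟨c, d, hc, hd, hcd, rfl⟩ := hy
  apply le_of_sq_le_sq _ (by positivity)
  rw [dist_pt_sq hq]
  have e : ((p.1 + a) / Ln l n - (p.1 + c) / Ln l n) ^ 2 +
      ((p.1 + a) / Ln l n - (p.1 + c) / Ln l n) * ((p.2 + b) / Ln l n - (p.2 + d) / Ln l n) +
      ((p.2 + b) / Ln l n - (p.2 + d) / Ln l n) ^ 2 =
      ((a - c) ^ 2 + (a - c) * (b - d) + (b - d) ^ 2) * (1 / (Ln l n : ℝ)) ^ 2 := by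
    field_simp; ring
  rw [e]
  have : (a - c) ^ 2 + (a - c) * (b - d) + (b - d) ^ 2 ≤ 1 := by
    rcases le_total a c with h | h <;> rcases le_total b d with h' | h' <;>
    rcases le_total (a + b) (c + d) with h'' | h'' <;> nlinarith
  have h2 : (0 : ℝ) ≤ (1 / (Ln l n : ℝ)) ^ 2 := by positivity
  nlinarith

lemma Ln_ge_pow (hl : ∀ m, 5 ≤ l m) (n k : ℕ) : (5 : ℝ) ^ k * Ln l n ≤ Ln l (n + k) := by
  induction k with
  | zero => simp
  | succ k ih =>
    rw [← add_assoc, Ln_succ]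
    have h1 := Ln_pos hl (n + k)
    have h2 := l_ge hl (n + k)
    have h3 := Ln_pos hl n
    rw [pow_succ]
    nlinarith

/-- `x` and `y` are joined by a path in `K` of length at most `c`. -/
def Cn (q : Fin 3 → E2) (l : ℕ → ℕ) (x y : E2) (c : ℝ) : Prop :=
  0 ≤ c ∧ ∃ γ : ℝ → E2, (∀ s t, dist (γ s) (γ t) ≤ |s - t|) ∧ (∀ t, γ t ∈ Gasket q l) ∧
    (∀ t ≤ 0, γ t = x) ∧ (∀ t, c ≤ t → γ t = y)

lemma Cn.mono {x y : E2} {c c' : ℝ} (h : Cn q l x y c) (hc : c ≤ c') : Cn q l x y c' := by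
  obtain ⟨h0, γ, h1, h2, h3, h4⟩ := h
  exact ⟨h0.trans hc, γ, h1, h2, h3, fun t ht => h4 t (hc.trans ht)⟩

lemma Cn.symm {x y : E2} {c : ℝ} (h : Cn q l x y c) : Cn q l y x c := by
  obtain ⟨h0, γ, h1, h2, h3, h4⟩ := h
  refine ⟨h0, fun t => γ (c - t), fun s t => ?_, fun t => h2 _, fun t ht => h4 _ (by linarith),
    fun t ht => h3 _ (by linarith)⟩
  refine (h1 _ _).trans (le_of_eq ?_)
  rw [show c - s - (c - t) = -(s - t) by ring, abs_neg]

lemma Cn.refl {x : E2} (hx : x ∈ Gasket q l) : Cn q l x x 0 :=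
  ⟨le_rfl, fun _ => x, fun s t => by simp, fun _ => hx, fun _ _ => rfl, fun _ _ => rfl⟩

/-- concatenation of functions -/
def glue (f g : ℝ → E2) (c : ℝ) (t : ℝ) : E2 := if t ≤ c then f t else g (t - c)

lemma glue_lip {f g : ℝ → E2} {c : ℝ} (hf : ∀ s t, dist (f s) (f t) ≤ |s - t|)
    (hg : ∀ s t, dist (g s) (g t) ≤ |s - t|) (h : f c = g 0) (s t : ℝ) :
    dist (glue f g c s) (glue f g c t) ≤ |s - t| := by
  wlog hst : s ≤ t with H
  · rw [dist_comm, abs_sub_comm]; exact H hf hg h t s (by linarith)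
  unfold glue
  by_cases h1 : s ≤ c <;> by_cases h2 : t ≤ c <;> simp only [h1, h2, if_true, if_false]
  · exact hf s t
  · push Not at h2
    calc dist (f s) (g (t - c)) ≤ dist (f s) (f c) + dist (f c) (g (t - c)) := dist_triangle _ _ _
      _ ≤ |s - c| + |0 - (t - c)| := by
          apply add_le_add (hf _ _); rw [h]; exact hg _ _
      _ = |s - t| := by
          rw [abs_of_nonpos (by linarith), abs_of_nonpos (by linarith), abs_of_nonpos (by linarith)]
          ring
  · exfalso; linarith
  · refine (hg _ _).trans (le_of_eq ?_); congr 1; ring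

lemma Cn.trans {x y z : E2} {c c' : ℝ} (h : Cn q l x y c) (h' : Cn q l y z c') :
    Cn q l x z (c + c') := by
  obtain ⟨h0, γ, h1, h2, h3, h4⟩ := h
  obtain ⟨h0', γ', h1', h2', h3', h4'⟩ := h'
  have hj : γ c = γ' 0 := by rw [h4 c le_rfl, h3' 0 le_rfl]
  refine ⟨by linarith, glue γ γ' c, glue_lip h1 h1' hj, ?_, ?_, ?_⟩
  · intro t; unfold glue; split_ifs; exacts [h2 _, h2' _]
  · intro t ht; unfold glue; rw [if_pos (by linarith)]; exact h3 t ht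
  · intro t ht; unfold glue
    split_ifs with hh
    · have : c' = 0 := by linarith
      have e : t = c := by linarith
      rw [e, hj]; exact h4' 0 (by linarith)
    · exact h4' _ (by linarith)

lemma Cn.seg {x y : E2} (h : segment ℝ x y ⊆ Gasket q l) : Cn q l x y (dist x y) := by
  by_cases hxy : x = y
  · subst hxy; rw [dist_self]; exact Cn.refl (h (left_mem_segment ℝ x x))
  have hd : 0 < dist x y := dist_pos.2 hxy
  set d := dist x y with hdd
  refine ⟨hd.le, fun t => x + (max 0 (min 1 (t / d))) • (y - x), fun s t => ?_, fun t => ?_, ?_, ?_⟩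
  · rw [dist_add_left, dist_eq_norm, ← sub_smul, norm_smul, ← dist_eq_norm y x, dist_comm y x, ← hdd,
      Real.norm_eq_abs]
    have : |max 0 (min 1 (s / d)) - max 0 (min 1 (t / d))| ≤ |s / d - t / d| := by
      have e1 := abs_max_sub_max_le_max 0 (min 1 (s / d)) 0 (min 1 (t / d))
      have e2 := abs_min_sub_min_le_max 1 (s / d) 1 (t / d)
      simp only [sub_self, abs_zero] at e1 e2
      rw [max_eq_right (abs_nonneg (min 1 (s / d) - min 1 (t / d)))] at e1
      rw [max_eq_right (abs_nonneg (s / d - t / d))] at e2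
      exact e1.trans e2
    rw [← sub_div, abs_div, abs_of_pos hd] at this
    calc _ ≤ |s - t| / d * d := by gcongr
      _ = |s - t| := by field_simp
  · apply h
    rw [segment_eq_image']
    exact ⟨_, ⟨le_max_left _ _, max_le (by norm_num) (min_le_left _ _)⟩, rfl⟩
  · intro t ht
    have : t / d ≤ 0 := div_nonpos_of_nonpos_of_nonneg ht hd.le
    simp only
    rw [max_eq_left ((min_le_right _ _).trans this)]; simp
  · intro t ht
    have : 1 ≤ t / d := by rwa [one_le_div hd]
    simp only
    rw [min_eq_left this]; simp

/-- infinite concatenation -/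
lemma Cn.lim (hK : IsClosed (Gasket q l)) {v : ℕ → E2} {c : ℕ → ℝ} {x : E2}
    (h : ∀ k, Cn q l (v k) (v (k + 1)) (c k)) (hx : Tendsto v atTop (nhds x))
    {S : ℝ} (hS : HasSum c S) : Cn q l (v 0) x S := by
  have hc0 : ∀ k, 0 ≤ c k := fun k => (h k).1
  choose _ γ h1 h2 h3 h4 using h
  let s : ℕ → ℝ := fun k => ∑ i ∈ Finset.range k, c i
  let G : ℕ → ℝ → E2 := fun k => Nat.rec (fun _ => v 0) (fun k f => glue f (γ k) (s k)) k
  have Gs : ∀ k, G (k + 1) = glue (G k) (γ k) (s k) := fun k => rfl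
  have s0 : ∀ k, 0 ≤ s k := fun k => Finset.sum_nonneg fun i _ => hc0 i
  have ss : ∀ k, s (k + 1) = s k + c k := fun k => Finset.sum_range_succ _ _
  have Gend : ∀ k t, s k ≤ t → G k t = v k := by
    intro k
    induction k with
    | zero => intro t _; rfl
    | succ k ih =>
      intro t ht
      rw [Gs]; unfold glue
      rw [ss] at ht
      split_ifs with hh
      · have e : t = s k := le_antisymm hh (by linarith [hc0 k])
        rw [ih t (by linarith)]
        rw [← h3 k 0 le_rfl]; exact h4 k 0 (by linarith)
      · exact h4 k _ (by linarith)
  have Gstart : ∀ k t, t ≤ 0 → G k t = v 0 := by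
    intro k
    induction k with
    | zero => intro t _; rfl
    | succ k ih => intro t ht; rw [Gs]; unfold glue; rw [if_pos (ht.trans (s0 k))]; exact ih t ht
  have Glip : ∀ k a b, dist (G k a) (G k b) ≤ |a - b| := by
    intro k
    induction k with
    | zero => intro a b; show dist (v 0) (v 0) ≤ _; simp
    | succ k ih =>
      rw [Gs]; exact glue_lip ih (h1 k) (by rw [Gend k _ le_rfl, h3 k 0 le_rfl])
  have v0K : v 0 ∈ Gasket q l := by rw [← h3 0 0 le_rfl]; exact h2 0 0
  have GK : ∀ k t, G k t ∈ Gasket q l := by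
    intro k
    induction k with
    | zero => intro t; exact v0K
    | succ k ih => intro t; rw [Gs]; unfold glue; split_ifs; exacts [ih _, h2 _ _]
  have Gstep : ∀ t k, dist (G k t) (G (k + 1) t) ≤ c k := by
    intro t k
    rw [Gs]; unfold glue
    split_ifs with hh
    · simpa using hc0 k
    · push Not at hh
      rw [Gend k t hh.le]
      have hv : v k = γ k 0 := (h3 k 0 le_rfl).symm
      by_cases h5 : t - s k ≤ c k
      · rw [hv]; refine (h1 k _ _).trans ?_
        rw [abs_of_nonpos (by linarith)]; linarith
      · push Not at h5
        rw [h4 k _ h5.le, hv, ← h4 k (c k) le_rfl]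
        refine (h1 k _ _).trans ?_
        rw [abs_of_nonpos (by linarith [hc0 k])]; linarith
  have Gc : ∀ t, ∃ y, Tendsto (fun k => G k t) atTop (nhds y) := fun t =>
    cauchySeq_tendsto_of_complete (cauchySeq_of_dist_le_of_summable c (Gstep t) hS.summable)
  choose g hg using Gc
  have sS : ∀ k, s k ≤ S := fun k => sum_le_hasSum _ (fun i _ => hc0 i) hS
  refine ⟨hS.nonneg hc0, g, fun a b => ?_, fun t => ?_, fun t ht => ?_, fun t ht => ?_⟩
  · exact le_of_tendsto ((hg a).dist (hg b)) (Eventually.of_forall fun k => Glip k a b)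
  · exact hK.mem_of_tendsto (hg t) (Eventually.of_forall fun k => GK k t)
  · refine tendsto_nhds_unique (hg t) ?_
    simp only [Gstart _ t ht]; exact tendsto_const_nhds
  · refine tendsto_nhds_unique (hg t) ?_
    have : ∀ k, G k t = v k := fun k => Gend k t ((sS k).trans ht)
    simp only [this]; exact hx

lemma Cn.pdist_le {x y : E2} {c : ℝ} (h : Cn q l x y c) : pdist q l x y ≤ ENNReal.ofReal c := by
  obtain ⟨h0, γ, h1, h2, h3, h4⟩ := h
  have hl : LipschitzWith (Real.toNNReal c) (fun t => γ (c * t)) := by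
    apply LipschitzWith.of_dist_le_mul
    intro s t
    refine (h1 _ _).trans ?_
    rw [← mul_sub, abs_mul, Real.coe_toNNReal c h0, abs_of_nonneg h0, Real.dist_eq]
  unfold pdist
  refine iInf_le_of_le (fun t => γ (c * t)) (iInf_le_of_le hl.continuous.continuousOn
    (iInf_le_of_le (fun t _ => h2 _) (iInf_le_of_le (by simpa using h3 0 le_rfl)
    (iInf_le_of_le (by simpa using h4 c le_rfl) ?_))))
  have := (hl.lipschitzOnWith (s := univ)).comp_eVariationOn_le (g := fun t : ℝ => t) (s := Icc 0 1)
    (fun _ _ => mem_univ _)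
  have hid : eVariationOn (fun t : ℝ => t) (Icc 0 1) ≤ ENNReal.ofReal (1 - 0) := by
    have := (monotone_id (α := ℝ)).monotoneOn (Icc 0 1) |>.eVariationOn_le (a := 0) (b := 1)
      (by simp) (by simp)
    simpa [Function.id_def] using this
  calc _ ≤ _ := this
    _ ≤ (Real.toNNReal c : ℝ≥0∞) * ENNReal.ofReal (1 - 0) := by gcongr
    _ = ENNReal.ofReal c := by simp [ENNReal.ofReal]

/-- point on side `i` of a cell with parameter `t` -/
def side (q : Fin 3 → E2) (l : ℕ → ℕ) (n : ℕ) (p : ℕ × ℕ) (i : Fin 3) (t : ℝ) : E2 :=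
  pt q ((p.1 + ![t, 1 - t, 0] i) / Ln l n) ((p.2 + ![0, t, 1 - t] i) / Ln l n)

lemma side_per {n : ℕ} {p : ℕ × ℕ} {i : Fin 3} {t : ℝ} (h0 : 0 ≤ t) (h1 : t ≤ 1) :
    side q l n p i t ∈ per q l n p := by
  refine ⟨_, _, ?_, ?_, ?_, ?_, rfl⟩ <;> fin_cases i <;> simp <;> linarith

lemma per_side {n : ℕ} {p : ℕ × ℕ} {x : E2} (h : x ∈ per q l n p) :
    ∃ i t, 0 ≤ t ∧ t ≤ 1 ∧ x = side q l n p i t := by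
  obtain ⟨a, b, ha, hb, hab, hc, rfl⟩ := h
  rcases hc with h | h | h
  · subst h
    exact ⟨2, 1 - b, by linarith, by linarith, by simp [side]⟩
  · subst h
    exact ⟨0, a, by linarith, by linarith, by simp [side]⟩
  · have : a = 1 - b := by linarith
    subst this
    exact ⟨1, b, by linarith, by linarith, by simp [side]⟩

lemma side_end {n : ℕ} {p : ℕ × ℕ} (i : Fin 3) : side q l n p i 1 = side q l n p (i + 1) 0 := by
  fin_cases i <;> simp [side]

lemma side_dist (hq : Equi q) (hl : ∀ m, 5 ≤ l m) {n : ℕ} {p : ℕ × ℕ} (i : Fin 3) (s t : ℝ) :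
    dist (side q l n p i s) (side q l n p i t) = |s - t| / Ln l n := by
  have hL := Ln_pos hl n
  rw [← abs_of_nonneg (a := dist _ _) dist_nonneg, ← abs_of_pos hL, ← abs_div, ← sq_eq_sq_iff_abs_eq_abs,
    side, side, dist_pt_sq hq]
  fin_cases i <;> simp <;> field_simp <;> ring

lemma side_cn (hq : Equi q) (hl : ∀ m, 5 ≤ l m) {n : ℕ} {p : ℕ × ℕ} (hp : p ∈ CF l n) (i : Fin 3)
    {s t : ℝ} (h0 : 0 ≤ s) (h1 : s ≤ 1) (h0' : 0 ≤ t) (h1' : t ≤ 1) :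
    Cn q l (side q l n p i s) (side q l n p i t) (|s - t| / Ln l n) := by
  rw [← side_dist hq hl]
  apply Cn.seg
  rintro x ⟨a, b, ha, hb, hab, rfl⟩
  have hL := Ln_pos hl n
  apply per_sub_K hl hp
  have : a • side q l n p i s + b • side q l n p i t = side q l n p i (a * s + b * t) := by
    unfold side; rw [pt_comb _ _ _ _ _ _ _ hab]
    have hb : b = 1 - a := by linarith
    subst hb
    congr 1 <;> fin_cases i <;> simp <;> field_simp <;> ring
  rw [this]
  exact side_per (by positivity) (by nlinarith)

lemma per_cn (hq : Equi q) (hl : ∀ m, 5 ≤ l m) {n : ℕ} {p : ℕ × ℕ} (hp : p ∈ CF l n) {x y : E2}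
    (hx : x ∈ per q l n p) (hy : y ∈ per q l n p) : Cn q l x y ((3 / 2) / Ln l n) := by
  have hL := Ln_pos hl n
  have adj : ∀ (i : Fin 3) (s t : ℝ), 0 ≤ s → s ≤ 1 → 0 ≤ t → t ≤ 1 →
      Cn q l (side q l n p i s) (side q l n p (i + 1) t) ((3 / 2) / Ln l n) := by
    intro i s t h0 h1 h0' h1'
    by_cases h : (1 - s) + t ≤ 3 / 2
    · have c1 := side_cn hq hl hp i h0 h1 zero_le_one le_rfl
      rw [side_end] at c1
      have c2 := side_cn hq hl hp (i + 1) le_rfl zero_le_one h0' h1'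
      refine (c1.trans c2).mono ?_
      rw [← add_div]
      rw [abs_of_nonpos (by linarith), abs_of_nonpos (by linarith)]
      gcongr; linarith
    · have c1 := side_cn hq hl hp i h0 h1 le_rfl zero_le_one
      have e : side q l n p i 0 = side q l n p (i + 1 + 1) 1 := by
        rw [side_end]; congr 1; fin_cases i <;> rfl
      rw [e] at c1
      have c2 := side_cn hq hl hp (i + 1 + 1) zero_le_one le_rfl le_rfl zero_le_one
      rw [← side_end (i + 1)] at c2
      have c3 := side_cn hq hl hp (i + 1) zero_le_one le_rfl h0' h1'
      refine ((c1.trans c2).trans c3).mono ?_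
      rw [← add_div, ← add_div]
      rw [abs_of_nonneg (by linarith : 0 ≤ s - 0), abs_of_nonneg (by linarith : 0 ≤ 1 - t)]
      gcongr; norm_num; linarith
  obtain ⟨i, s, h0, h1, rfl⟩ := per_side hx
  obtain ⟨j, t, h0', h1', rfl⟩ := per_side hy
  by_cases hij : i = j
  · subst hij
    refine (side_cn hq hl hp i h0 h1 h0' h1').mono ?_
    gcongr
    rw [abs_le]; constructor <;> linarith
  · have : j = i + 1 ∨ i = j + 1 := by
      clear hx hy
      revert i j; decide
    rcases this with rfl | rfl
    · exact adj _ _ _ h0 h1 h0' h1'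
    · exact (adj _ _ _ h0' h1' h0 h1).symm

/-- perimeter lattice index -/
def IsP (m : ℕ) (j : ℕ × ℕ) : Prop := j.1 + j.2 ≤ m ∧ (j.1 = 0 ∨ j.2 = 0 ∨ j.1 + j.2 = m)

lemma isP_per (hl : ∀ m, 5 ≤ l m) {n : ℕ} {P j : ℕ × ℕ} (h : IsP (l n) j) :
    lpt q l (n + 1) (ch (l n) P j) ∈ per q l n P := by
  have hL := Ln_pos hl n
  have h5 := l_ge hl n
  refine ⟨j.1 / l n, j.2 / l n, by positivity, by positivity, ?_, ?_, ?_⟩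
  · rw [← add_div, div_le_one (by linarith)]; exact_mod_cast h.1
  · rcases h.2 with h | h | h
    · left; simp [h]
    · right; left; simp [h]
    · right; right; rw [← add_div, div_eq_one_iff_eq (by linarith)]; exact_mod_cast h
  · unfold lpt ch
    have := coord_child hl n P.1 j.1 0
    have h' := coord_child hl n P.2 j.2 0
    simp only [add_zero] at this h'
    simp only [this, h']

lemma exists_isP {m : ℕ} (hm : 5 ≤ m) (P : ℕ × ℕ) {i : ℕ × ℕ} (hi : i ∈ SF m) :
    ∃ j, IsP m j ∧ IsV (ch m P j) (ch m P i) := by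
  rw [mem_SF' hm] at hi
  by_cases h : i.1 = 0 ∨ i.2 = 0
  · exact ⟨i, ⟨by omega, by tauto⟩, Or.inl rfl⟩
  · refine ⟨(i.1 + 1, i.2), ⟨?_, ?_⟩, Or.inr (Or.inl ?_)⟩
    · simp only; omega
    · simp only; omega
    · simp [ch, add_assoc]

lemma descSeq (hq : Equi q) (hl : ∀ m, 5 ≤ l m) {n : ℕ} {P v : ℕ × ℕ} {x : E2}
    (hx : x ∈ Gasket q l) (hP : P ∈ CF l n) (hxP : x ∈ tri q l n P) (hv : IsV v P) :
    ∃ c w : ℕ → ℕ × ℕ, c 0 = P ∧ w 0 = v ∧ (∀ k, c k ∈ CF l (n + k) ∧ x ∈ tri q l (n + k) (c k) ∧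
      IsV (w k) (c k)) ∧ ∀ k, (∃ i ∈ SF (l (n + k)), c (k + 1) = ch (l (n + k)) (c k) i) ∧
      ∃ j, IsP (l (n + k)) j ∧ w (k + 1) = ch (l (n + k)) (c k) j := by
  have step : ∀ k (z : (ℕ × ℕ) × (ℕ × ℕ)), ∃ z' : (ℕ × ℕ) × (ℕ × ℕ),
      (z.1 ∈ CF l (n + k) ∧ x ∈ tri q l (n + k) z.1 ∧ IsV z.2 z.1) →
      (z'.1 ∈ CF l (n + (k + 1)) ∧ x ∈ tri q l (n + (k + 1)) z'.1 ∧ IsV z'.2 z'.1) ∧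
      (∃ i ∈ SF (l (n + k)), z'.1 = ch (l (n + k)) z.1 i) ∧
      ∃ j, IsP (l (n + k)) j ∧ z'.2 = ch (l (n + k)) z.1 j := by
    intro k z
    by_cases h : (z.1 ∈ CF l (n + k) ∧ x ∈ tri q l (n + k) z.1 ∧ IsV z.2 z.1)
    · obtain ⟨i, hi, hxi⟩ := desc hq hl hx h.2.1
      obtain ⟨j, hj, hv⟩ := exists_isP (hl (n + k)) z.1 hi
      exact ⟨(ch (l (n + k)) z.1 i, ch (l (n + k)) z.1 j), fun _ =>
        ⟨⟨ch_mem h.1 hi, hxi, hv⟩, ⟨i, hi, rfl⟩, ⟨j, hj, rfl⟩⟩⟩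
    · exact ⟨z, fun h' => absurd h' h⟩
  choose F hF using step
  let S : ℕ → (ℕ × ℕ) × (ℕ × ℕ) := fun k => Nat.rec (P, v) (fun k z => F k z) k
  have hS : ∀ k, S (k + 1) = F k (S k) := fun k => rfl
  have inv : ∀ k, ((S k).1 ∈ CF l (n + k) ∧ x ∈ tri q l (n + k) (S k).1 ∧ IsV (S k).2 (S k).1) := by
    intro k
    induction k with
    | zero => exact ⟨hP, hxP, hv⟩
    | succ k ih => rw [hS]; exact (hF k _ ih).1
  refine ⟨fun k => (S k).1, fun k => (S k).2, rfl, rfl, inv, fun k => ?_⟩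
  exact (hF k _ (inv k)).2

lemma vert_cn (hq : Equi q) (hl : ∀ m, 5 ≤ l m) {n : ℕ} {P v : ℕ × ℕ} {x : E2}
    (hx : x ∈ Gasket q l) (hP : P ∈ CF l n) (hxP : x ∈ tri q l n P) (hv : IsV v P) :
    Cn q l (lpt q l n v) x (2 / Ln l n) := by
  obtain ⟨c, w, h0, w0, h1, h2⟩ := descSeq hq hl hx hP hxP hv
  have hL := Ln_pos hl n
  have step : ∀ k, Cn q l (lpt q l (n + k) (w k)) (lpt q l (n + (k + 1)) (w (k + 1)))
      ((3 / 2) / Ln l n * (1 / 5) ^ k) := by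
    intro k
    obtain ⟨-, j, hj, e⟩ := h2 k
    have := per_cn hq hl (h1 k).1 (isV_per (q := q) (l := l) (h1 k).2.2) (isP_per hl hj)
    rw [← e] at this
    refine this.mono ?_
    have g := Ln_ge_pow hl n k
    have : (5 : ℝ) ^ k > 0 := by positivity
    rw [one_div, inv_pow, ← div_eq_mul_inv, div_div (3 / 2 : ℝ)]
    rw [mul_comm] at g
    gcongr
  have hs : HasSum (fun k => (3 / 2) / Ln l n * (1 / 5 : ℝ) ^ k) ((3 / 2) / Ln l n * (1 - 1 / 5 : ℝ)⁻¹) :=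
    (hasSum_geometric_of_lt_one (by norm_num) (by norm_num)).mul_left _
  have ht : Tendsto (fun k => lpt q l (n + k) (w k)) atTop (nhds x) := by
    rw [tendsto_iff_dist_tendsto_zero]
    refine squeeze_zero (fun _ => dist_nonneg) (g := fun k => 1 / Ln l n * (1 / 5 : ℝ) ^ k) ?_ ?_
    · intro k
      refine (tri_diam hq hl (per_sub_tri (isV_per (h1 k).2.2)) (h1 k).2.1).trans ?_
      have g := Ln_ge_pow hl n k
      have : (5 : ℝ) ^ k > 0 := by positivity
      rw [one_div (5 : ℝ), inv_pow, ← div_eq_mul_inv, div_div]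
      gcongr
      linarith
    · have := (tendsto_pow_atTop_nhds_zero_of_lt_one (r := (1 / 5 : ℝ)) (by norm_num)
        (by norm_num)).const_mul (1 / (Ln l n : ℝ))
      simpa using this
  have := Cn.lim (isClosed_K hl) step ht hs
  simp only [add_zero, w0] at this
  refine this.mono ?_
  rw [div_mul_eq_mul_div]
  gcongr
  norm_num

lemma per_pt_cn (hq : Equi q) (hl : ∀ m, 5 ≤ l m) {n : ℕ} {P : ℕ × ℕ} {x y : E2}
    (hx : x ∈ Gasket q l) (hP : P ∈ CF l n) (hxP : x ∈ tri q l n P) (hy : y ∈ per q l n P) :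
    Cn q l x y (2 / Ln l (n + 1) + (3 / 2) / Ln l n) := by
  obtain ⟨i, hi, hxi⟩ := desc hq hl hx hxP
  obtain ⟨j, hj, hv⟩ := exists_isP (hl n) P hi
  exact (vert_cn hq hl hx (ch_mem hP hi) hxi hv).symm.trans (per_cn hq hl hP (isP_per hl hj) hy)

lemma cell_cn (hq : Equi q) (hl : ∀ m, 5 ≤ l m) {n : ℕ} {P : ℕ × ℕ} {x y : E2}
    (hx : x ∈ Gasket q l) (hP : P ∈ CF l n) (hxP : x ∈ tri q l n P) (hy : y ∈ Gasket q l)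
    (hyP : y ∈ tri q l n P) :
    Cn q l x y ((23 / 10) / Ln l n) := by
  obtain ⟨i, hi, hyi⟩ := desc hq hl hy hyP
  obtain ⟨j, hj, hv⟩ := exists_isP (hl n) P hi
  have h1 := per_pt_cn hq hl hx hP hxP (isP_per hl hj)
  have h2 := vert_cn hq hl hy (ch_mem hP hi) hyi hv
  refine (h1.trans h2).mono ?_
  have hL := Ln_pos hl n
  have h5 := l_ge hl n
  rw [Ln_succ]
  have : 2 / (Ln l n * (l n : ℝ)) ≤ (2 / 5) / Ln l n := by
    rw [div_div]; apply div_le_div_of_nonneg_left <;> nlinarith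
  calc _ ≤ (2 / 5) / (Ln l n : ℝ) + 3 / 2 / Ln l n + (2 / 5) / Ln l n := by gcongr
    _ = _ := by field_simp; norm_num

/-! distance -/

lemma mem_zero (hl : ∀ m, 5 ≤ l m) {x : E2} (hx : x ∈ Gasket q l) : x ∈ tri q l 0 (0, 0) := by
  obtain ⟨p, hp, h⟩ := (mem_K hl x).1 hx 0
  simp only [CF, Finset.mem_singleton] at hp
  rwa [hp] at h

lemma CF_zero (l : ℕ → ℕ) : (0, 0) ∈ CF l 0 := by simp [CF]

lemma pdist_ne_top (hq : Equi q) (hl : ∀ m, 5 ≤ l m) {x y : E2} (hx : x ∈ Gasket q l)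
    (hy : y ∈ Gasket q l) : pdist q l x y ≠ ⊤ :=
  ne_top_of_le_ne_top ENNReal.ofReal_ne_top
    (cell_cn hq hl hx (CF_zero l) (mem_zero hl hx) hy (mem_zero hl hy)).pdist_le

lemma Cn.gdist_le {x y : E2} {c : ℝ} (h : Cn q l x y c) : gdist q l x y ≤ c := by
  unfold gdist
  calc _ ≤ (ENNReal.ofReal c).toReal := ENNReal.toReal_mono ENNReal.ofReal_ne_top h.pdist_le
    _ = c := ENNReal.toReal_ofReal h.1

lemma gdist_nonneg (x y : E2) : 0 ≤ gdist q l x y := ENNReal.toReal_nonneg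

lemma gdist_self {x : E2} (hx : x ∈ Gasket q l) : gdist q l x x = 0 :=
  le_antisymm (Cn.refl hx).gdist_le (gdist_nonneg _ _)

/-- near-minimizing path -/
lemma exists_path (hq : Equi q) (hl : ∀ m, 5 ≤ l m) {x y : E2} (hx : x ∈ Gasket q l)
    (hy : y ∈ Gasket q l) {s : ℝ} (h : gdist q l x y < s) :
    ∃ γ : ℝ → E2, ContinuousOn γ (Icc 0 1) ∧ MapsTo γ (Icc 0 1) (Gasket q l) ∧ γ 0 = x ∧ γ 1 = y ∧
      eVariationOn γ (Icc 0 1) < ENNReal.ofReal s := by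
  have h0 := gdist_nonneg (q := q) (l := l) x y
  have : pdist q l x y < ENNReal.ofReal s := by
    rw [← ENNReal.ofReal_toReal (pdist_ne_top hq hl hx hy)]
    exact (ENNReal.ofReal_lt_ofReal_iff (by linarith)).2 h
  unfold pdist at this
  simp only [iInf_lt_iff] at this
  obtain ⟨γ, h1, h2, h3, h4, h5⟩ := this
  exact ⟨γ, h1, h2, h3, h4, h5⟩

lemma dist_le_gdist (hq : Equi q) (hl : ∀ m, 5 ≤ l m) {x y : E2} (hx : x ∈ Gasket q l)
    (hy : y ∈ Gasket q l) : dist x y ≤ gdist q l x y := by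
  apply le_of_forall_gt_imp_ge_of_dense
  intro s hs
  obtain ⟨γ, h1, h2, h3, h4, h5⟩ := exists_path hq hl hx hy hs
  have := eVariationOn.edist_le γ (s := Icc 0 1) (x := 0) (y := 1) (by simp) (by simp)
  rw [h3, h4, edist_dist] at this
  have h6 := this.trans h5.le
  have h0 := gdist_nonneg (q := q) (l := l) x y
  exact (ENNReal.ofReal_le_ofReal_iff (by linarith)).1 h6

lemma gdist_triangle (hq : Equi q) (hl : ∀ m, 5 ≤ l m) {x y z : E2}
    (hx : x ∈ Gasket q l) (hy : y ∈ Gasket q l)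
    (hz : z ∈ Gasket q l) : gdist q l x z ≤ gdist q l x y + gdist q l y z := by
  have h0 := gdist_nonneg (q := q) (l := l) x y
  have h0' := gdist_nonneg (q := q) (l := l) y z
  apply le_of_forall_pos_le_add
  intro ε hε
  obtain ⟨f, f1, f2, f3, f4, f5⟩ := exists_path hq hl hx hy (s := gdist q l x y + ε / 2) (by linarith)
  obtain ⟨g, g1, g2, g3, g4, g5⟩ := exists_path hq hl hy hz (s := gdist q l y z + ε / 2) (by linarith)
  let γ : ℝ → E2 := fun t => if t ≤ 1 / 2 then f (2 * t) else g (2 * t - 1)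
  have e1 : EqOn γ (f ∘ fun t => 2 * t) (Icc 0 (1 / 2)) := fun t ht => by
    simp only [γ, Function.comp, if_pos ht.2]
  have e2 : EqOn γ (g ∘ fun t => 2 * t - 1) (Icc (1 / 2) 1) := fun t ht => by
    simp only [γ, Function.comp]
    split_ifs with h
    · have : t = 1 / 2 := le_antisymm h ht.1
      subst this; norm_num; rw [f4, g3]
    · rfl
  have m1 : MapsTo (fun t : ℝ => 2 * t) (Icc 0 (1 / 2)) (Icc 0 1) := fun t ht =>
    ⟨by have := ht.1; simp only; linarith, by have := ht.2; simp only; linarith⟩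
  have m2 : MapsTo (fun t : ℝ => 2 * t - 1) (Icc (1 / 2) 1) (Icc 0 1) := fun t ht =>
    ⟨by have := ht.1; simp only; linarith, by have := ht.2; simp only; linarith⟩
  have hU : (Icc 0 1 : Set ℝ) = Icc 0 (1 / 2) ∪ Icc (1 / 2) 1 :=
    (Icc_union_Icc_eq_Icc (by norm_num) (by norm_num)).symm
  have hc : ContinuousOn γ (Icc 0 1) := by
    rw [hU]
    apply ContinuousOn.union_of_isClosed _ _ isClosed_Icc isClosed_Icc
    · exact (f1.comp (by fun_prop) m1).congr e1
    · exact (g1.comp (by fun_prop) m2).congr e2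
  have hm : MapsTo γ (Icc 0 1) (Gasket q l) := by
    intro t ht
    rw [hU] at ht
    rcases ht with ht | ht
    · rw [e1 ht]; exact f2 (m1 ht)
    · rw [e2 ht]; exact g2 (m2 ht)
  have v : eVariationOn γ (Icc 0 1) ≤ ENNReal.ofReal (gdist q l x y + gdist q l y z + ε) := by
    rw [hU, eVariationOn.union γ (x := 1 / 2) (isGreatest_Icc (by norm_num))
      (isLeast_Icc (by norm_num)), eVariationOn.eq_of_eqOn e1, eVariationOn.eq_of_eqOn e2]
    have a1 : eVariationOn (f ∘ fun t => 2 * t) (Icc 0 (1 / 2)) ≤ eVariationOn f (Icc 0 1) :=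
      eVariationOn.comp_le_of_monotoneOn f _ (fun a _ b _ h => by linarith) m1
    have a2 : eVariationOn (g ∘ fun t => 2 * t - 1) (Icc (1 / 2) 1) ≤ eVariationOn g (Icc 0 1) :=
      eVariationOn.comp_le_of_monotoneOn g _ (fun a _ b _ h => by linarith) m2
    calc _ ≤ ENNReal.ofReal (gdist q l x y + ε / 2) + ENNReal.ofReal (gdist q l y z + ε / 2) :=
          add_le_add (a1.trans f5.le) (a2.trans g5.le)
      _ = _ := by rw [← ENNReal.ofReal_add (by linarith) (by linarith)]; congr 1; ring
  have : pdist q l x z ≤ ENNReal.ofReal (gdist q l x y + gdist q l y z + ε) := by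
    unfold pdist
    refine iInf_le_of_le γ (iInf_le_of_le hc (iInf_le_of_le hm (iInf_le_of_le ?_
      (iInf_le_of_le ?_ v))))
    · simp [γ, f3]
    · simp only [γ]; norm_num; exact g4
  unfold gdist
  calc _ ≤ _ := ENNReal.toReal_mono ENNReal.ofReal_ne_top this
    _ = _ := ENNReal.toReal_ofReal (by linarith)

/-- chain of `k` steps from `p` (entered through `v`) to `p'`, visiting new cells from `P`. -/
def Ch : ℕ → Finset (ℕ × ℕ) → ℕ × ℕ → ℕ × ℕ → ℕ × ℕ → Prop
  | 0, _, _, p, p' => p = p'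
  | k + 1, P, v, p, p' => ∃ w p1, w ≠ v ∧ IsV w p ∧ IsV w p1 ∧ p1 ∈ P ∧ p1 ≠ p ∧
      Ch k (P.erase p1) w p1 p'

lemma lpt_dist (hq : Equi q) (hl : ∀ m, 5 ≤ l m) {n : ℕ} {v w : ℕ × ℕ} (h : v ≠ w) :
    1 / Ln l n ≤ dist (lpt q l n v) (lpt q l n w) := by
  have hL := Ln_pos hl n
  have e := dist_pt_sq hq (v.1 / Ln l n) (v.2 / Ln l n) (w.1 / Ln l n) (w.2 / Ln l n)
  apply le_of_sq_le_sq _ dist_nonneg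
  unfold lpt
  rw [e]
  have key : (1 : ℤ) ≤ ((v.1 : ℤ) - w.1) ^ 2 + ((v.1 : ℤ) - w.1) * (v.2 - w.2) + ((v.2 : ℤ) - w.2) ^ 2 := by
    by_contra hc
    push Not at hc
    have h1 : ((v.1 : ℤ) - w.1) = 0 := by
      nlinarith [sq_nonneg (((v.1 : ℤ) - w.1) + 2 * (v.2 - w.2)), sq_nonneg (((v.2 : ℤ) - w.2) + 2 * (v.1 - w.1))]
    rw [h1] at hc
    have h2 : ((v.2 : ℤ) - w.2) = 0 := by nlinarith
    exact h (Prod.ext (by omega) (by omega))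
  have key' : (1 : ℝ) ≤ ((v.1 : ℝ) - w.1) ^ 2 + ((v.1 : ℝ) - w.1) * (v.2 - w.2) + ((v.2 : ℝ) - w.2) ^ 2 := by
    exact_mod_cast key
  rw [show (v.1 / Ln l n - w.1 / Ln l n : ℝ) ^ 2 + (v.1 / Ln l n - w.1 / Ln l n) * (v.2 / Ln l n - w.2 / Ln l n) + (v.2 / Ln l n - w.2 / Ln l n) ^ 2 = (((v.1 : ℝ) - w.1) ^ 2 + ((v.1 : ℝ) - w.1) * (v.2 - w.2) + ((v.2 : ℝ) - w.2) ^ 2) * (1 / (Ln l n : ℝ)) ^ 2 by field_simp]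
  nlinarith [sq_nonneg (1 / (Ln l n : ℝ))]

lemma exit_step (hq : Equi q) (hl : ∀ m, 5 ≤ l m) {n : ℕ} {γ : ℝ → E2}
    (hc : ContinuousOn γ (Icc 0 1)) {P : Finset (ℕ × ℕ)} {p : ℕ × ℕ} {a : ℝ} (ha : a ∈ Icc (0 : ℝ) 1)
    (hp : p ∉ P) (hap : γ a ∈ tri q l n p)
    (hcov : ∀ t ∈ Ioc a 1, γ t ∈ tri q l n p ∨ ∃ p' ∈ P, γ t ∈ tri q l n p') :
    γ 1 ∈ tri q l n p ∨ ∃ b ∈ Icc a 1, ∃ p1 ∈ P, ∃ w, IsV w p ∧ IsV w p1 ∧ γ b = lpt q l n w ∧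
      ∀ t ∈ Ioc b 1, ∃ p' ∈ P, γ t ∈ tri q l n p' := by
  by_cases h1 : γ 1 ∈ tri q l n p
  · exact Or.inl h1
  right
  have hca : ContinuousOn γ (Icc a 1) := hc.mono (Icc_subset_Icc_left ha.1)
  have hcl : IsClosed (Icc a 1 ∩ γ ⁻¹' (tri q l n p)) :=
    hca.preimage_isClosed_of_isClosed isClosed_Icc (isClosed_tri n p)
  have hcpt : IsCompact (Icc a 1 ∩ γ ⁻¹' (tri q l n p)) :=
    isCompact_Icc.of_isClosed_subset hcl inter_subset_left
  obtain ⟨b, ⟨hb, hbp⟩, hmax⟩ := hcpt.exists_isGreatest ⟨a, ⟨le_rfl, ha.2⟩, hap⟩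
  have hb1 : b < 1 := lt_of_le_of_ne hb.2 (fun e => h1 (by rw [← e]; exact hbp))
  have hafter : ∀ t ∈ Ioc b 1, ∃ p' ∈ P, γ t ∈ tri q l n p' := by
    intro t ht
    rcases hcov t ⟨hb.1.trans_lt ht.1, ht.2⟩ with h | h
    · exact absurd (hmax ⟨⟨hb.1.trans ht.1.le, ht.2⟩, h⟩) (not_le.2 ht.1)
    · exact h
  have hcl2 : IsClosed (⋃ p' ∈ P, tri q l n p') :=
    Set.Finite.isClosed_biUnion P.finite_toSet (fun p _ => isClosed_tri n p)
  have hlim : γ b ∈ ⋃ p' ∈ P, tri q l n p' := by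
    have ht : Tendsto γ (nhdsWithin b (Ioc b 1)) (nhds (γ b)) :=
      ((hca b hb).mono (fun t ht => ⟨hb.1.trans ht.1.le, ht.2⟩))
    have : (nhdsWithin b (Ioc b 1)).NeBot := by
      rw [nhdsWithin_Ioc_eq_nhdsGT hb1]; infer_instance
    refine hcl2.mem_of_tendsto ht ?_
    filter_upwards [self_mem_nhdsWithin] with t ht
    obtain ⟨p', hp', h⟩ := hafter t ht
    exact mem_biUnion hp' h
  simp only [mem_iUnion, exists_prop] at hlim
  obtain ⟨p1, hp1, hbp1⟩ := hlim
  obtain ⟨w, hw, hw1, e⟩ := tri_inter hq hl (fun e => hp (by rw [e]; exact hp1)) hbp hbp1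
  exact ⟨b, hb, p1, hp1, w, hw, hw1, e, hafter⟩

lemma chain_aux (hq : Equi q) (hl : ∀ m, 5 ≤ l m) {n : ℕ} {γ : ℝ → E2}
    (hc : ContinuousOn γ (Icc 0 1)) : ∀ (N : ℕ) (P : Finset (ℕ × ℕ)), P.card ≤ N → P ⊆ CF l n →
    ∀ (p v : ℕ × ℕ) (a : ℝ), a ∈ Icc (0 : ℝ) 1 → p ∈ CF l n → p ∉ P → IsV v p →
    γ a = lpt q l n v → (∀ p' ∈ P, ¬ IsV v p') →
    (∀ t ∈ Ioc a 1, γ t ∈ tri q l n p ∨ ∃ p' ∈ P, γ t ∈ tri q l n p') →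
    ∃ k p', Ch k P v p p' ∧ γ 1 ∈ tri q l n p' ∧
      ENNReal.ofReal (k / Ln l n) ≤ eVariationOn γ (Icc a 1) := by
  intro N
  induction N with
  | zero =>
    intro P hP0 hPs p v a ha hp hpP hv hav hvP hcov
    have : P = ∅ := by simpa using hP0
    subst this
    refine ⟨0, p, rfl, ?_, by simp⟩
    rcases eq_or_lt_of_le ha.2 with h | h
    · rw [← h, hav]; exact per_sub_tri (isV_per hv)
    · rcases hcov 1 ⟨h, le_rfl⟩ with h | ⟨p', hp', _⟩
      · exact h
      · simp at hp'
  | succ N ih =>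
    intro P hP0 hPs p v a ha hp hpP hv hav hvP hcov
    have hap : γ a ∈ tri q l n p := by rw [hav]; exact per_sub_tri (isV_per hv)
    rcases exit_step hq hl hc ha hpP hap hcov with h | ⟨b, hb, p1, hp1, w, hw, hw1, e, haft⟩
    · exact ⟨0, p, rfl, h, by simp⟩
    have hne : p1 ≠ p := fun e => hpP (e ▸ hp1)
    have hwv : w ≠ v := fun e => hvP p1 hp1 (e ▸ hw1)
    obtain ⟨k, p', hk, h1, hvar⟩ := ih (P.erase p1) (by rw [Finset.card_erase_of_mem hp1]; omega)
      ((Finset.erase_subset _ _).trans hPs) p1 w b ⟨ha.1.trans hb.1, hb.2⟩ (hPs hp1)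
      (Finset.notMem_erase _ _) hw1 e (by
        intro p2 hp2 hv2
        rw [Finset.mem_erase] at hp2
        exact not_three hl hp (hPs hp1) (hPs hp2.2) hw hw1 hv2 hne.symm
          (fun e => hpP (e ▸ hp2.2)) hp2.1.symm)
      (by
        intro t ht
        obtain ⟨p', hp', h⟩ := haft t ht
        by_cases e : p' = p1
        · left; rw [← e]; exact h
        · right; exact ⟨p', Finset.mem_erase.2 ⟨e, hp'⟩, h⟩)
    refine ⟨k + 1, p', ⟨w, p1, hwv, hw, hw1, hp1, hne, hk⟩, h1, ?_⟩
    have hL := Ln_pos hl n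
    have hs : eVariationOn γ (Icc a 1) = eVariationOn γ (Icc a b) + eVariationOn γ (Icc b 1) := by
      rw [← Icc_union_Icc_eq_Icc hb.1 hb.2]
      exact eVariationOn.union γ (isGreatest_Icc hb.1) (isLeast_Icc hb.2)
    have hd : ENNReal.ofReal (1 / Ln l n) ≤ eVariationOn γ (Icc a b) := by
      refine le_trans ?_ (eVariationOn.edist_le γ (x := a) (y := b) (by simp [hb.1]) (by simp [hb.1]))
      rw [edist_dist, hav, e]
      exact ENNReal.ofReal_le_ofReal (lpt_dist hq hl hwv.symm)
    rw [hs]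
    push_cast
    rw [add_div, add_comm, ENNReal.ofReal_add (by positivity) (by positivity)]
    exact add_le_add hd hvar

lemma chain_path (hq : Equi q) (hl : ∀ m, 5 ≤ l m) {n : ℕ} {x y : E2} (hx : x ∈ Gasket q l)
    (hy : y ∈ Gasket q l) {s : ℝ} (hs : gdist q l x y < s) {p v : ℕ × ℕ} (hp : p ∈ CF l n)
    (hxp : x ∈ tri q l n p) (hv : ¬ IsV v p) :
    ∃ k p', Ch k ((CF l n).erase p) v p p' ∧ y ∈ tri q l n p' ∧ (k : ℝ) < Ln l n * s + 1 := by
  obtain ⟨γ, hc, hm, h0, h1, hvar⟩ := exists_path hq hl hx hy hs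
  have hL := Ln_pos hl n
  have hs0 : 0 < s := (gdist_nonneg x y).trans_lt hs
  have cov : ∀ t ∈ Icc (0 : ℝ) 1, γ t ∈ tri q l n p ∨ ∃ p' ∈ (CF l n).erase p, γ t ∈ tri q l n p' := by
    intro t ht
    obtain ⟨p', hp', h⟩ := (mem_K hl _).1 (hm ht) n
    by_cases e : p' = p
    · left; rw [← e]; exact h
    · right; exact ⟨p', Finset.mem_erase.2 ⟨e, hp'⟩, h⟩
  rcases exit_step hq hl hc (a := 0) (by simp) (Finset.notMem_erase p (CF l n))
    (by rw [h0]; exact hxp) (fun t ht => cov t ⟨ht.1.le, ht.2⟩) with h | ⟨b, hb, p1, hp1, w, hw, hw1, e, haft⟩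
  · exact ⟨0, p, rfl, by rw [← h1]; exact h, by push_cast; positivity⟩
  have hp1' := Finset.mem_erase.1 hp1
  obtain ⟨k, p', hk, h1', hvar'⟩ := chain_aux hq hl hc _ (((CF l n).erase p).erase p1) le_rfl
    ((Finset.erase_subset _ _).trans (Finset.erase_subset _ _)) p1 w b hb hp1'.2
    (Finset.notMem_erase _ _) hw1 e (by
        intro p2 hp2 hv2
        rw [Finset.mem_erase, Finset.mem_erase] at hp2
        exact not_three hl hp hp1'.2 hp2.2.2 hw hw1 hv2 hp1'.1.symm hp2.2.1.symm hp2.1.symm)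
      (by
        intro t ht
        obtain ⟨p', hp', h⟩ := haft t ht
        by_cases e : p' = p1
        · left; rw [← e]; exact h
        · right; exact ⟨p', Finset.mem_erase.2 ⟨e, hp'⟩, h⟩)
  refine ⟨k + 1, p', ⟨w, p1, fun e => hv (e ▸ hw), hw, hw1, hp1, hp1'.1, hk⟩, by rw [← h1]; exact h1', ?_⟩
  have : ENNReal.ofReal (k / Ln l n) < ENNReal.ofReal s :=
    (hvar'.trans (eVariationOn.mono γ (Icc_subset_Icc_left hb.1))).trans_lt hvar
  rw [ENNReal.ofReal_lt_ofReal_iff hs0, div_lt_iff₀ hL] at this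
  push_cast
  linarith

/-! counting -/

lemma isV_card (p : ℕ × ℕ) (v : ℕ × ℕ) (hv : IsV v p) :
    ∃ S : Finset (ℕ × ℕ), S.card ≤ 2 ∧ ∀ w, IsV w p → w ≠ v → w ∈ S := by
  refine ⟨({p, (p.1 + 1, p.2), (p.1, p.2 + 1)} : Finset (ℕ × ℕ)).erase v, ?_, ?_⟩
  · rw [Finset.card_erase_of_mem]
    · have := Finset.card_le_three (a := p) (b := (p.1 + 1, p.2)) (c := (p.1, p.2 + 1))
      omega
    · unfold IsV at hv; simp; tauto
  · intro w hw hne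
    unfold IsV at hw; simp [hne]; tauto

lemma reach_card (hl : ∀ m, 5 ≤ l m) {n : ℕ} (k : ℕ) : ∀ p v, p ∈ CF l n → IsV v p →
    ∃ S : Finset (ℕ × ℕ), S.card ≤ 2 ^ k ∧ ∀ P ⊆ CF l n, ∀ p', Ch k P v p p' → p' ∈ S := by
  induction k with
  | zero => intro p v _ _; exact ⟨{p}, by simp, fun P _ p' h => by simp [Ch] at h; simp [h]⟩
  | succ k ih =>
    intro p v hp hv
    obtain ⟨S, hS, hS'⟩ := isV_card p v hv
    have : ∀ w, ∃ T : Finset (ℕ × ℕ), T.card ≤ 2 ^ k ∧ ∀ P ⊆ CF l n, ∀ p1 p', IsV w p → IsV w p1 →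
        p1 ∈ P → p1 ≠ p → Ch k (P.erase p1) w p1 p' → p' ∈ T := by
      intro w
      by_cases h : ∃ p1 ∈ CF l n, p1 ≠ p ∧ IsV w p ∧ IsV w p1
      · obtain ⟨p1, h1, h2, h3, h4⟩ := h
        obtain ⟨T, hT, hT'⟩ := ih p1 w h1 h4
        refine ⟨T, hT, fun P hP p2 p' a b c d e => ?_⟩
        by_cases h5 : p2 = p1
        · subst h5; exact hT' _ ((Finset.erase_subset _ _).trans hP) _ e
        · exact (not_three hl hp h1 (hP c) h3 h4 b h2.symm d.symm (Ne.symm h5)).elim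
      · exact ⟨∅, by simp, fun P hP p1 p' a b c d e => (h ⟨p1, hP c, d, a, b⟩).elim⟩
    choose T hT hT' using this
    refine ⟨S.biUnion T, ?_, ?_⟩
    · refine (Finset.card_biUnion_le_card_mul _ _ _ (fun w _ => hT w)).trans ?_
      rw [pow_succ, mul_comm]; gcongr
    · rintro P hP p' ⟨w, p1, h1, h2, h3, h4, h5, h6⟩
      exact Finset.mem_biUnion.2 ⟨w, hS' w h2 h1, hT' w P hP p1 p' h2 h3 h4 h5 h6⟩

lemma reach_card_start (hl : ∀ m, 5 ≤ l m) {n : ℕ} (k : ℕ) (p v : ℕ × ℕ) (hp : p ∈ CF l n) :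
    ∃ S : Finset (ℕ × ℕ), S.card ≤ 3 * 2 ^ k - 2 ∧ ∀ P ⊆ CF l n, ∀ p', ∀ k' ≤ k,
      Ch k' P v p p' → p' ∈ S := by
  induction k with
  | zero =>
    refine ⟨{p}, by simp, fun P _ p' k' hk h => ?_⟩
    obtain rfl : k' = 0 := by omega
    simp [Ch] at h; simp [h]
  | succ k ih =>
    obtain ⟨S0, hS0, hS0'⟩ := ih
    have : ∀ w, ∃ T : Finset (ℕ × ℕ), T.card ≤ 2 ^ k ∧ ∀ P ⊆ CF l n, ∀ p1 p', IsV w p → IsV w p1 →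
        p1 ∈ P → p1 ≠ p → Ch k (P.erase p1) w p1 p' → p' ∈ T := by
      intro w
      by_cases h : ∃ p1 ∈ CF l n, p1 ≠ p ∧ IsV w p ∧ IsV w p1
      · obtain ⟨p1, h1, h2, h3, h4⟩ := h
        obtain ⟨T, hT, hT'⟩ := reach_card hl k p1 w h1 h4
        refine ⟨T, hT, fun P hP p2 p' a b c d e => ?_⟩
        by_cases h5 : p2 = p1
        · subst h5; exact hT' _ ((Finset.erase_subset _ _).trans hP) _ e
        · exact (not_three hl hp h1 (hP c) h3 h4 b h2.symm d.symm (Ne.symm h5)).elim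
      · exact ⟨∅, by simp, fun P hP p1 p' a b c d e => (h ⟨p1, hP c, d, a, b⟩).elim⟩
    choose T hT hT' using this
    refine ⟨S0 ∪ ({p, (p.1 + 1, p.2), (p.1, p.2 + 1)} : Finset (ℕ × ℕ)).biUnion T, ?_, ?_⟩
    · refine (Finset.card_union_le _ _).trans ?_
      have h1 := Finset.card_biUnion_le_card_mul ({p, (p.1 + 1, p.2), (p.1, p.2 + 1)} : Finset (ℕ × ℕ))
        T (2 ^ k) (fun w _ => hT w)
      have h2 := Finset.card_le_three (a := p) (b := (p.1 + 1, p.2)) (c := (p.1, p.2 + 1))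
      have h3 := Nat.mul_le_mul_right (2 ^ k) h2
      have h4 : 1 ≤ 2 ^ k := Nat.one_le_two_pow
      rw [pow_succ]
      omega
    · intro P hP p' k' hk h
      rcases Nat.lt_or_ge k' (k + 1) with h' | h'
      · exact Finset.mem_union_left _ (hS0' P hP p' k' (by omega) h)
      · obtain rfl : k' = k + 1 := by omega
        obtain ⟨w, p1, h1, h2, h3, h4, h5, h6⟩ := h
        refine Finset.mem_union_right _ (Finset.mem_biUnion.2 ⟨w, ?_, hT' w P hP p1 p' h2 h3 h4 h5 h6⟩)
        unfold IsV at h2; simpa using h2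

/-- cells meeting the ball: `k` integer with `L s ≤ k` -/
lemma ball_cells (hq : Equi q) (hl : ∀ m, 5 ≤ l m) (n : ℕ) {x : E2} (hx : x ∈ Gasket q l) {s : ℝ}
    {k : ℕ} (hk : Ln l n * s ≤ k) :
    ∃ S : Finset (ℕ × ℕ), S ⊆ CF l n ∧ S.card ≤ 3 * 2 ^ k - 2 ∧ ∀ y ∈ Bd q l x s, ∃ p ∈ S, y ∈ tri q l n p := by
  obtain ⟨p, hp, hxp⟩ := (mem_K hl x).1 hx n
  obtain ⟨S, hS, hS'⟩ := reach_card_start hl k p (p.1 + 2, p.2) hp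
  have hv : ¬ IsV (p.1 + 2, p.2) p := by unfold IsV; simp [Prod.ext_iff]
  refine ⟨S ∩ CF l n, Finset.inter_subset_right, (Finset.card_le_card Finset.inter_subset_left).trans hS, ?_⟩
  rintro y ⟨hy, hys⟩
  obtain ⟨k', p', h1, h2, h3⟩ := chain_path hq hl hx hy hys hp hxp hv
  have hk' : k' ≤ k := by
    have : (k' : ℝ) < k + 1 := by linarith
    exact Nat.lt_succ_iff.1 (by exact_mod_cast this)
  have hin : ∀ k P v p, p ∈ CF l n → P ⊆ CF l n → Ch k P v p p' → p' ∈ CF l n := by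
    intro k
    induction k with
    | zero => intro P v p hp hP h; simp [Ch] at h; exact h ▸ hp
    | succ k ih =>
      rintro P v p hp hP ⟨w, p1, a1, a2, a3, a4, a5, a6⟩
      exact ih _ _ _ (hP a4) ((Finset.erase_subset _ _).trans hP) a6
  exact ⟨p', Finset.mem_inter.2 ⟨hS' _ (Finset.erase_subset _ _) p' k' hk' h1,
    hin _ _ _ _ hp (Finset.erase_subset _ _) h1⟩, h2⟩

lemma sum_SF {m : ℕ} (hm : 5 ≤ m) (f : ℕ × ℕ → ℝ) :
    ∑ i ∈ SF m, f i = ∑ k ∈ Finset.range (m - 1), (f (k, 0) + f (m - 1 - k, k) + f (0, m - 1 - k)) := by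
  rw [Finset.sum_add_distrib, Finset.sum_add_distrib]
  have e : SF m = ((Finset.range (m - 1)).image (fun k => (k, 0)) ∪
      (Finset.range (m - 1)).image (fun k => (m - 1 - k, k))) ∪
      (Finset.range (m - 1)).image (fun k => (0, m - 1 - k)) := by
    ext ⟨a, b⟩
    rw [mem_SF' hm]
    simp only [Finset.mem_union, Finset.mem_image, Finset.mem_range, Prod.mk.injEq]
    constructor
    · rintro ⟨h1, h2⟩
      by_cases hb : b = 0 ∧ a < m - 1
      · exact Or.inl (Or.inl ⟨a, hb.2, rfl, hb.1.symm⟩)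
      · by_cases hab : a + b = m - 1 ∧ b < m - 1
        · exact Or.inl (Or.inr ⟨b, hab.2, by omega, rfl⟩)
        · exact Or.inr ⟨m - 1 - b, by omega, by omega, by omega⟩
    · rintro ((⟨k, h1, h2, h3⟩ | ⟨k, h1, h2, h3⟩) | ⟨k, h1, h2, h3⟩) <;> omega
  rw [e, Finset.sum_union, Finset.sum_union, Finset.sum_image, Finset.sum_image, Finset.sum_image]
  · intro a ha b hb h; simp only [Finset.coe_range, mem_Iio, Prod.mk.injEq] at *; omega
  · intro a ha b hb h; simp only [Finset.coe_range, mem_Iio, Prod.mk.injEq] at *; omega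
  · intro a ha b hb h; simp only [Finset.coe_range, mem_Iio, Prod.mk.injEq] at *; omega
  · rw [Finset.disjoint_left]
    rintro ⟨a, b⟩ h1 h2
    simp only [Finset.mem_image, Finset.mem_range, Prod.mk.injEq] at h1 h2
    obtain ⟨k, h1, h3, h4⟩ := h1
    obtain ⟨k', h1', h3', h4'⟩ := h2
    omega
  · rw [Finset.disjoint_left]
    rintro ⟨a, b⟩ h1 h2
    simp only [Finset.mem_union, Finset.mem_image, Finset.mem_range, Prod.mk.injEq] at h1 h2
    obtain ⟨k', h1', h3', h4'⟩ := h2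
    rcases h1 with ⟨k, h1, h3, h4⟩ | ⟨k, h1, h3, h4⟩ <;> omega

lemma Mn_succ (hl : ∀ m, 5 ≤ l m) (n : ℕ) : (Mn l (n + 1) : ℝ) = Mn l n * (3 * l n - 3) := by
  unfold Mn; rw [Finset.prod_range_succ]
  have := hl n
  push_cast [Nat.cast_sub (by omega : 3 ≤ 3 * l n)]
  ring

lemma Mn_pos (hl : ∀ m, 5 ≤ l m) (n : ℕ) : (0 : ℝ) < Mn l n := by
  unfold Mn; exact_mod_cast Finset.prod_pos (fun k _ => by have := hl k; omega)

lemma Mn_zero (l : ℕ → ℕ) : (Mn l 0 : ℝ) = 1 := by simp [Mn]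

lemma card_CF (hl : ∀ m, 5 ≤ l m) (n : ℕ) : ((CF l n).card : ℝ) = Mn l n := by
  induction n with
  | zero => simp [CF, Mn]
  | succ n ih =>
    have h := sum_CF_succ hl n (fun _ => 1)
    simp only [sum_SF (hl n), Finset.sum_const, Finset.card_range, nsmul_eq_mul, mul_one, ih] at h
    rw [h, Mn_succ hl]
    have := hl n
    push_cast [Nat.cast_sub (by omega : 1 ≤ l n)]
    ring

section meas
variable {μ : Measure E2}

lemma meas_K (hl : ∀ m, 5 ≤ l m) (hμ : IsUnif q l μ) : μ (Gasket q l) = 1 := by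
  have := unif_cell hl hμ (CF_zero l)
  have e : Gasket q l ∩ tri q l 0 (0, 0) = Gasket q l :=
    inter_eq_left.2 (fun x hx => mem_zero hl hx)
  rw [e] at this
  simpa [Mn] using this

lemma meas_le_one (hl : ∀ m, 5 ≤ l m) (hμ : IsUnif q l μ) {B : Set E2} (hB : B ⊆ Gasket q l) :
    μ B ≤ 1 := (measure_mono hB).trans (meas_K hl hμ).le

lemma meas_le_card (hl : ∀ m, 5 ≤ l m) (hμ : IsUnif q l μ) {B : Set E2} (hB : B ⊆ Gasket q l) {n : ℕ}
    {S : Finset (ℕ × ℕ)} (hS : S ⊆ CF l n) (h : ∀ y ∈ B, ∃ p ∈ S, y ∈ tri q l n p) :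
    (μ B).toReal ≤ (S.card : ℝ) * (Mn l n : ℝ)⁻¹ := by
  have h1 : μ B ≤ (S.card : ℝ≥0∞) * (Mn l n : ℝ≥0∞)⁻¹ := by
    calc μ B ≤ μ (⋃ p ∈ S, Gasket q l ∩ tri q l n p) := by
          apply measure_mono
          intro y hy
          obtain ⟨p, hp, h'⟩ := h y hy
          exact mem_biUnion hp ⟨hB hy, h'⟩
      _ ≤ ∑ p ∈ S, μ (Gasket q l ∩ tri q l n p) := measure_biUnion_finset_le _ _
      _ = ∑ p ∈ S, (Mn l n : ℝ≥0∞)⁻¹ := Finset.sum_congr rfl fun p hp => unif_cell hl hμ (hS hp)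
      _ = _ := by rw [Finset.sum_const, nsmul_eq_mul]
  have hM : (Mn l n : ℝ≥0∞) ≠ 0 := by
    have := Mn_pos hl n
    have h2 : 0 < Mn l n := by exact_mod_cast this
    exact_mod_cast h2.ne'
  have h2 := ENNReal.toReal_mono (by
    apply ENNReal.mul_ne_top (ENNReal.natCast_ne_top _); simpa using hM) h1
  simpa using h2

lemma meas_ge_card (hl : ∀ m, 5 ≤ l m) (hμ : IsUnif q l μ) {B : Set E2} (hB : B ⊆ Gasket q l) {n : ℕ}
    {S : Finset (ℕ × ℕ)} (hS : S ⊆ CF l n) (h : ∀ p ∈ S, Gasket q l ∩ tri q l n p ⊆ B) :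
    (S.card : ℝ) * (Mn l n : ℝ)⁻¹ ≤ (μ B).toReal := by
  have h1 := meas_le_card hl hμ (B := Gasket q l \ B) sdiff_subset (S := CF l n \ S)
    Finset.sdiff_subset (by
      rintro y ⟨hy, hyB⟩
      obtain ⟨p, hp, hyp⟩ := (mem_K hl y).1 hy n
      refine ⟨p, Finset.mem_sdiff.2 ⟨hp, fun hpS => hyB (h p hpS ⟨hy, hyp⟩)⟩, hyp⟩)
  have h2 : (1 : ℝ) ≤ (μ B).toReal + (μ (Gasket q l \ B)).toReal := by
    have h3 : (1 : ℝ≥0∞) ≤ μ B + μ (Gasket q l \ B) := by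
      rw [← meas_K hl hμ]
      refine (measure_mono ?_).trans (measure_union_le _ _)
      rw [union_sdiff_self]; exact subset_union_right
    have hb := meas_le_one hl hμ hB
    have hb' := meas_le_one hl hμ (B := Gasket q l \ B) sdiff_subset
    have t1 : μ B ≠ ⊤ := ne_top_of_le_ne_top ENNReal.one_ne_top hb
    have t2 : μ (Gasket q l \ B) ≠ ⊤ := ne_top_of_le_ne_top ENNReal.one_ne_top hb'
    rw [← ENNReal.toReal_add t1 t2]
    simpa using ENNReal.toReal_mono (ENNReal.add_ne_top.2 ⟨t1, t2⟩) h3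
  have h3 : ((CF l n \ S).card : ℝ) = Mn l n - S.card := by
    rw [← card_CF hl n, Finset.card_sdiff_of_subset hS, Nat.cast_sub (Finset.card_le_card hS)]
  have hM := Mn_pos hl n
  rw [h3, sub_mul, mul_inv_cancel₀ hM.ne'] at h1
  linarith
end meas

/-- index of the `k`-th cell on side `j` -/
def sx (m : ℕ) (j : Fin 3) (k : ℕ) : ℕ × ℕ := (![k, m - 1 - k, 0] j, ![0, k, m - 1 - k] j)

lemma sx_mem {m : ℕ} (hm : 5 ≤ m) (j : Fin 3) {k : ℕ} (hk : k < m) : sx m j k ∈ SF m := by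
  rw [mem_SF' hm]; fin_cases j <;> simp [sx] <;> omega

lemma exists_sx {m : ℕ} (hm : 5 ≤ m) {i : ℕ × ℕ} (hi : i ∈ SF m) : ∃ j, ∃ k < m, i = sx m j k := by
  rw [mem_SF' hm] at hi
  obtain ⟨a, b⟩ := i
  simp only at hi
  by_cases h : b = 0
  · exact ⟨0, a, by omega, by simp [sx, h]⟩
  · by_cases h' : a = 0
    · exact ⟨2, m - 1 - b, by omega, by simp [sx, h']; omega⟩
    · exact ⟨1, b, by omega, by simp [sx]; omega⟩

lemma sx_inj {m : ℕ} {j : Fin 3} {k k' : ℕ} (hk : k < m) (hk' : k' < m) (h : sx m j k = sx m j k') :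
    k = k' := by
  fin_cases j <;> simp [sx] at h <;> omega

/-- lattice point with parameter `k` on side `j` -/
def sv (m : ℕ) (j : Fin 3) (k : ℕ) : ℕ × ℕ := (![k, m - k, 0] j, ![0, k, m - k] j)

lemma sv_isP {m : ℕ} (j : Fin 3) {k : ℕ} (hk : k ≤ m) : IsP m (sv m j k) := by
  fin_cases j <;> simp [IsP, sv] <;> omega

lemma sv_isV {m : ℕ} (j : Fin 3) {k : ℕ} (hk : k < m) (P : ℕ × ℕ) :
    IsV (ch m P (sv m j k)) (ch m P (sx m j k)) ∧ IsV (ch m P (sv m j (k + 1))) (ch m P (sx m j k)) := by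
  fin_cases j <;> simp [IsV, sv, sx, ch] <;> omega

lemma sv_side (hl : ∀ m, 5 ≤ l m) {n : ℕ} (P : ℕ × ℕ) (j : Fin 3) {k : ℕ} (hk : k ≤ l n) :
    lpt q l (n + 1) (ch (l n) P (sv (l n) j k)) = side q l n P j (k / l n) := by
  have h5 := l_ge hl n
  have hL := Ln_pos hl n
  unfold lpt side ch
  have c1 := fun i => coord_child hl n P.1 i 0
  have c2 := fun i => coord_child hl n P.2 i 0
  simp only [add_zero] at c1 c2
  simp only [c1, c2]
  congr 2 <;> fin_cases j <;> simp [sv, Nat.cast_sub hk] <;> field_simp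

lemma side_cell_cn (hq : Equi q) (hl : ∀ m, 5 ≤ l m) {n : ℕ} {P : ℕ × ℕ} (hP : P ∈ CF l n) (j : Fin 3)
    {k k' : ℕ} (hkk : k < k') (hk' : k' < l n) {x y : E2} (hx : x ∈ Gasket q l) (hy : y ∈ Gasket q l)
    (hxk : x ∈ tri q l (n + 1) (ch (l n) P (sx (l n) j k)))
    (hyk : y ∈ tri q l (n + 1) (ch (l n) P (sx (l n) j k'))) :
    Cn q l x y (((k' : ℝ) - k + 3) / Ln l (n + 1)) := by
  have h5 := l_ge hl n
  have hL := Ln_pos hl n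
  have hk : k < l n := by omega
  have c1 := vert_cn hq hl hx (ch_mem hP (sx_mem (hl n) j hk)) hxk (sv_isV j hk P).2
  have c2 := vert_cn hq hl hy (ch_mem hP (sx_mem (hl n) j hk')) hyk (sv_isV j hk' P).1
  rw [sv_side hl P j (by omega)] at c1 c2
  have hk'r : (k' : ℝ) ≤ l n := by exact_mod_cast hk'.le
  have hkr : ((k + 1 : ℕ) : ℝ) ≤ l n := by exact_mod_cast hk
  have c3 := side_cn hq hl hP j (s := ((k + 1 : ℕ) : ℝ) / l n) (t := (k' : ℝ) / l n) (by positivity)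
    (by rw [div_le_one (by linarith)]; exact hkr)
    (by positivity) (by rw [div_le_one (by linarith)]; exact hk'r)
  refine ((c1.symm.trans c3).trans c2).mono (le_of_eq ?_)
  rw [← sub_div, abs_div, abs_of_nonpos (by push_cast; have : ((k : ℝ) + 1) ≤ k' := (by exact_mod_cast hkk)
                                            linarith), abs_of_pos (by linarith : (0 : ℝ) < l n), Ln_succ]
  push_cast
  field_simp
  ring

lemma side_cell_cn' (hq : Equi q) (hl : ∀ m, 5 ≤ l m) {n : ℕ} {P : ℕ × ℕ} (hP : P ∈ CF l n) (j : Fin 3)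
    {k k' : ℕ} (hk : k < l n) (hk' : k' < l n) {x y : E2} (hx : x ∈ Gasket q l) (hy : y ∈ Gasket q l)
    (hxk : x ∈ tri q l (n + 1) (ch (l n) P (sx (l n) j k)))
    (hyk : y ∈ tri q l (n + 1) (ch (l n) P (sx (l n) j k'))) {r : ℕ} (h1 : k ≤ k' + r) (h2 : k' ≤ k + r) :
    Cn q l x y (((r : ℝ) + 3) / Ln l (n + 1)) := by
  have hL := Ln_pos hl (n + 1)
  rcases lt_trichotomy k k' with h | h | h
  · refine (side_cell_cn hq hl hP j h hk' hx hy hxk hyk).mono ?_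
    have : (k' : ℝ) ≤ k + r := by exact_mod_cast h2
    gcongr; linarith
  · subst h
    refine (cell_cn hq hl hx (ch_mem hP (sx_mem (hl n) j hk)) hxk hy hyk).mono ?_
    gcongr
    have : (0 : ℝ) ≤ r := by positivity
    linarith
  · refine (side_cell_cn hq hl hP j h hk hy hx hyk hxk).symm.mono ?_
    have : (k : ℝ) ≤ k' + r := by exact_mod_cast h1
    gcongr; linarith

lemma window {m k r : ℕ} (hk : k < m) (hr : r + 1 ≤ m) :
    ∃ S : Finset ℕ, S.card = r + 1 ∧ ∀ k' ∈ S, k' < m ∧ k ≤ k' + r ∧ k' ≤ k + r := by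
  by_cases h : r ≤ k
  · exact ⟨Finset.Icc (k - r) k, by simp; omega, fun k' hk' => by simp at hk'; omega⟩
  · exact ⟨Finset.Icc 0 r, by simp, fun k' hk' => by simp at hk'; omega⟩

section meas2
variable {μ : Measure E2}

lemma low_side (hq : Equi q) (hl : ∀ m, 5 ≤ l m) (hμ : IsUnif q l μ) (n : ℕ) {x : E2}
    (hx : x ∈ Gasket q l) {s : ℝ} {r : ℕ} (hr : r + 1 ≤ l n) (hs : (r : ℝ) + 3 < Ln l (n + 1) * s) :
    ((r : ℝ) + 1) * (Mn l (n + 1) : ℝ)⁻¹ ≤ (μ (Bd q l x s)).toReal := by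
  obtain ⟨P, hP, hxP⟩ := (mem_K hl x).1 hx n
  obtain ⟨i, hi, hxi⟩ := desc hq hl hx hxP
  obtain ⟨j, k, hk, rfl⟩ := exists_sx (hl n) hi
  obtain ⟨W, hW, hW'⟩ := window hk hr
  have hL := Ln_pos hl (n + 1)
  have := meas_ge_card hl hμ (B := Bd q l x s) (fun y hy => hy.1) (n := n + 1)
    (S := W.image (fun k' => ch (l n) P (sx (l n) j k'))) (by
      intro p hp
      obtain ⟨k', hk', rfl⟩ := Finset.mem_image.1 hp
      exact ch_mem hP (sx_mem (hl n) j (hW' k' hk').1)) (by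
      rintro p hp y ⟨hy, hyp⟩
      obtain ⟨k', hk', rfl⟩ := Finset.mem_image.1 hp
      obtain ⟨a1, a2, a3⟩ := hW' k' hk'
      refine ⟨hy, (side_cell_cn' hq hl hP j hk a1 hx hy hxi hyp a2 a3).gdist_le.trans_lt ?_⟩
      rw [div_lt_iff₀ hL]; linarith)
  rw [Finset.card_image_of_injOn, hW] at this
  · push_cast at this; exact this
  · intro a ha b hb h
    exact sx_inj (hW' a ha).1 (hW' b hb).1
      (ch_inj (hl n) (sx_mem (hl n) j (hW' a ha).1) (sx_mem (hl n) j (hW' b hb).1) h).2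

lemma low_cell (hq : Equi q) (hl : ∀ m, 5 ≤ l m) (hμ : IsUnif q l μ) (n : ℕ) {x : E2}
    (hx : x ∈ Gasket q l) {s : ℝ} (hs : 23 / 10 < Ln l n * s) :
    (Mn l n : ℝ)⁻¹ ≤ (μ (Bd q l x s)).toReal := by
  obtain ⟨P, hP, hxP⟩ := (mem_K hl x).1 hx n
  have hL := Ln_pos hl n
  have := meas_ge_card hl hμ (B := Bd q l x s) (fun y hy => hy.1) (n := n)
    (S := {P}) (by simpa using hP) (by
      rintro p hp y ⟨hy, hyp⟩
      rw [Finset.mem_singleton] at hp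
      subst hp
      refine ⟨hy, (cell_cn hq hl hx hP hxP hy hyp).gdist_le.trans_lt ?_⟩
      rw [div_lt_iff₀ hL]; linarith)
  simpa using this

lemma low_a (hq : Equi q) (hl : ∀ m, 5 ≤ l m) (hμ : IsUnif q l μ) (n : ℕ) {x : E2}
    (hx : x ∈ Gasket q l) {s : ℝ} (hs : 1 ≤ Ln l n * s) :
    1 / 6 * (Mn l n : ℝ)⁻¹ ≤ (μ (Bd q l x s)).toReal := by
  have h5 := l_ge hl n
  have h5' := hl n
  have hM := Mn_pos hl n
  have e : ((l n - 4 : ℕ) : ℝ) = l n - 4 := by rw [Nat.cast_sub (by omega)]; norm_num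
  refine le_trans ?_ (low_side hq hl hμ n hx (r := l n - 4) (by omega) ?_)
  · rw [Mn_succ hl, mul_inv, mul_comm _ ((3 * (l n : ℝ) - 3)⁻¹), ← mul_assoc]
    gcongr
    rw [← div_eq_mul_inv, div_le_div_iff₀ (by norm_num) (by linarith), e]
    linarith
  · rw [e, Ln_succ]; nlinarith

lemma low_b (hq : Equi q) (hl : ∀ m, 5 ≤ l m) (hμ : IsUnif q l μ) (n : ℕ) {x : E2}
    (hx : x ∈ Gasket q l) {s : ℝ} (hs : 3 / 2 < Ln l n * s) :
    1 / 3 * (Mn l n : ℝ)⁻¹ ≤ (μ (Bd q l x s)).toReal := by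
  have h5 := l_ge hl n
  have h5' := hl n
  have hM := Mn_pos hl n
  have e : ((l n - 1 : ℕ) : ℝ) = l n - 1 := by rw [Nat.cast_sub (by omega)]; norm_num
  refine le_trans ?_ (low_side hq hl hμ n hx (r := l n - 1) (by omega) ?_)
  · rw [Mn_succ hl, mul_inv, mul_comm _ ((3 * (l n : ℝ) - 3)⁻¹), ← mul_assoc]
    gcongr
    rw [← div_eq_mul_inv, div_le_div_iff₀ (by norm_num) (by linarith), e]
    linarith
  · rw [e, Ln_succ]; nlinarith

/-- lower bound, `t = L_{n+1} s` -/
lemma low_main (hq : Equi q) (hl : ∀ m, 5 ≤ l m) (hμ : IsUnif q l μ) (n : ℕ) {x : E2}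
    (hx : x ∈ Gasket q l) {s : ℝ} (hs : 1 ≤ Ln l (n + 1) * s) (hs' : Ln l (n + 1) * s ≤ l n) :
    1 / 16 * ((Mn l (n + 1) : ℝ)⁻¹ * (3 * (Ln l (n + 1) * s) - 2)) ≤ (μ (Bd q l x s)).toReal := by
  set t := Ln l (n + 1) * s with ht
  have hM := Mn_pos hl (n + 1)
  have hM' : 0 < (Mn l (n + 1) : ℝ)⁻¹ := by positivity
  by_cases h1 : t ≤ 3 / 2
  · refine le_trans ?_ (low_a hq hl hμ (n + 1) hx hs)
    nlinarith
  push Not at h1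
  by_cases h2 : t ≤ 23 / 10
  · refine le_trans ?_ (low_b hq hl hμ (n + 1) hx h1)
    nlinarith
  push Not at h2
  by_cases h3 : t ≤ 6
  · refine le_trans ?_ (low_cell hq hl hμ (n + 1) hx h2)
    nlinarith
  push Not at h3
  have c1 : t ≤ ⌈t⌉₊ := Nat.le_ceil t
  have c2 : (⌈t⌉₊ : ℝ) < t + 1 := Nat.ceil_lt_add_one (by linarith)
  have c3 : ⌈t⌉₊ ≤ l n := Nat.ceil_le.2 hs'
  have c4 : 6 ≤ ⌈t⌉₊ := by
    have : (6 : ℝ) ≤ ⌈t⌉₊ := by linarith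
    exact_mod_cast this
  have e : ((⌈t⌉₊ - 4 : ℕ) : ℝ) = ⌈t⌉₊ - 4 := by rw [Nat.cast_sub (by omega)]; norm_num
  refine le_trans ?_ (low_side hq hl hμ n hx (r := ⌈t⌉₊ - 4) (by omega) ?_)
  · rw [e]; nlinarith
  · rw [e]; linarith
end meas2

lemma card_interval (m : ℕ) (C t : ℝ) (ht : 0 ≤ t) :
    (((Finset.range m).filter (fun k : ℕ => C - t - 1 < k ∧ (k : ℝ) < C + t)).card : ℝ) ≤ 2 * t + 2 := by
  have h : (((Finset.range m).filter (fun k : ℕ => C - t - 1 < k ∧ (k : ℝ) < C + t)).image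
      (fun k : ℕ => (k : ℤ))) ⊆ Finset.Icc (⌊C - t - 1⌋ + 1) (⌈C + t⌉ - 1) := by
    intro z hz
    simp only [Finset.mem_image, Finset.mem_filter] at hz
    obtain ⟨k, ⟨-, h1, h2⟩, rfl⟩ := hz
    rw [Finset.mem_Icc]
    constructor
    · have : ⌊C - t - 1⌋ < (k : ℤ) := Int.floor_lt.2 (by exact_mod_cast h1)
      omega
    · have : (k : ℤ) < ⌈C + t⌉ := Int.lt_ceil.2 (by exact_mod_cast h2)
      omega
  have h2 := Finset.card_le_card h
  rw [Finset.card_image_of_injective _ Nat.cast_injective, Int.card_Icc] at h2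
  have h3 := Int.ceil_lt_add_one (C + t)
  have h4 := Int.lt_floor_add_one (C - t - 1)
  have h5 : ((⌈C + t⌉ - 1 + 1 - (⌊C - t - 1⌋ + 1)).toNat : ℝ) ≤ 2 * t + 2 := by
    rcases le_total 0 (⌈C + t⌉ - 1 + 1 - (⌊C - t - 1⌋ + 1)) with h | h
    · have : (((⌈C + t⌉ - 1 + 1 - (⌊C - t - 1⌋ + 1)).toNat : ℤ) : ℝ) =
        ((⌈C + t⌉ - 1 + 1 - (⌊C - t - 1⌋ + 1) : ℤ) : ℝ) := by rw [Int.toNat_of_nonneg h]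
      rw [Int.cast_natCast] at this
      rw [this]; push_cast; linarith
    · rw [Int.toNat_of_nonpos h]; push_cast; linarith
  exact le_trans (by exact_mod_cast h2) h5

lemma quad1 {a b t : ℝ} (h : a ^ 2 + a * b + b ^ 2 < t ^ 2) : (a + b / 2) ^ 2 < t ^ 2 := by
  nlinarith [sq_nonneg b]

lemma quad2 {a b t : ℝ} (h : a ^ 2 + a * b + b ^ 2 < t ^ 2) : ((a - b) / 2) ^ 2 < t ^ 2 := by
  nlinarith [sq_nonneg (a + b)]

lemma quad3 {a b t : ℝ} (h : a ^ 2 + a * b + b ^ 2 < t ^ 2) : (a / 2 + b) ^ 2 < t ^ 2 := by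
  nlinarith [sq_nonneg a]

/-- cells on one side of `P` meeting a Euclidean ball -/
lemma side_count (hq : Equi q) (hl : ∀ m, 5 ≤ l m) (n : ℕ) (P : ℕ × ℕ) (j : Fin 3) {x : E2}
    (hx : x ∈ Gasket q l) {s : ℝ} (hs : 0 ≤ s) :
    ∃ S : Finset ℕ, (S.card : ℝ) ≤ 2 * (Ln l (n + 1) * s) + 2 ∧ (∀ k ∈ S, k < l n) ∧
      ∀ k < l n, ∀ y ∈ tri q l (n + 1) (ch (l n) P (sx (l n) j k)), dist x y < s → k ∈ S := by
  obtain ⟨p, -, X, Y, -, -, -, rfl⟩ := (mem_K hl x).1 hx (n + 1)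
  have hL := Ln_pos hl (n + 1)
  set L : ℝ := ((Ln l (n + 1) : ℕ) : ℝ) with hLd
  set A : ℝ := p.1 + X with hA
  set B : ℝ := p.2 + Y with hB
  have key : ∀ A' B' : ℝ, dist (pt q (A / L) (B / L)) (pt q (A' / L) (B' / L)) < s →
      (A - A') ^ 2 + (A - A') * (B - B') + (B - B') ^ 2 < (L * s) ^ 2 := by
    intro A' B' h
    have h1 : dist (pt q (A / L) (B / L)) (pt q (A' / L) (B' / L)) ^ 2 < s ^ 2 :=
      pow_lt_pow_left₀ h dist_nonneg (by norm_num)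
    rw [dist_pt_sq hq] at h1
    have h2 : (A / L - A' / L) ^ 2 + (A / L - A' / L) * (B / L - B' / L) + (B / L - B' / L) ^ 2 =
      ((A - A') ^ 2 + (A - A') * (B - B') + (B - B') ^ 2) / L ^ 2 := by field_simp
    rw [h2, div_lt_iff₀ (by positivity)] at h1
    nlinarith
  set t := L * s with ht
  have ht0 : 0 ≤ t := by positivity
  let C : ℝ := ![(A - l n * P.1) + (B - l n * P.2) / 2,
    ((B - l n * P.2) - (A - l n * P.1) + l n) / 2,
    l n - 1 / 2 - ((B - l n * P.2) + (A - l n * P.1) / 2) + 1 / 2] j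
  refine ⟨(Finset.range (l n)).filter (fun k : ℕ => C - t - 1 < k ∧ (k : ℝ) < C + t), card_interval _ _ _ ht0,
    fun k hk => by simp at hk; exact hk.1, ?_⟩
  rintro k hk y ⟨a, b, ha, hb, hab, rfl⟩ hd
  have h := key _ _ hd
  simp only [Finset.mem_filter, Finset.mem_range]
  refine ⟨hk, ?_⟩
  have hkc : ((l n - 1 - k : ℕ) : ℝ) = l n - 1 - k := by
    rw [Nat.cast_sub (by omega), Nat.cast_sub (by omega)]; norm_num
  fin_cases j
  · simp only [C, ch, sx] at *
    simp at h ⊢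
    have h2 := quad1 h
    have h3 := abs_lt_of_sq_lt_sq' h2 ht0
    constructor <;> linarith [h3.1, h3.2]
  · simp only [C, ch, sx] at *
    simp [hkc] at h ⊢
    have h2 := quad2 h
    have h3 := abs_lt_of_sq_lt_sq' h2 ht0
    constructor <;> linarith [h3.1, h3.2]
  · simp only [C, ch, sx] at *
    simp [hkc] at h ⊢
    have h2 := quad3 h
    have h3 := abs_lt_of_sq_lt_sq' h2 ht0
    constructor <;> linarith [h3.1, h3.2]

lemma big_count (hq : Equi q) (hl : ∀ m, 5 ≤ l m) (n : ℕ) {x : E2} (hx : x ∈ Gasket q l) {s : ℝ}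
    (hs0 : 0 ≤ s) (hs : Ln l n * s ≤ 1) :
    ∃ S : Finset (ℕ × ℕ), S ⊆ CF l (n + 1) ∧ (S.card : ℝ) ≤ 24 * (Ln l (n + 1) * s) + 24 ∧
      ∀ y ∈ Bd q l x s, ∃ p ∈ S, y ∈ tri q l (n + 1) p := by
  obtain ⟨S, hS, hc, hcov⟩ := ball_cells hq hl n hx (s := s) (k := 1) (by simpa using hs)
  choose T hT hT1 hT2 using fun (P : ℕ × ℕ) (j : Fin 3) => side_count hq hl n P j hx hs0
  let U : ℕ × ℕ → Finset (ℕ × ℕ) := fun P => (Finset.univ : Finset (Fin 3)).biUnion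
    fun j => (T P j).image fun k => ch (l n) P (sx (l n) j k)
  have hU : ∀ P, ((U P).card : ℝ) ≤ 3 * (2 * (Ln l (n + 1) * s) + 2) := by
    intro P
    have h1 : ((U P).card : ℝ) ≤ ∑ j : Fin 3, ((T P j).card : ℝ) := by
      have : (U P).card ≤ ∑ j : Fin 3, (T P j).card :=
        Finset.card_biUnion_le.trans (Finset.sum_le_sum fun j _ => Finset.card_image_le)
      exact_mod_cast this
    refine h1.trans ((Finset.sum_le_sum fun j _ => hT P j).trans ?_)
    simp
    linarith
  refine ⟨S.biUnion U, ?_, ?_, ?_⟩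
  · intro p hp
    simp only [U, Finset.mem_biUnion, Finset.mem_image, Finset.mem_univ, true_and] at hp
    obtain ⟨P, hP, j, k, hk, rfl⟩ := hp
    exact ch_mem (hS hP) (sx_mem (hl n) j (hT1 P j k hk))
  · have h1 : ((S.biUnion U).card : ℝ) ≤ ∑ P ∈ S, ((U P).card : ℝ) := by
      exact_mod_cast Finset.card_biUnion_le
    refine h1.trans ((Finset.sum_le_sum fun P _ => hU P).trans ?_)
    rw [Finset.sum_const, nsmul_eq_mul]
    have hL := Ln_pos hl (n + 1)
    have : (S.card : ℝ) ≤ 4 := by exact_mod_cast hc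
    have h0 : 0 ≤ Ln l (n + 1) * s := by positivity
    nlinarith
  · intro y hy
    obtain ⟨P, hP, hyP⟩ := hcov y hy
    obtain ⟨i, hi, hyi⟩ := desc hq hl hy.1 hyP
    obtain ⟨j, k, hk, rfl⟩ := exists_sx (hl n) hi
    refine ⟨_, ?_, hyi⟩
    simp only [U, Finset.mem_biUnion, Finset.mem_image, Finset.mem_univ, true_and]
    exact ⟨P, hP, j, k, hT2 P j k hk y hyi ((dist_le_gdist hq hl hx hy.1).trans_lt hy.2), rfl⟩

lemma up_count (hq : Equi q) (hl : ∀ m, 5 ≤ l m) (n : ℕ) {x : E2} (hx : x ∈ Gasket q l) {s : ℝ}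
    (hs : 1 ≤ Ln l (n + 1) * s) (hs' : Ln l (n + 1) * s ≤ l n) :
    ∃ S : Finset (ℕ × ℕ), S ⊆ CF l (n + 1) ∧ (S.card : ℝ) ≤ 12 * (1 + 11 / 4 * (Ln l (n + 1) * s - 1)) ∧
      ∀ y ∈ Bd q l x s, ∃ p ∈ S, y ∈ tri q l (n + 1) p := by
  have sm : ∀ k : ℕ, Ln l (n + 1) * s ≤ k → (((3 * 2 ^ k - 2 : ℕ)) : ℝ) ≤ 12 * (1 + 11 / 4 * (Ln l (n + 1) * s - 1)) →
    ∃ S : Finset (ℕ × ℕ), S ⊆ CF l (n + 1) ∧ (S.card : ℝ) ≤ 12 * (1 + 11 / 4 * (Ln l (n + 1) * s - 1)) ∧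
      ∀ y ∈ Bd q l x s, ∃ p ∈ S, y ∈ tri q l (n + 1) p := by
    intro k hk h
    obtain ⟨S, h1, h2, h3⟩ := ball_cells hq hl (n + 1) hx hk
    exact ⟨S, h1, le_trans (by exact_mod_cast h2) h, h3⟩
  by_cases h1 : Ln l (n + 1) * s ≤ 2
  · exact sm 2 (by simpa using h1) (by norm_num; linarith)
  by_cases h2 : Ln l (n + 1) * s ≤ 3
  · exact sm 3 (by simpa using h2) (by norm_num; linarith)
  by_cases h3 : Ln l (n + 1) * s ≤ 4
  · exact sm 4 (by simpa using h3) (by norm_num; linarith)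
  by_cases h4 : Ln l (n + 1) * s ≤ 5
  · exact sm 5 (by simpa using h4) (by norm_num; linarith)
  have hL := Ln_pos hl (n + 1)
  have hL' := Ln_pos hl n
  have h5 := l_ge hl n
  have hs0 : 0 ≤ s := by
    by_contra h; push Not at h; nlinarith
  obtain ⟨S, h1, h2, h3⟩ := big_count hq hl n hx hs0 (by
    rw [Ln_succ] at hs'
    have : (Ln l n * s) * l n ≤ 1 * l n := by linarith
    exact le_of_mul_le_mul_right this (by linarith))
  exact ⟨S, h1, by linarith, h3⟩

lemma up_main (hq : Equi q) (hl : ∀ m, 5 ≤ l m) {μ : Measure E2} (hμ : IsUnif q l μ) (n : ℕ) {x : E2}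
    (hx : x ∈ Gasket q l) {s : ℝ} (hs : 1 ≤ Ln l (n + 1) * s) (hs' : Ln l (n + 1) * s ≤ l n) :
    (μ (Bd q l x s)).toReal ≤ 12 * ((Mn l (n + 1) : ℝ)⁻¹ * (1 + 11 / 4 * (Ln l (n + 1) * s - 1))) := by
  obtain ⟨S, h1, h2, h3⟩ := up_count hq hl n hx hs hs'
  have hM := Mn_pos hl (n + 1)
  refine (meas_le_card hl hμ (fun y hy => hy.1) h1 h3).trans ?_
  rw [mul_left_comm, mul_comm ((S.card : ℝ))]
  gcongr

lemma exists_scale (hl : ∀ m, 5 ≤ l m) {s : ℝ} (hs : 0 < s) (hs1 : s ≤ 1) :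
    ∃ n, 1 ≤ (Ln l (n + 1) : ℝ) * s ∧ (Ln l n : ℝ) * s ≤ 1 := by
  have hex : ∃ n, 1 ≤ (Ln l (n + 1) : ℝ) * s := by
    obtain ⟨n, hn⟩ := pow_unbounded_of_one_lt s⁻¹ (by norm_num : (1 : ℝ) < 5)
    refine ⟨n, ?_⟩
    have h := Ln_ge_pow hl 0 (n + 1)
    rw [Ln_zero, mul_one, zero_add] at h
    have h2 : s⁻¹ ≤ Ln l (n + 1) := by
      have : (5 : ℝ) ^ n ≤ 5 ^ (n + 1) := pow_le_pow_right₀ (by norm_num) (by omega)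
      linarith
    have := mul_le_mul_of_nonneg_right h2 hs.le
    rwa [inv_mul_cancel₀ hs.ne'] at this
  classical
  refine ⟨Nat.find hex, Nat.find_spec hex, ?_⟩
  by_cases h0 : Nat.find hex = 0
  · rw [h0, Ln_zero]; linarith
  · obtain ⟨k, hk⟩ := Nat.exists_eq_succ_of_ne_zero h0
    have := Nat.find_min hex (m := k) (by omega)
    rw [hk]
    exact (not_le.1 this).le

lemma scale_inv (hl : ∀ m, 5 ≤ l m) {s : ℝ} {n : ℕ} (h1 : 1 ≤ (Ln l (n + 1) : ℝ) * s)
    (h2 : (Ln l n : ℝ) * s ≤ 1) :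
    ((Ln l (n + 1) : ℝ))⁻¹ ≤ s ∧ s ≤ ((Ln l n : ℝ))⁻¹ ∧ (Ln l (n + 1) : ℝ) * s ≤ l n := by
  have hL := Ln_pos hl (n + 1)
  have hL' := Ln_pos hl n
  refine ⟨?_, ?_, ?_⟩
  · rw [inv_le_iff_one_le_mul₀ hL]; linarith
  · rw [le_inv_comm₀ (by by_contra h; nlinarith) hL', ← one_div, le_div_iff₀ (by by_contra h; nlinarith)]
    linarith
  · rw [Ln_succ]
    have := l_ge hl n
    nlinarith

lemma rl_inv (m : ℕ) : (rl m)⁻¹ = 2 * (m : ℝ) / 3 + 1 / 9 := by simp [rl]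

lemma rl_pos (m : ℕ) : 0 < rl m := by unfold rl; positivity

lemma Rn_pos (l : ℕ → ℕ) (n : ℕ) : 0 < Rn l n := Finset.prod_pos fun k _ => rl_pos _

lemma Rn_succ (l : ℕ → ℕ) (n : ℕ) : Rn l (n + 1) = Rn l n * rl (l n) := by
  simp [Rn, Finset.prod_range_succ]

lemma Rn_zero (l : ℕ → ℕ) : Rn l 0 = 1 := by simp [Rn]

lemma betaM_le (hl : ∀ m, 5 ≤ l m) : 0 ≤ betaM l ∧ betaM l ≤ 2 ∧
    BddBelow (range fun n : ℕ => Real.logb (l n) (3 * (l n : ℝ) - 3)) := by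
  have h0 : ∀ n, 0 ≤ Real.logb (l n) (3 * (l n : ℝ) - 3) := fun n => by
    have := l_ge hl n
    exact Real.logb_nonneg (by linarith) (by linarith)
  have hb : BddBelow (range fun n : ℕ => Real.logb (l n) (3 * (l n : ℝ) - 3)) :=
    ⟨0, by rintro _ ⟨n, rfl⟩; exact h0 n⟩
  refine ⟨le_ciInf h0, (ciInf_le hb 0).trans ?_, hb⟩
  have := l_ge hl 0
  rw [Real.logb_le_iff_le_rpow (by linarith) (by linarith)]
  norm_num
  nlinarith

lemma betaR_le (hl : ∀ m, 5 ≤ l m) : 0 ≤ betaR l ∧ betaR l ≤ 1 ∧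
    BddAbove (range fun n : ℕ => Real.logb (l n) ((rl (l n))⁻¹)) := by
  have h0 : ∀ n, Real.logb (l n) ((rl (l n))⁻¹) ≤ 1 := fun n => by
    have := l_ge hl n
    rw [rl_inv, Real.logb_le_iff_le_rpow (by linarith) (by linarith)]
    norm_num
    linarith
  have hb : BddAbove (range fun n : ℕ => Real.logb (l n) ((rl (l n))⁻¹)) :=
    ⟨1, by rintro _ ⟨n, rfl⟩; exact h0 n⟩
  refine ⟨le_trans ?_ (le_ciSup hb 0), ciSup_le h0, hb⟩
  have := l_ge hl 0
  rw [rl_inv]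
  exact Real.logb_nonneg (by linarith) (by linarith)

lemma beta0_bd (hl : ∀ m, 5 ≤ l m) : 2 ≤ betaZero l ∧ betaZero l ≤ betaM l + betaR l := by
  have h0 : ∀ n, 2 ≤ Real.logb (l n) (2 * (l n : ℝ) ^ 2 - (5 / 3) * (l n : ℝ) - 1 / 3) := fun n => by
    have := l_ge hl n
    rw [Real.le_logb_iff_rpow_le (by linarith) (by nlinarith)]
    norm_num
    nlinarith
  have hb : BddBelow (range fun n : ℕ => Real.logb (l n) (2 * (l n : ℝ) ^ 2 - (5 / 3) * (l n : ℝ) - 1 / 3)) :=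
    ⟨2, by rintro _ ⟨n, rfl⟩; exact h0 n⟩
  refine ⟨le_ciInf h0, ?_⟩
  rw [← sub_le_iff_le_add]
  refine le_ciInf fun n => ?_
  have h1 := ciInf_le hb n
  have h2 := le_ciSup (betaR_le hl).2.2 n
  have hn := l_ge hl n
  have h3 : 2 * (l n : ℝ) ^ 2 - (5 / 3) * (l n : ℝ) - 1 / 3 = (3 * (l n : ℝ) - 3) * (rl (l n))⁻¹ := by
    rw [rl_inv]; ring
  have h4 := Real.logb_mul (b := l n) (x := 3 * (l n : ℝ) - 3) (y := (rl (l n))⁻¹) (by linarith)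
    (inv_pos.2 (rl_pos _)).ne'
  rw [h3, h4] at h1
  change betaZero l ≤ _ at h1
  change _ ≤ betaR l at h2
  linarith

lemma cM_bd (hl : ∀ m, 5 ≤ l m) (n : ℕ) :
    11 / 4 ≤ (3 * (l n : ℝ) - 4) / ((l n : ℝ) - 1) ∧ (3 * (l n : ℝ) - 4) / ((l n : ℝ) - 1) ≤ 3 := by
  have := l_ge hl n
  rw [le_div_iff₀ (by linarith), div_le_iff₀ (by linarith)]
  constructor <;> linarith

lemma cR_bd (hl : ∀ m, 5 ≤ l m) (n : ℕ) :
    11 / 18 ≤ ((2 / 3) * (l n : ℝ) - 8 / 9) / ((l n : ℝ) - 1) ∧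
    ((2 / 3) * (l n : ℝ) - 8 / 9) / ((l n : ℝ) - 1) ≤ 2 / 3 := by
  have := l_ge hl n
  rw [le_div_iff₀ (by linarith), div_le_iff₀ (by linarith)]
  constructor <;> linarith

lemma part1 (hq : Equi q) (hl : ∀ m, 5 ≤ l m) {μ : Measure E2} (hμ : IsUnif q l μ) {PsiM : ℝ → ℝ}
    (hPsiM : IsPsiM l PsiM) {x : E2} (hx : x ∈ Gasket q l) {s : ℝ} (hs0 : 0 < s) (hs3 : s ≤ 3) :
    (1 / 16) * PsiM s ≤ (μ (Bd q l x s)).toReal ∧ (μ (Bd q l x s)).toReal ≤ 12 * PsiM s ∧ 0 < PsiM s := by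
  rcases le_total s 1 with hs1 | hs1
  · obtain ⟨n, h1, h2⟩ := exists_scale hl hs0 hs1
    obtain ⟨h3, h4, h5⟩ := scale_inv hl h1 h2
    rw [hPsiM.1 n s h3 h4, psiMPiece]
    have hM : 0 < (Mn l (n + 1) : ℝ) := Mn_pos hl (n + 1)
    have hM' := inv_pos.2 hM
    obtain ⟨c1, c2⟩ := cM_bd hl n
    refine ⟨le_trans ?_ (low_main hq hl hμ n hx h1 h5), (up_main hq hl hμ n hx h1 h5).trans ?_, ?_⟩
    · have : 1 + (3 * (l n : ℝ) - 4) / ((l n : ℝ) - 1) * (↑(Ln l (n + 1)) * s - 1) ≤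
        3 * (↑(Ln l (n + 1)) * s) - 2 := by nlinarith
      gcongr
    · gcongr
    · have : 0 ≤ (3 * (l n : ℝ) - 4) / ((l n : ℝ) - 1) * (↑(Ln l (n + 1)) * s - 1) :=
        mul_nonneg (by linarith) (by linarith)
      positivity
  · rw [hPsiM.2.1 s hs1]
    obtain ⟨b0, b2, -⟩ := betaM_le hl
    have h1 : 1 ≤ s ^ betaM l := Real.one_le_rpow hs1 b0
    have h2 : s ^ betaM l ≤ s ^ 2 := by
      have := Real.rpow_le_rpow_of_exponent_le hs1 b2
      rwa [Real.rpow_two] at this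
    refine ⟨?_, ?_, by linarith⟩
    · rcases le_or_gt s (3 / 2) with h | h
      · have := low_a hq hl hμ 0 hx (s := s) (by rw [Ln_zero]; linarith)
        rw [Mn_zero] at this
        norm_num at this
        nlinarith
      rcases le_or_gt s (23 / 10) with h' | h'
      · have := low_b hq hl hμ 0 hx (s := s) (by rw [Ln_zero]; linarith)
        rw [Mn_zero] at this
        norm_num at this
        nlinarith
      · have := low_cell hq hl hμ 0 hx (s := s) (by rw [Ln_zero]; linarith)
        rw [Mn_zero] at this
        norm_num at this
        nlinarith
    · have : (μ (Bd q l x s)).toReal ≤ 1 := by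
        have := meas_le_one hl hμ (B := Bd q l x s) (fun y hy => hy.1)
        exact ENNReal.toReal_mono (by simp) this
      linarith

lemma part2 (hq : Equi q) (hl : ∀ m, 5 ≤ l m) {μ : Measure E2} (hμ : IsUnif q l μ) {Psi PsiM PsiR : ℝ → ℝ}
    (hPsi : IsPsi l Psi) (hPsiM : IsPsiM l PsiM) (hPsiR : IsPsiR l PsiR)
    {x : E2} (hx : x ∈ Gasket q l) {s : ℝ} (hs0 : 0 < s) (hs3 : s ≤ 3) :
    (1 / 12) * PsiR s ≤ Psi s / (μ (Bd q l x s)).toReal ∧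
     Psi s / (μ (Bd q l x s)).toReal ≤ 16 * PsiR s := by
  obtain ⟨p1, p2, p3⟩ := part1 hq hl hμ hPsiM hx hs0 hs3
  have hm : 0 < (μ (Bd q l x s)).toReal := by linarith
  rw [le_div_iff₀ hm, div_le_iff₀ hm]
  rcases le_total s 1 with hs1 | hs1
  · obtain ⟨n, h1, h2⟩ := exists_scale hl hs0 hs1
    obtain ⟨h3, h4, h5⟩ := scale_inv hl h1 h2
    have e : Psi s = PsiM s * PsiR s := by
      rw [hPsi.1 n s h3 h4, hPsiM.1 n s h3 h4, hPsiR.1 n s h3 h4, psiPiece, psiMPiece, psiRPiece, Tn,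
        inv_div]
      ring
    have hR : 0 < PsiR s := by
      rw [hPsiR.1 n s h3 h4, psiRPiece]
      have := Rn_pos l (n + 1)
      have : 0 ≤ ((2 / 3) * (l n : ℝ) - 8 / 9) / ((l n : ℝ) - 1) * (↑(Ln l (n + 1)) * s - 1) :=
        mul_nonneg (by linarith [(cR_bd hl n).1]) (by linarith)
      positivity
    rw [e]
    constructor <;> nlinarith
  · have hm1 : (μ (Bd q l x s)).toReal ≤ 1 := by
        have := meas_le_one hl hμ (B := Bd q l x s) (fun y hy => hy.1)
        exact ENNReal.toReal_mono (by simp) this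
    rw [hPsi.2.1 s hs1, hPsiR.2.1 s hs1]
    rw [hPsiM.2.1 s hs1] at p1 p2
    obtain ⟨b1, b2⟩ := beta0_bd hl
    obtain ⟨r1, r2, -⟩ := betaR_le hl
    have h1 : s ^ betaR l ≤ s ^ betaZero l := Real.rpow_le_rpow_of_exponent_le hs1 (by linarith)
    have h2 : s ^ betaZero l ≤ s ^ betaM l * s ^ betaR l := by
      rw [← Real.rpow_add hs0]
      exact Real.rpow_le_rpow_of_exponent_le hs1 b2
    have h3 : 0 < s ^ betaR l := Real.rpow_pos_of_pos hs0 _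
    constructor <;> nlinarith

lemma titu {a b x y : ℝ} (hx : 0 < x) (hy : 0 < y) : (a + b) ^ 2 ≤ (x + y) * (a ^ 2 / x + b ^ 2 / y) := by
  have h : (x + y) * (a ^ 2 / x + b ^ 2 / y) = (a + b) ^ 2 + (a * y - b * x) ^ 2 / (x * y) := by
    field_simp; ring
  rw [h]; have : 0 ≤ (a * y - b * x) ^ 2 / (x * y) := by positivity
  linarith

lemma corner3 (A B C p r s : ℝ) :
    3 / 5 * ed A B C ≤ ed A p r + ed p B s + ed r s C := by
  unfold ed
  nlinarith [sq_nonneg ((p - (2 * A + 2 * B + C) / 5) - (r - (2 * A + B + 2 * C) / 5)),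
    sq_nonneg ((p - (2 * A + 2 * B + C) / 5) - (s - (A + 2 * B + 2 * C) / 5)),
    sq_nonneg ((r - (2 * A + B + 2 * C) / 5) - (s - (A + 2 * B + 2 * C) / 5)),
    sq_nonneg (p - (2 * A + 2 * B + C) / 5), sq_nonneg (r - (2 * A + B + 2 * C) / 5),
    sq_nonneg (s - (A + 2 * B + 2 * C) / 5)]

lemma tele (n : ℕ) (G : ℕ → ℝ) : (G n - G 0) ^ 2 ≤ n * ∑ j ∈ Finset.range n, (G (j + 1) - G j) ^ 2 := by
  rw [← Finset.sum_range_sub]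
  have := sq_sum_le_card_mul_sum_sq (s := Finset.range n) (f := fun j => G (j + 1) - G j)
  simpa using this

lemma ed_ge (a b c : ℝ) : 3 / 2 * (b - a) ^ 2 ≤ ed a b c := by
  unfold ed; nlinarith [sq_nonneg (2 * c - a - b)]

lemma tele_ed (k : ℕ) (G c : ℕ → ℝ) :
    (G (k + 1) - G 0) ^ 2 / (2 * ((k : ℝ) + 1) / 3) ≤ ∑ j ∈ Finset.range (k + 1), ed (G j) (G (j + 1)) (c j) := by
  have h1 : ∑ j ∈ Finset.range (k + 1), 3 / 2 * (G (j + 1) - G j) ^ 2 ≤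
      ∑ j ∈ Finset.range (k + 1), ed (G j) (G (j + 1)) (c j) :=
    Finset.sum_le_sum fun j _ => ed_ge _ _ _
  rw [← Finset.mul_sum] at h1
  have h2 := tele (k + 1) G
  rw [div_le_iff₀ (by positivity)]
  push_cast at h2
  nlinarith [mul_le_mul_of_nonneg_left h1 (by positivity : (0 : ℝ) ≤ 2 * ((k : ℝ) + 1) / 3)]

/-- series law -/
lemma series3 {y b b' y' x : ℝ} (hx : 0 < x) :
    (y - y') ^ 2 / (x + 10 / 9) ≤ 9 / 5 * (b - y) ^ 2 + (b' - b) ^ 2 / x + 9 / 5 * (b' - y') ^ 2 := by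
  rw [div_le_iff₀ (by positivity)]
  have h1 := titu (a := y - b) (b := b - b') (x := 5 / 9) (y := x) (by norm_num) hx
  have h2 := titu (a := y - b') (b := b' - y') (x := 5 / 9 + x) (y := 5 / 9) (by positivity) (by norm_num)
  have e1 : y - b + (b - b') = y - b' := by ring
  have e2 : y - b' + (b' - y') = y - y' := by ring
  rw [e1] at h1
  rw [e2] at h2
  have h3 : (y - b') ^ 2 / (5 / 9 + x) ≤ (y - b) ^ 2 / (5 / 9) + (b - b') ^ 2 / x := by
    rw [div_le_iff₀ (by positivity)]; linarith
  have e3 : (b' - b) ^ 2 = (b - b') ^ 2 := by ring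
  have e4 : (5 / 9 + x + 5 / 9) = x + 10 / 9 := by ring
  rw [e4] at h2
  rw [e3]
  refine h2.trans ?_
  rw [mul_comm]
  refine mul_le_mul_of_nonneg_right ?_ (by positivity)
  have e5 : (b - y) ^ 2 = (y - b) ^ 2 := by ring
  rw [e5]
  linarith

lemma ed_add {a b c a' b' c' x y : ℝ} (hx : 0 < x) (hy : 0 < y) :
    ed (a + a') (b + b') (c + c') ≤ (x + y) * (ed a b c / x + ed a' b' c' / y) := by
  unfold ed
  have h1 := titu (a := a - b) (b := a' - b') hx hy
  have h2 := titu (a := b - c) (b := b' - c') hx hy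
  have h3 := titu (a := c - a) (b := c' - a') hx hy
  calc _ = (a - b + (a' - b')) ^ 2 + (b - c + (b' - c')) ^ 2 + (c - a + (c' - a')) ^ 2 := by ring
    _ ≤ _ := add_le_add (add_le_add h1 h2) h3
    _ = _ := by ring

lemma final_net {a b c : Fin 3 → ℝ} {x : ℝ} (hx : 0 < x) :
    ed (a 0) (a 1) (a 2) ≤ (x + 25 / 9) * (3 / 5 * ed (a 0) (b 0) (c 0) + 3 / 5 * ed (a 1) (b 1) (c 1)
      + 3 / 5 * ed (a 2) (b 2) (c 2) + ((b 1 - c 0) ^ 2 / x + (b 2 - c 1) ^ 2 / x + (b 0 - c 2) ^ 2 / x)) := by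
  set y : Fin 3 → ℝ := fun i => (a i + b i + c i) / 3 with hy
  have star : ∀ i, 3 / 5 * ed (a i) (b i) (c i) =
      9 / 5 * (a i - y i) ^ 2 + 9 / 5 * (b i - y i) ^ 2 + 9 / 5 * (c i - y i) ^ 2 := by
    intro i; simp only [hy, ed]; ring
  rw [star 0, star 1, star 2]
  have s1 := series3 (y := y 0) (b := c 0) (b' := b 1) (y' := y 1) hx
  have s2 := series3 (y := y 1) (b := c 1) (b' := b 2) (y' := y 2) hx
  have s3 := series3 (y := y 2) (b := c 2) (b' := b 0) (y' := y 0) hx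
  have h := ed_add (a := y 0) (b := y 1) (c := y 2) (a' := a 0 - y 0) (b' := a 1 - y 1)
    (c' := a 2 - y 2) (x := x + 10 / 9) (y := 5 / 3) (by positivity) (by norm_num)
  have e : ed (a 0 - y 0) (a 1 - y 1) (a 2 - y 2) / (5 / 3) ≤
      9 / 5 * (a 0 - y 0) ^ 2 + 9 / 5 * (a 1 - y 1) ^ 2 + 9 / 5 * (a 2 - y 2) ^ 2 := by
    unfold ed; nlinarith [sq_nonneg ((a 0 - y 0) + (a 1 - y 1) + (a 2 - y 2))]
  have e' : ed (y 0) (y 1) (y 2) / (x + 10 / 9) = (y 0 - y 1) ^ 2 / (x + 10 / 9) +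
      (y 1 - y 2) ^ 2 / (x + 10 / 9) + (y 2 - y 0) ^ 2 / (x + 10 / 9) := by unfold ed; ring
  have e2 : x + 10 / 9 + 5 / 3 = x + 25 / 9 := by ring
  rw [e2, e'] at h
  simp only [add_sub_cancel] at h
  refine h.trans (mul_le_mul_of_nonneg_left ?_ (by positivity))
  linarith

/-- energy of the cell at `P` of a lattice function -/
def edl (g : ℕ × ℕ → ℝ) (p : ℕ × ℕ) : ℝ := ed (g p) (g (p.1 + 1, p.2)) (g (p.1, p.2 + 1))

lemma edl_nonneg (g : ℕ × ℕ → ℝ) (p : ℕ × ℕ) : 0 ≤ edl g p := by unfold edl ed; positivity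

lemma sum_split (k : ℕ) (F : ℕ → ℝ) : ∑ j ∈ Finset.range (k + 4), F j =
    F 0 + F 1 + F (k + 3) + ∑ j ∈ Finset.range (k + 1), F (j + 2) := by
  rw [Finset.sum_range_succ, Finset.sum_range_succ', Finset.sum_range_succ']
  simp only [add_assoc]; norm_num; ring

lemma trace_le {m : ℕ} (hm : 5 ≤ m) (g : ℕ × ℕ → ℝ) :
    ed (g (0, 0)) (g (m, 0)) (g (0, m)) ≤ (rl m)⁻¹ * ∑ i ∈ SF m, edl g i := by
  obtain ⟨k, rfl⟩ : ∃ k, m = k + 5 := ⟨m - 5, by omega⟩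
  rw [sum_SF hm, show k + 5 - 1 = k + 4 from rfl, sum_split]
  have hb := tele_ed k (fun j => g (j + 2, 0)) (fun j => g (j + 2, 1))
  have hh := tele_ed k (fun j => g (k + 3 - j, j + 2)) (fun j => g (k + 2 - j, j + 2))
  have hc := tele_ed k (fun j => g (0, k + 3 - j)) (fun j => g (1, k + 2 - j))
  have eb : ∀ j ∈ Finset.range (k + 1), edl g (j + 2, 0) + edl g (k + 4 - (j + 2), j + 2) +
      edl g (0, k + 4 - (j + 2)) = ed (g (j + 2, 0)) (g (j + 1 + 2, 0)) (g (j + 2, 1)) +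
      ed (g (k + 3 - j, j + 2)) (g (k + 2 - j, j + 1 + 2)) (g (k + 2 - j, j + 2)) +
      ed (g (0, k + 3 - j)) (g (0, k + 2 - j)) (g (1, k + 2 - j)) := by
    intro j hj
    have hj : j ≤ k := by simpa [Nat.lt_succ_iff] using hj
    have e1 : k + 4 - (j + 2) = k + 2 - j := by omega
    have e3 : k + 3 - j = k + 2 - j + 1 := by omega
    simp only [edl, e1, e3, ed]
    have e4 : j + 2 + 1 = j + 1 + 2 := by ring
    simp only [e4, zero_add]
    ring
  rw [Finset.sum_congr rfl eb, Finset.sum_add_distrib, Finset.sum_add_distrib]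
  have c0 := corner3 (g (0, 0)) (g (2, 0)) (g (0, 2)) (g (1, 0)) (g (0, 1)) (g (1, 1))
  have c1 := corner3 (g (k + 5, 0)) (g (k + 3, 2)) (g (k + 3, 0)) (g (k + 4, 1)) (g (k + 4, 0)) (g (k + 3, 1))
  have c2 := corner3 (g (0, k + 5)) (g (0, k + 3)) (g (2, k + 3)) (g (0, k + 4)) (g (1, k + 4)) (g (1, k + 3))
  have hf := final_net (a := ![g (0, 0), g (k + 5, 0), g (0, k + 5)])
    (b := ![g (0, 2), g (k + 3, 0), g (2, k + 3)]) (c := ![g (2, 0), g (k + 3, 2), g (0, k + 3)])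
    (x := 2 * ((k : ℝ) + 1) / 3) (by positivity)
  simp at hf hb hh hc
  rw [rl_inv]
  have e0 : 2 * ((k + 5 : ℕ) : ℝ) / 3 + 1 / 9 = 2 * ((k : ℝ) + 1) / 3 + 25 / 9 := by push_cast; ring
  rw [e0]
  refine hf.trans (mul_le_mul_of_nonneg_left ?_ (by positivity))
  have k3 : k + 4 - (k + 3) = 1 := by omega
  have k4 : k + 4 - 1 = k + 3 := by omega
  have k5 : k + 1 + 2 = k + 3 := rfl
  have k6 : k + 3 + 1 = k + 4 := rfl
  have k7 : k + 4 + 1 = k + 5 := rfl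
  clear hf eb
  simp only [edl, k3, k4, k5, k6, k7, Nat.sub_zero, zero_add, Nat.reduceAdd] at *
  generalize ∑ j ∈ Finset.range (k + 1), ed (g (j + 2, 0)) (g (j + 1 + 2, 0)) (g (j + 2, 1)) = S1 at *
  generalize ∑ j ∈ Finset.range (k + 1), ed (g (k + 3 - j, j + 2)) (g (k + 2 - j, j + 1 + 2)) (g (k + 2 - j, j + 2)) = S2 at *
  generalize ∑ j ∈ Finset.range (k + 1), ed (g (0, k + 3 - j)) (g (0, k + 2 - j)) (g (1, k + 2 - j)) = S3 at *
  simp only [ed] at *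
  linarith

/-- (unnormalised) harmonic function with boundary values `(1,0,0)` -/
def hrm (m c a b : ℕ) : ℕ :=
  if c = m then 6 * m + 1
  else if 2 ≤ c then (if a = 0 ∨ b = 0 then 6 * c - 2 else 6 * c + 1)
  else if c = 1 then (if a = 1 ∨ b = 1 then 6 else 5)
  else (if a = 0 ∨ b = 0 then 0 else if a = 1 ∨ b = 1 then 4 else 5)

/-- harmonic extension on one cell -/
def hex (m : ℕ) (a0 a1 a2 : ℝ) (v : ℕ × ℕ) : ℝ :=
  (a0 * hrm m (m - v.1 - v.2) v.1 v.2 + a1 * hrm m v.1 v.2 (m - v.1 - v.2)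
    + a2 * hrm m v.2 (m - v.1 - v.2) v.1) / (6 * m + 1)

lemma hrm_sum {m a b c : ℕ} (hm : 5 ≤ m) (h : a + b + c = m) (h1 : a ≤ 1 ∨ b ≤ 1 ∨ c ≤ 1) :
    hrm m c a b + hrm m a b c + hrm m b c a = 6 * m + 1 := by
  unfold hrm
  rcases Nat.lt_or_ge c 2 with hc | hc
  · interval_cases c
    · rcases Nat.lt_or_ge a 2 with ha | ha
      · interval_cases a <;> simp <;> split_ifs <;> omega
      · rcases Nat.lt_or_ge b 2 with hb | hb
        · interval_cases b <;> simp <;> split_ifs <;> omega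
        · simp; split_ifs <;> omega
    · rcases Nat.lt_or_ge a 2 with ha | ha
      · interval_cases a <;> simp <;> split_ifs <;> omega
      · rcases Nat.lt_or_ge b 2 with hb | hb
        · interval_cases b <;> simp <;> split_ifs <;> omega
        · simp; split_ifs <;> omega
  · rcases Nat.lt_or_ge a 2 with ha | ha
    · interval_cases a
      · rcases Nat.lt_or_ge b 2 with hb | hb
        · interval_cases b <;> simp <;> split_ifs <;> omega
        · simp; split_ifs <;> omega
      · rcases Nat.lt_or_ge b 2 with hb | hb
        · interval_cases b <;> simp <;> split_ifs <;> omega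
        · simp; split_ifs <;> omega
    · have hb : b < 2 := by omega
      interval_cases b <;> simp <;> split_ifs <;> omega

lemma hex_mem {m : ℕ} (hm : 5 ≤ m) {a0 a1 a2 lo hi : ℝ} (h0 : a0 ∈ Icc lo hi) (h1 : a1 ∈ Icc lo hi)
    (h2 : a2 ∈ Icc lo hi) {i v : ℕ × ℕ} (hi' : i ∈ SF m) (hv : IsV v i) : hex m a0 a1 a2 v ∈ Icc lo hi := by
  rw [mem_SF' hm] at hi'
  obtain ⟨a, b⟩ := v
  obtain ⟨i1, i2⟩ := i
  have hs : hrm m (m - a - b) a b + hrm m a b (m - a - b) + hrm m b (m - a - b) a = 6 * m + 1 := by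
    apply hrm_sum hm
    · simp only [IsV, Prod.mk.injEq] at hv hi'; omega
    · simp only [IsV, Prod.mk.injEq] at hv hi'; omega
  have hs' : (hrm m (m - a - b) a b : ℝ) + hrm m a b (m - a - b) + hrm m b (m - a - b) a = 6 * m + 1 := by
    exact_mod_cast hs
  unfold hex
  simp only
  have e0 : (0 : ℝ) ≤ hrm m (m - a - b) a b := Nat.cast_nonneg _
  have e1 : (0 : ℝ) ≤ hrm m a b (m - a - b) := Nat.cast_nonneg _
  have e2 : (0 : ℝ) ≤ hrm m b (m - a - b) a := Nat.cast_nonneg _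
  have hp : (0 : ℝ) < 6 * m + 1 := by positivity
  constructor
  · rw [le_div_iff₀ hp, ← hs']
    nlinarith [mul_le_mul_of_nonneg_right h0.1 e0, mul_le_mul_of_nonneg_right h1.1 e1,
      mul_le_mul_of_nonneg_right h2.1 e2]
  · rw [div_le_iff₀ hp, ← hs']
    nlinarith [mul_le_mul_of_nonneg_right h0.2 e0, mul_le_mul_of_nonneg_right h1.2 e1,
      mul_le_mul_of_nonneg_right h2.2 e2]

lemma hex_corner {m : ℕ} (hm : 5 ≤ m) (a0 a1 a2 : ℝ) :
    hex m a0 a1 a2 (0, 0) = a0 ∧ hex m a0 a1 a2 (m, 0) = a1 ∧ hex m a0 a1 a2 (0, m) = a2 := by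
  have hp : (6 * (m : ℝ) + 1) ≠ 0 := by positivity
  have h0 : ¬ (0 = m) := by omega
  refine ⟨?_, ?_, ?_⟩ <;>
  · unfold hex hrm
    simp [h0]
    field_simp

/-- relational form of `hrm`, suited to linear arithmetic -/
def HR (m c a b x : ℕ) : Prop :=
  (c = m ∧ x = 6 * m + 1) ∨ (c ≠ m ∧ 2 ≤ c ∧ (a = 0 ∨ b = 0) ∧ x + 2 = 6 * c) ∨
  (c ≠ m ∧ 2 ≤ c ∧ ¬ (a = 0 ∨ b = 0) ∧ x = 6 * c + 1) ∨
  (c ≠ m ∧ c = 1 ∧ (a = 1 ∨ b = 1) ∧ x = 6) ∨ (c ≠ m ∧ c = 1 ∧ ¬ (a = 1 ∨ b = 1) ∧ x = 5) ∨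
  (c ≠ m ∧ c = 0 ∧ (a = 0 ∨ b = 0) ∧ x = 0) ∨
  (c ≠ m ∧ c = 0 ∧ ¬ (a = 0 ∨ b = 0) ∧ (a = 1 ∨ b = 1) ∧ x = 4) ∨
  (c ≠ m ∧ c = 0 ∧ ¬ (a = 0 ∨ b = 0) ∧ ¬ (a = 1 ∨ b = 1) ∧ x = 5)

lemma HR.eq {m c a b x : ℕ} (h : HR m c a b x) : hrm m c a b = x := by
  unfold HR at h; unfold hrm; split_ifs <;> omega

lemma hex_eq {m a b c x0 x1 x2 : ℕ} (h : a + b + c = m ∧ HR m c a b x0 ∧ HR m a b c x1 ∧ HR m b c a x2)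
    (a0 a1 a2 : ℝ) :
    hex m a0 a1 a2 (a, b) = (a0 * x0 + a1 * x1 + a2 * x2) / (6 * m + 1) := by
  have : m - a - b = c := by omega
  simp only [hex, this, h.2.1.eq, h.2.2.1.eq, h.2.2.2.eq]

lemma ed_div (x y z D : ℝ) : ed (x / D) (y / D) (z / D) = ed x y z / D ^ 2 := by
  unfold ed; ring

lemma edl_eq3 (g : ℕ × ℕ → ℝ) (a b : ℕ) {x y z D : ℝ} (h0 : g (a, b) = x / D) (h1 : g (a + 1, b) = y / D)
    (h2 : g (a, b + 1) = z / D) : edl g (a, b) = ed x y z / D ^ 2 := by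
  unfold edl; simp only [h0, h1, h2, ed_div]

lemma mid_bot (α γ : ℕ) (a0 a1 a2 : ℝ) :
    edl (hex (α + γ + 5) a0 a1 a2) (α + 2, 0) = (54 * (a0 - a1) ^ 2) / (6 * ((α + γ + 5 : ℕ) : ℝ) + 1) ^ 2 := by
  rw [edl_eq3 _ _ _
    (hex_eq (m := α + γ + 5) (a := α + 2) (b := 0) (c := γ + 3) (x0 := 6 * γ + 16) (x1 := 6 * α + 10) (x2 := 5) (by refine ⟨by omega, ?_, ?_, ?_⟩ <;> simp [HR] <;> omega) a0 a1 a2)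
    (hex_eq (m := α + γ + 5) (a := α + 3) (b := 0) (c := γ + 2) (x0 := 6 * γ + 10) (x1 := 6 * α + 16) (x2 := 5) (by refine ⟨by omega, ?_, ?_, ?_⟩ <;> simp [HR] <;> omega) a0 a1 a2)
    (hex_eq (m := α + γ + 5) (a := α + 2) (b := 1) (c := γ + 2) (x0 := 6 * γ + 13) (x1 := 6 * α + 13) (x2 := 5) (by refine ⟨by omega, ?_, ?_, ?_⟩ <;> simp [HR] <;> omega) a0 a1 a2)]
  congr 1
  unfold ed
  push_cast
  ring

lemma mid_hyp (α γ : ℕ) (a0 a1 a2 : ℝ) :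
    edl (hex (α + γ + 5) a0 a1 a2) (γ + 2, α + 2) = (54 * (a1 - a2) ^ 2) / (6 * ((α + γ + 5 : ℕ) : ℝ) + 1) ^ 2 := by
  rw [edl_eq3 _ _ _
    (hex_eq (m := α + γ + 5) (a := γ + 2) (b := α + 2) (c := 1) (x0 := 5) (x1 := 6 * γ + 13) (x2 := 6 * α + 13) (by refine ⟨by omega, ?_, ?_, ?_⟩ <;> simp [HR] <;> omega) a0 a1 a2)
    (hex_eq (m := α + γ + 5) (a := γ + 3) (b := α + 2) (c := 0) (x0 := 5) (x1 := 6 * γ + 16) (x2 := 6 * α + 10) (by refine ⟨by omega, ?_, ?_, ?_⟩ <;> simp [HR] <;> omega) a0 a1 a2)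
    (hex_eq (m := α + γ + 5) (a := γ + 2) (b := α + 3) (c := 0) (x0 := 5) (x1 := 6 * γ + 10) (x2 := 6 * α + 16) (by refine ⟨by omega, ?_, ?_, ?_⟩ <;> simp [HR] <;> omega) a0 a1 a2)]
  congr 1
  unfold ed
  push_cast
  ring

lemma mid_left (α γ : ℕ) (a0 a1 a2 : ℝ) :
    edl (hex (α + γ + 5) a0 a1 a2) (0, γ + 2) = (54 * (a2 - a0) ^ 2) / (6 * ((α + γ + 5 : ℕ) : ℝ) + 1) ^ 2 := by
  rw [edl_eq3 _ _ _
    (hex_eq (m := α + γ + 5) (a := 0) (b := γ + 2) (c := α + 3) (x0 := 6 * α + 16) (x1 := 5) (x2 := 6 * γ + 10) (by refine ⟨by omega, ?_, ?_, ?_⟩ <;> simp [HR] <;> omega) a0 a1 a2)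
    (hex_eq (m := α + γ + 5) (a := 1) (b := γ + 2) (c := α + 2) (x0 := 6 * α + 13) (x1 := 5) (x2 := 6 * γ + 13) (by refine ⟨by omega, ?_, ?_, ?_⟩ <;> simp [HR] <;> omega) a0 a1 a2)
    (hex_eq (m := α + γ + 5) (a := 0) (b := γ + 3) (c := α + 2) (x0 := 6 * α + 10) (x1 := 5) (x2 := 6 * γ + 16) (by refine ⟨by omega, ?_, ?_, ?_⟩ <;> simp [HR] <;> omega) a0 a1 a2)]
  congr 1
  unfold ed
  push_cast
  ring

lemma cor0 (k : ℕ) (a0 a1 a2 : ℝ) :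
    edl (hex (k + 5) a0 a1 a2) (0, 0) = (ed (a0 * (6 * k + 31) + a1 * (0) + a2 * (0)) (a0 * (6 * k + 22) + a1 * (5) + a2 * (4)) (a0 * (6 * k + 22) + a1 * (4) + a2 * (5))) / (6 * ((k + 5 : ℕ) : ℝ) + 1) ^ 2 := by
  rw [edl_eq3 _ _ _
    (hex_eq (m := k + 5) (a := 0) (b := 0) (c := k + 5) (x0 := 6 * k + 31) (x1 := 0) (x2 := 0) (by refine ⟨by omega, ?_, ?_, ?_⟩ <;> simp [HR] <;> omega) a0 a1 a2)
    (hex_eq (m := k + 5) (a := 1) (b := 0) (c := k + 4) (x0 := 6 * k + 22) (x1 := 5) (x2 := 4) (by refine ⟨by omega, ?_, ?_, ?_⟩ <;> simp [HR] <;> omega) a0 a1 a2)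
    (hex_eq (m := k + 5) (a := 0) (b := 1) (c := k + 4) (x0 := 6 * k + 22) (x1 := 4) (x2 := 5) (by refine ⟨by omega, ?_, ?_, ?_⟩ <;> simp [HR] <;> omega) a0 a1 a2)]
  congr 1
  unfold ed
  push_cast
  ring

lemma cor1 (k : ℕ) (a0 a1 a2 : ℝ) :
    edl (hex (k + 5) a0 a1 a2) (1, 0) = (ed (a0 * (6 * k + 22) + a1 * (5) + a2 * (4)) (a0 * (6 * k + 16) + a1 * (10) + a2 * (5)) (a0 * (6 * k + 19) + a1 * (6) + a2 * (6))) / (6 * ((k + 5 : ℕ) : ℝ) + 1) ^ 2 := by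
  rw [edl_eq3 _ _ _
    (hex_eq (m := k + 5) (a := 1) (b := 0) (c := k + 4) (x0 := 6 * k + 22) (x1 := 5) (x2 := 4) (by refine ⟨by omega, ?_, ?_, ?_⟩ <;> simp [HR] <;> omega) a0 a1 a2)
    (hex_eq (m := k + 5) (a := 2) (b := 0) (c := k + 3) (x0 := 6 * k + 16) (x1 := 10) (x2 := 5) (by refine ⟨by omega, ?_, ?_, ?_⟩ <;> simp [HR] <;> omega) a0 a1 a2)
    (hex_eq (m := k + 5) (a := 1) (b := 1) (c := k + 3) (x0 := 6 * k + 19) (x1 := 6) (x2 := 6) (by refine ⟨by omega, ?_, ?_, ?_⟩ <;> simp [HR] <;> omega) a0 a1 a2)]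
  congr 1
  unfold ed
  push_cast
  ring

lemma cor2 (k : ℕ) (a0 a1 a2 : ℝ) :
    edl (hex (k + 5) a0 a1 a2) (0, 1) = (ed (a0 * (6 * k + 22) + a1 * (4) + a2 * (5)) (a0 * (6 * k + 19) + a1 * (6) + a2 * (6)) (a0 * (6 * k + 16) + a1 * (5) + a2 * (10))) / (6 * ((k + 5 : ℕ) : ℝ) + 1) ^ 2 := by
  rw [edl_eq3 _ _ _
    (hex_eq (m := k + 5) (a := 0) (b := 1) (c := k + 4) (x0 := 6 * k + 22) (x1 := 4) (x2 := 5) (by refine ⟨by omega, ?_, ?_, ?_⟩ <;> simp [HR] <;> omega) a0 a1 a2)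
    (hex_eq (m := k + 5) (a := 1) (b := 1) (c := k + 3) (x0 := 6 * k + 19) (x1 := 6) (x2 := 6) (by refine ⟨by omega, ?_, ?_, ?_⟩ <;> simp [HR] <;> omega) a0 a1 a2)
    (hex_eq (m := k + 5) (a := 0) (b := 2) (c := k + 3) (x0 := 6 * k + 16) (x1 := 5) (x2 := 10) (by refine ⟨by omega, ?_, ?_, ?_⟩ <;> simp [HR] <;> omega) a0 a1 a2)]
  congr 1
  unfold ed
  push_cast
  ring

lemma cor3 (k : ℕ) (a0 a1 a2 : ℝ) :
    edl (hex (k + 5) a0 a1 a2) (k + 4, 0) = (ed (a0 * (5) + a1 * (6 * k + 22) + a2 * (4)) (a0 * (0) + a1 * (6 * k + 31) + a2 * (0)) (a0 * (4) + a1 * (6 * k + 22) + a2 * (5))) / (6 * ((k + 5 : ℕ) : ℝ) + 1) ^ 2 := by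
  rw [edl_eq3 _ _ _
    (hex_eq (m := k + 5) (a := k + 4) (b := 0) (c := 1) (x0 := 5) (x1 := 6 * k + 22) (x2 := 4) (by refine ⟨by omega, ?_, ?_, ?_⟩ <;> simp [HR] <;> omega) a0 a1 a2)
    (hex_eq (m := k + 5) (a := k + 5) (b := 0) (c := 0) (x0 := 0) (x1 := 6 * k + 31) (x2 := 0) (by refine ⟨by omega, ?_, ?_, ?_⟩ <;> simp [HR] <;> omega) a0 a1 a2)
    (hex_eq (m := k + 5) (a := k + 4) (b := 1) (c := 0) (x0 := 4) (x1 := 6 * k + 22) (x2 := 5) (by refine ⟨by omega, ?_, ?_, ?_⟩ <;> simp [HR] <;> omega) a0 a1 a2)]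
  congr 1
  unfold ed
  push_cast
  ring

lemma cor4 (k : ℕ) (a0 a1 a2 : ℝ) :
    edl (hex (k + 5) a0 a1 a2) (k + 3, 0) = (ed (a0 * (10) + a1 * (6 * k + 16) + a2 * (5)) (a0 * (5) + a1 * (6 * k + 22) + a2 * (4)) (a0 * (6) + a1 * (6 * k + 19) + a2 * (6))) / (6 * ((k + 5 : ℕ) : ℝ) + 1) ^ 2 := by
  rw [edl_eq3 _ _ _
    (hex_eq (m := k + 5) (a := k + 3) (b := 0) (c := 2) (x0 := 10) (x1 := 6 * k + 16) (x2 := 5) (by refine ⟨by omega, ?_, ?_, ?_⟩ <;> simp [HR] <;> omega) a0 a1 a2)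
    (hex_eq (m := k + 5) (a := k + 4) (b := 0) (c := 1) (x0 := 5) (x1 := 6 * k + 22) (x2 := 4) (by refine ⟨by omega, ?_, ?_, ?_⟩ <;> simp [HR] <;> omega) a0 a1 a2)
    (hex_eq (m := k + 5) (a := k + 3) (b := 1) (c := 1) (x0 := 6) (x1 := 6 * k + 19) (x2 := 6) (by refine ⟨by omega, ?_, ?_, ?_⟩ <;> simp [HR] <;> omega) a0 a1 a2)]
  congr 1
  unfold ed
  push_cast
  ring

lemma cor5 (k : ℕ) (a0 a1 a2 : ℝ) :
    edl (hex (k + 5) a0 a1 a2) (k + 3, 1) = (ed (a0 * (6) + a1 * (6 * k + 19) + a2 * (6)) (a0 * (4) + a1 * (6 * k + 22) + a2 * (5)) (a0 * (5) + a1 * (6 * k + 16) + a2 * (10))) / (6 * ((k + 5 : ℕ) : ℝ) + 1) ^ 2 := by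
  rw [edl_eq3 _ _ _
    (hex_eq (m := k + 5) (a := k + 3) (b := 1) (c := 1) (x0 := 6) (x1 := 6 * k + 19) (x2 := 6) (by refine ⟨by omega, ?_, ?_, ?_⟩ <;> simp [HR] <;> omega) a0 a1 a2)
    (hex_eq (m := k + 5) (a := k + 4) (b := 1) (c := 0) (x0 := 4) (x1 := 6 * k + 22) (x2 := 5) (by refine ⟨by omega, ?_, ?_, ?_⟩ <;> simp [HR] <;> omega) a0 a1 a2)
    (hex_eq (m := k + 5) (a := k + 3) (b := 2) (c := 0) (x0 := 5) (x1 := 6 * k + 16) (x2 := 10) (by refine ⟨by omega, ?_, ?_, ?_⟩ <;> simp [HR] <;> omega) a0 a1 a2)]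
  congr 1
  unfold ed
  push_cast
  ring

lemma cor6 (k : ℕ) (a0 a1 a2 : ℝ) :
    edl (hex (k + 5) a0 a1 a2) (0, k + 4) = (ed (a0 * (5) + a1 * (4) + a2 * (6 * k + 22)) (a0 * (4) + a1 * (5) + a2 * (6 * k + 22)) (a0 * (0) + a1 * (0) + a2 * (6 * k + 31))) / (6 * ((k + 5 : ℕ) : ℝ) + 1) ^ 2 := by
  rw [edl_eq3 _ _ _
    (hex_eq (m := k + 5) (a := 0) (b := k + 4) (c := 1) (x0 := 5) (x1 := 4) (x2 := 6 * k + 22) (by refine ⟨by omega, ?_, ?_, ?_⟩ <;> simp [HR] <;> omega) a0 a1 a2)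
    (hex_eq (m := k + 5) (a := 1) (b := k + 4) (c := 0) (x0 := 4) (x1 := 5) (x2 := 6 * k + 22) (by refine ⟨by omega, ?_, ?_, ?_⟩ <;> simp [HR] <;> omega) a0 a1 a2)
    (hex_eq (m := k + 5) (a := 0) (b := k + 5) (c := 0) (x0 := 0) (x1 := 0) (x2 := 6 * k + 31) (by refine ⟨by omega, ?_, ?_, ?_⟩ <;> simp [HR] <;> omega) a0 a1 a2)]
  congr 1
  unfold ed
  push_cast
  ring

lemma cor7 (k : ℕ) (a0 a1 a2 : ℝ) :
    edl (hex (k + 5) a0 a1 a2) (0, k + 3) = (ed (a0 * (10) + a1 * (5) + a2 * (6 * k + 16)) (a0 * (6) + a1 * (6) + a2 * (6 * k + 19)) (a0 * (5) + a1 * (4) + a2 * (6 * k + 22))) / (6 * ((k + 5 : ℕ) : ℝ) + 1) ^ 2 := by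
  rw [edl_eq3 _ _ _
    (hex_eq (m := k + 5) (a := 0) (b := k + 3) (c := 2) (x0 := 10) (x1 := 5) (x2 := 6 * k + 16) (by refine ⟨by omega, ?_, ?_, ?_⟩ <;> simp [HR] <;> omega) a0 a1 a2)
    (hex_eq (m := k + 5) (a := 1) (b := k + 3) (c := 1) (x0 := 6) (x1 := 6) (x2 := 6 * k + 19) (by refine ⟨by omega, ?_, ?_, ?_⟩ <;> simp [HR] <;> omega) a0 a1 a2)
    (hex_eq (m := k + 5) (a := 0) (b := k + 4) (c := 1) (x0 := 5) (x1 := 4) (x2 := 6 * k + 22) (by refine ⟨by omega, ?_, ?_, ?_⟩ <;> simp [HR] <;> omega) a0 a1 a2)]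
  congr 1
  unfold ed
  push_cast
  ring

lemma cor8 (k : ℕ) (a0 a1 a2 : ℝ) :
    edl (hex (k + 5) a0 a1 a2) (1, k + 3) = (ed (a0 * (6) + a1 * (6) + a2 * (6 * k + 19)) (a0 * (5) + a1 * (10) + a2 * (6 * k + 16)) (a0 * (4) + a1 * (5) + a2 * (6 * k + 22))) / (6 * ((k + 5 : ℕ) : ℝ) + 1) ^ 2 := by
  rw [edl_eq3 _ _ _
    (hex_eq (m := k + 5) (a := 1) (b := k + 3) (c := 1) (x0 := 6) (x1 := 6) (x2 := 6 * k + 19) (by refine ⟨by omega, ?_, ?_, ?_⟩ <;> simp [HR] <;> omega) a0 a1 a2)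
    (hex_eq (m := k + 5) (a := 2) (b := k + 3) (c := 0) (x0 := 5) (x1 := 10) (x2 := 6 * k + 16) (by refine ⟨by omega, ?_, ?_, ?_⟩ <;> simp [HR] <;> omega) a0 a1 a2)
    (hex_eq (m := k + 5) (a := 1) (b := k + 4) (c := 0) (x0 := 4) (x1 := 5) (x2 := 6 * k + 22) (by refine ⟨by omega, ?_, ?_, ?_⟩ <;> simp [HR] <;> omega) a0 a1 a2)]
  congr 1
  unfold ed
  push_cast
  ring

lemma hex_energy {m : ℕ} (hm : 5 ≤ m) (a0 a1 a2 : ℝ) :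
    ∑ i ∈ SF m, edl (hex m a0 a1 a2) i = rl m * ed a0 a1 a2 := by
  obtain ⟨k, rfl⟩ : ∃ k, m = k + 5 := ⟨m - 5, by omega⟩
  rw [sum_SF hm, show k + 5 - 1 = k + 4 from rfl, sum_split]
  have k3 : k + 4 - (k + 3) = 1 := by omega
  have k4 : k + 4 - 1 = k + 3 := by omega
  have mid : ∀ j ∈ Finset.range (k + 1), edl (hex (k + 5) a0 a1 a2) (j + 2, 0) +
      edl (hex (k + 5) a0 a1 a2) (k + 4 - (j + 2), j + 2) + edl (hex (k + 5) a0 a1 a2) (0, k + 4 - (j + 2)) =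
      54 * ed a0 a1 a2 / (6 * ((k + 5 : ℕ) : ℝ) + 1) ^ 2 := by
    intro j hj
    obtain ⟨d, rfl⟩ : ∃ d, k = j + d := Nat.exists_eq_add_of_le (by simpa [Nat.lt_succ_iff] using hj)
    have e : j + d + 4 - (j + 2) = d + 2 := by omega
    rw [e, mid_bot, mid_hyp, mid_left]
    unfold ed; ring
  rw [Finset.sum_congr rfl mid, Finset.sum_const, Finset.card_range, nsmul_eq_mul, k3, k4, Nat.sub_zero,
    cor0, cor1, cor2, cor3, cor4, cor5, cor6, cor7, cor8]
  have hr : rl (k + 5) = 9 / (6 * ((k + 5 : ℕ) : ℝ) + 1) := by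
    unfold rl; rw [inv_eq_one_div, div_eq_div_iff (by positivity) (by positivity)]; ring
  rw [hr]
  have hD : (6 * ((k + 5 : ℕ) : ℝ) + 1) ≠ 0 := by positivity
  push_cast at hD ⊢
  field_simp
  unfold ed
  ring

lemma edc_eq (u : E2 → ℝ) (n : ℕ) (p : ℕ × ℕ) : edc q l u n p = edl (fun v => u (lpt q l n v)) p := rfl

lemma ch_edl (g : ℕ × ℕ → ℝ) (m : ℕ) (P i : ℕ × ℕ) :
    edl (fun v => g (ch m P v)) i = edl g (ch m P i) := by
  simp only [edl, ch, add_assoc]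

lemma ch_corner (hl : ∀ m, 5 ≤ l m) (n : ℕ) (P : ℕ × ℕ) :
    lpt q l (n + 1) (ch (l n) P (0, 0)) = lpt q l n P ∧
    lpt q l (n + 1) (ch (l n) P (l n, 0)) = lpt q l n (P.1 + 1, P.2) ∧
    lpt q l (n + 1) (ch (l n) P (0, l n)) = lpt q l n (P.1, P.2 + 1) := by
  refine ⟨?_, ?_, ?_⟩
  · rw [← lpt_ch hl n P]; simp [ch]
  · rw [← lpt_ch hl n (P.1 + 1, P.2)]; simp [ch, mul_add]
  · rw [← lpt_ch hl n (P.1, P.2 + 1)]; simp [ch, mul_add]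

lemma edc_le (hl : ∀ m, 5 ≤ l m) (u : E2 → ℝ) (n : ℕ) (P : ℕ × ℕ) :
    edc q l u n P ≤ (rl (l n))⁻¹ * ∑ i ∈ SF (l n), edc q l u (n + 1) (ch (l n) P i) := by
  have h := trace_le (hl n) (fun v => u (lpt q l (n + 1) (ch (l n) P v)))
  obtain ⟨h0, h1, h2⟩ := ch_corner (q := q) hl n P
  rw [h0, h1, h2] at h
  refine h.trans (le_of_eq ?_)
  congr 1

lemma En_mono (hl : ∀ m, 5 ≤ l m) (u : E2 → ℝ) : Monotone fun n => En q l n u u := by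
  refine monotone_nat_of_le_succ fun n => ?_
  rw [En_eq hl, En_eq hl, sum_CF_succ hl, Rn_succ, mul_inv, mul_assoc]
  refine mul_le_mul_of_nonneg_left ?_ (inv_nonneg.2 (Rn_pos l n).le)
  rw [Finset.mul_sum]
  exact Finset.sum_le_sum fun P _ => edc_le hl u n P

lemma En_le_EForm (hl : ∀ m, 5 ≤ l m) {u : E2 → ℝ} (hu : u ∈ FDom q l) (n : ℕ) :
    En q l n u u ≤ EForm q l u u := by
  obtain ⟨C, hC⟩ := hu
  have hb : BddAbove (range fun n => En q l n u u) := ⟨C, by rintro _ ⟨n, rfl⟩; exact hC n⟩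
  have ht := tendsto_atTop_ciSup (En_mono (q := q) hl u) hb
  unfold EForm
  rw [ht.limUnder_eq]
  exact le_ciSup hb n

lemma sum_edc_le (hl : ∀ m, 5 ≤ l m) {u : E2 → ℝ} (hu : u ∈ FDom q l) (n : ℕ) :
    ∑ p ∈ CF l n, edc q l u n p ≤ Rn l n * EForm q l u u := by
  have h := En_le_EForm hl hu n
  rw [En_eq hl, inv_mul_le_iff₀ (Rn_pos l n)] at h
  exact h

lemma edc_nonneg (u : E2 → ℝ) (n : ℕ) (p : ℕ × ℕ) : 0 ≤ edc q l u n p := by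
  unfold edc ed; positivity

lemma edl_vert (g : ℕ × ℕ → ℝ) {v w p : ℕ × ℕ} (hv : IsV v p) (hw : IsV w p) : (g v - g w) ^ 2 ≤ edl g p := by
  unfold edl ed
  rcases hv with h | h | h <;> rcases hw with h' | h' | h' <;> rw [h, h'] <;> nlinarith [sq_nonneg (g p - g (p.1+1,p.2)), sq_nonneg (g (p.1+1,p.2) - g (p.1,p.2+1)), sq_nonneg (g (p.1,p.2+1) - g p)]

lemma side_le {m a : ℕ} (ha : a ≤ m) (g : ℕ × ℕ → ℝ) (φ : ℕ → ℕ × ℕ) (hi : InjOn φ (Iio m))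
    (hm : ∀ i < m, φ i ∈ SF m) (G : ℕ → ℝ) (hG : ∀ i < m, (G (i + 1) - G i) ^ 2 ≤ edl g (φ i)) :
    (G a - G 0) ^ 2 ≤ m * ∑ i ∈ SF m, edl g i := by
  refine (tele a G).trans ?_
  have h1 : ∑ j ∈ Finset.range a, (G (j + 1) - G j) ^ 2 ≤ ∑ i ∈ SF m, edl g i := by
    calc _ ≤ ∑ j ∈ Finset.range a, edl g (φ j) := Finset.sum_le_sum fun j hj =>
            hG j (by have := Finset.mem_range.1 hj; omega)
      _ = ∑ p ∈ (Finset.range a).image φ, edl g p := by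
          rw [Finset.sum_image]
          intro x hx y hy h
          exact hi (by simp at hx ⊢; omega) (by simp at hy ⊢; omega) h
      _ ≤ _ := by
          refine Finset.sum_le_sum_of_subset_of_nonneg ?_ fun i _ _ => edl_nonneg _ _
          intro p hp
          obtain ⟨j, hj, rfl⟩ := Finset.mem_image.1 hp
          exact hm j (by have := Finset.mem_range.1 hj; omega)
  have h0 : 0 ≤ ∑ j ∈ Finset.range a, (G (j + 1) - G j) ^ 2 := Finset.sum_nonneg fun _ _ => sq_nonneg _
  have : (a : ℝ) ≤ m := by exact_mod_cast ha
  exact mul_le_mul this h1 h0 (by positivity)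

lemma perim_le {m : ℕ} (hm : 5 ≤ m) (g : ℕ × ℕ → ℝ) {j : ℕ × ℕ} (hj : IsP m j) :
    ∃ c, (c = (0, 0) ∨ c = (m, 0)) ∧ (g j - g c) ^ 2 ≤ m * ∑ i ∈ SF m, edl g i := by
  obtain ⟨a, b⟩ := j
  obtain ⟨h1, h2⟩ := hj
  simp only at h1 h2
  rcases h2 with rfl | rfl | h2
  · refine ⟨_, Or.inl rfl, ?_⟩
    refine side_le (a := b) (by omega) g (fun i => (0, i)) ?_ ?_ (fun i => g (0, i)) ?_
    · intro x _ y _ h; simpa using h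
    · intro i hi; rw [mem_SF' hm]; simp; omega
    · intro i hi; exact edl_vert g (Or.inr (Or.inr rfl)) (Or.inl rfl)
  · refine ⟨_, Or.inl rfl, ?_⟩
    refine side_le (a := a) (by omega) g (fun i => (i, 0)) ?_ ?_ (fun i => g (i, 0)) ?_
    · intro x _ y _ h; simpa using h
    · intro i hi; rw [mem_SF' hm]; simp; omega
    · intro i hi; exact edl_vert g (Or.inr (Or.inl rfl)) (Or.inl rfl)
  · refine ⟨_, Or.inr rfl, ?_⟩
    have := side_le (m := m) (a := b) (by omega) g (fun i => (m - 1 - i, i)) ?_ ?_ (fun i => g (m - i, i)) ?_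
    · have e : m - b = a := by omega
      simpa [e] using this
    · intro x _ y _ h; simp at h; exact h.2
    · intro i hi; rw [mem_SF' hm]; simp; omega
    · intro i hi
      refine edl_vert g (Or.inr (Or.inr ?_)) (Or.inr (Or.inl ?_)) <;> simp <;> omega

/-- oscillation scale -/
def osc (q : Fin 3 → E2) (l : ℕ → ℕ) (u : E2 → ℝ) (n : ℕ) : ℝ := Real.sqrt (Rn l n * EForm q l u u)

lemma EForm_nonneg (hl : ∀ m, 5 ≤ l m) {u : E2 → ℝ} (hu : u ∈ FDom q l) : 0 ≤ EForm q l u u := by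
  refine le_trans ?_ (En_le_EForm hl hu 0)
  rw [En_eq hl]
  exact mul_nonneg (inv_nonneg.2 (Rn_pos l 0).le) (Finset.sum_nonneg fun _ _ => edc_nonneg _ _ _)

lemma vert_osc (hl : ∀ m, 5 ≤ l m) {u : E2 → ℝ} (hu : u ∈ FDom q l) {n : ℕ} {p v w : ℕ × ℕ} (hp : p ∈ CF l n)
    (hv : IsV v p) (hw : IsV w p) : |u (lpt q l n v) - u (lpt q l n w)| ≤ osc q l u n := by
  unfold osc
  refine Real.abs_le_sqrt ?_
  refine (edl_vert (fun v => u (lpt q l n v)) hv hw).trans (le_trans ?_ (sum_edc_le hl hu n))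
  exact Finset.single_le_sum (f := fun p => edc q l u n p) (fun _ _ => edc_nonneg _ _ _) hp

lemma osc_succ (hl : ∀ m, 5 ≤ l m) {u : E2 → ℝ} (hu : u ∈ FDom q l) (n : ℕ) :
    osc q l u (n + 1) ≤ 3 / 5 * osc q l u n := by
  unfold osc
  have hE := EForm_nonneg hl hu
  have hR := Rn_pos l n
  refine Real.sqrt_le_iff.2 ⟨by positivity, ?_⟩
  rw [mul_pow, Real.sq_sqrt (by positivity), Rn_succ]
  have : rl (l n) ≤ 9 / 25 := by
    unfold rl; rw [inv_le_comm₀ (by positivity) (by norm_num)]; have := l_ge hl n; linarith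
  nlinarith [mul_nonneg hR.le hE]

lemma step_osc (hl : ∀ m, 5 ≤ l m) {u : E2 → ℝ} (hu : u ∈ FDom q l) {n : ℕ} {P v j : ℕ × ℕ} (hP : P ∈ CF l n)
    (hv : IsV v P) (hj : IsP (l n) j) :
    |u (lpt q l n v) - u (lpt q l (n + 1) (ch (l n) P j))| ≤ 3 * osc q l u n := by
  obtain ⟨c, hc, h⟩ := perim_le (hl n) (fun v => u (lpt q l (n + 1) (ch (l n) P v))) hj
  obtain ⟨h0, h1, h2⟩ := ch_corner (q := q) hl n P
  obtain ⟨w, hw, hwc⟩ : ∃ w, IsV w P ∧ lpt q l (n + 1) (ch (l n) P c) = lpt q l n w := by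
    rcases hc with rfl | rfl
    · exact ⟨_, Or.inl rfl, h0⟩
    · exact ⟨_, Or.inr (Or.inl rfl), h1⟩
  have hvw := vert_osc hl hu hP hv hw
  have hE := EForm_nonneg hl hu
  have hR := Rn_pos l n
  have hb : |u (lpt q l (n + 1) (ch (l n) P j)) - u (lpt q l n w)| ≤ 2 * osc q l u n := by
    have e2 : 2 * osc q l u n = Real.sqrt (4 * (Rn l n * EForm q l u u)) := by
      rw [Real.sqrt_mul (by norm_num), show (4 : ℝ) = 2 ^ 2 by norm_num, Real.sqrt_sq (by norm_num)]; rfl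
    rw [e2]
    refine Real.abs_le_sqrt ?_
    simp only [hwc] at h
    refine h.trans ?_
    have h3 : ∑ i ∈ SF (l n), edl (fun v => u (lpt q l (n + 1) (ch (l n) P v))) i ≤
        Rn l (n + 1) * EForm q l u u := by
      refine le_trans ?_ (sum_edc_le hl hu (n + 1))
      rw [sum_CF_succ hl]
      refine le_trans (le_of_eq ?_) (Finset.single_le_sum (f := fun P => ∑ i ∈ SF (l n), edc q l u (n + 1) (ch (l n) P i))
        (fun _ _ => Finset.sum_nonneg fun _ _ => edc_nonneg _ _ _) hP)
      refine Finset.sum_congr rfl fun i _ => ?_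
      rw [edc_eq, ← ch_edl]
    refine (mul_le_mul_of_nonneg_left h3 (by positivity)).trans ?_
    rw [Rn_succ]
    have h4 : (l n : ℝ) * rl (l n) ≤ 4 := by
      unfold rl; rw [← div_eq_mul_inv, div_le_iff₀ (by positivity)]; have := l_ge hl n; linarith
    nlinarith [mul_nonneg hR.le hE, mul_le_mul_of_nonneg_right h4 (mul_nonneg hR.le hE)]
  rw [abs_le] at *
  constructor <;> linarith [hvw.1, hvw.2, hb.1, hb.2]

lemma Ln_tendsto (hl : ∀ m, 5 ≤ l m) (n : ℕ) : Tendsto (fun k => 1 / (Ln l (n + k) : ℝ)) atTop (nhds 0) := by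
  have hL := Ln_pos hl n
  refine squeeze_zero (fun k => by have := Ln_pos hl (n + k); positivity) (g := fun k => (1 / 5 : ℝ) ^ k * (1 / Ln l n)) (fun k => ?_) ?_
  · have h := Ln_ge_pow hl n k
    have e : (1 / 5 : ℝ) ^ k * (1 / Ln l n) = 1 / (5 ^ k * Ln l n) := by
      rw [div_pow, one_pow, div_mul_div_comm, one_mul]
    rw [e]
    exact one_div_le_one_div_of_le (by positivity) h
  · have := (tendsto_pow_atTop_nhds_zero_of_lt_one (by norm_num : (0 : ℝ) ≤ 1 / 5) (by norm_num)).mul_const (1 / (Ln l n : ℝ))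
    simpa using this

lemma pt_osc (hq : Equi q) (hl : ∀ m, 5 ≤ l m) {u : E2 → ℝ} (hu : u ∈ FDom q l)
    (huc : ContinuousOn u (Gasket q l)) {n : ℕ} {P v : ℕ × ℕ} {x : E2} (hx : x ∈ Gasket q l)
    (hP : P ∈ CF l n) (hxP : x ∈ tri q l n P) (hv : IsV v P) :
    |u (lpt q l n v) - u x| ≤ 15 / 2 * osc q l u n := by
  obtain ⟨c, w, hc0, hw0, h1, h2⟩ := descSeq hq hl hx hP hxP hv
  have hind : ∀ k, |u (lpt q l n v) - u (lpt q l (n + k) (w k))| ≤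
      15 / 2 * (osc q l u n - osc q l u (n + k)) := by
    intro k
    induction k with
    | zero => simp [hw0]
    | succ k ih =>
      obtain ⟨-, j, hj, hw⟩ := h2 k
      have hs := step_osc hl hu (h1 k).1 (h1 k).2.2 hj
      rw [← hw] at hs
      have ho := osc_succ hl hu (n + k)
      rw [← add_assoc]
      rw [abs_le] at *
      constructor <;> linarith [hs.1, hs.2, ih.1, ih.2]
  have hK : ∀ k, lpt q l (n + k) (w k) ∈ Gasket q l := fun k =>
    per_sub_K hl (h1 k).1 (isV_per (h1 k).2.2)
  have htend : Tendsto (fun k => lpt q l (n + k) (w k)) atTop (nhds x) := by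
    rw [tendsto_iff_dist_tendsto_zero]
    exact squeeze_zero (fun _ => dist_nonneg) (fun k => tri_diam hq hl
      (per_sub_tri (isV_per (h1 k).2.2)) (h1 k).2.1) (Ln_tendsto hl n)
  have hu1 : Tendsto (fun k => u (lpt q l (n + k) (w k))) atTop (nhds (u x)) :=
    (huc x hx).tendsto.comp (tendsto_nhdsWithin_iff.2 ⟨htend, Eventually.of_forall hK⟩)
  have hu2 := (tendsto_const_nhds (x := u (lpt q l n v))).sub hu1 |>.abs
  refine le_of_tendsto hu2 (Eventually.of_forall fun k => (hind k).trans ?_)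
  have : 0 ≤ osc q l u (n + k) := Real.sqrt_nonneg _
  linarith

lemma chain_osc (U : ℕ × ℕ → ℝ) (k : ℕ) : ∀ (P : Finset (ℕ × ℕ)) (v0 v p p' : ℕ × ℕ), Ch k P v0 p p' → p ∉ P → IsV v p →
    ∃ z, IsV z p' ∧ ∃ S : Finset (ℕ × ℕ), S ⊆ insert p P ∧ S.card ≤ k ∧
      |U v - U z| ≤ ∑ r ∈ S, Real.sqrt (edl U r) := by
  induction k with
  | zero =>
    intro P v0 v p p' h _ hv
    have : p = p' := h
    subst this
    exact ⟨v, hv, ∅, by simp, by simp, by simp⟩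
  | succ k ih =>
    intro P v0 v p p' h hp hv
    obtain ⟨w, p1, -, hw, hw1, hp1, hne, hc⟩ := h
    obtain ⟨z, hz, S, hS, hSc, hle⟩ := ih (P.erase p1) w w p1 p' hc (Finset.notMem_erase _ _) hw1
    rw [Finset.insert_erase hp1] at hS
    have hpS : p ∉ S := fun h => hp (hS h)
    refine ⟨z, hz, insert p S, Finset.insert_subset_insert _ hS, ?_, ?_⟩
    · rw [Finset.card_insert_of_notMem hpS]; omega
    · rw [Finset.sum_insert hpS]
      have := Real.abs_le_sqrt (edl_vert U hv hw)
      exact (abs_sub_le _ (U w) _).trans (add_le_add this hle)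

lemma diff_le (hq : Equi q) (hl : ∀ m, 5 ≤ l m) {u : E2 → ℝ} (hu : u ∈ FDom q l)
    (huc : ContinuousOn u (Gasket q l)) (n : ℕ) {x y : E2} (hx : x ∈ Gasket q l) (hy : y ∈ Gasket q l) {s : ℝ}
    (hs : gdist q l x y < s) :
    (u x - u y) ^ 2 ≤ 3 * (225 / 2 + (Ln l n * s + 1)) * (Rn l n * EForm q l u u) := by
  obtain ⟨p, hp, hxp⟩ := (mem_K hl x).1 hx n
  obtain ⟨k, p', hc, hyp, hk⟩ := chain_path hq hl hx hy hs hp hxp (v := (p.1 + 2, p.2)) (by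
    unfold IsV; rintro (h | h | h) <;> simp [Prod.ext_iff] at h)
  set U : ℕ × ℕ → ℝ := fun v => u (lpt q l n v) with hU
  obtain ⟨z, hz, S, hS, hSc, hle⟩ := chain_osc U k _ _ p p p' hc (Finset.notMem_erase _ _) (Or.inl rfl)
  rw [Finset.insert_erase hp] at hS
  have hp' : p' ∈ CF l n := by
    have : ∀ (k : ℕ) (P : Finset (ℕ × ℕ)) (v p p' : ℕ × ℕ), p ∈ CF l n → P ⊆ CF l n → Ch k P v p p' → p' ∈ CF l n := by
      intro k
      induction k with
      | zero => intro P v p p' hp _ h; have : p = p' := h; exact this ▸ hp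
      | succ k ih =>
        rintro P v p p' hp hP ⟨w, p1, -, -, -, hp1, -, h⟩
        exact ih _ _ _ _ (hP hp1) ((Finset.erase_subset _ _).trans hP) h
    exact this _ _ _ _ _ hp (Finset.erase_subset _ _) hc
  have h1 := pt_osc hq hl hu huc hx hp hxp (v := p) (Or.inl rfl)
  have h2 := pt_osc hq hl hu huc hy hp' hyp hz
  have hE := EForm_nonneg hl hu
  have hR := Rn_pos l n
  have ho : osc q l u n ^ 2 = Rn l n * EForm q l u u := by unfold osc; rw [Real.sq_sqrt (by positivity)]
  have ho0 : 0 ≤ osc q l u n := Real.sqrt_nonneg _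
  have hsum : (∑ r ∈ S, Real.sqrt (edl U r)) ^ 2 ≤ k * (Rn l n * EForm q l u u) := by
    have := sq_sum_le_card_mul_sum_sq (s := S) (f := fun r => Real.sqrt (edl U r))
    refine this.trans ?_
    have e : ∑ r ∈ S, Real.sqrt (edl U r) ^ 2 = ∑ r ∈ S, edl U r :=
      Finset.sum_congr rfl fun r _ => Real.sq_sqrt (edl_nonneg _ _)
    rw [e]
    have h3 : ∑ r ∈ S, edl U r ≤ Rn l n * EForm q l u u :=
      (Finset.sum_le_sum_of_subset_of_nonneg hS fun _ _ _ => edl_nonneg _ _).trans (sum_edc_le hl hu n)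
    have h4 : (S.card : ℝ) ≤ k := by exact_mod_cast hSc
    exact mul_le_mul h4 h3 (Finset.sum_nonneg fun _ _ => edl_nonneg _ _) (by positivity)
  set X := ∑ r ∈ S, Real.sqrt (edl U r) with hX
  have hX0 : 0 ≤ X := Finset.sum_nonneg fun _ _ => Real.sqrt_nonneg _
  have habs : |u x - u y| ≤ 15 * osc q l u n + X := by
    simp only [hU] at hle
    rw [abs_le] at *
    constructor <;> linarith [h1.1, h1.2, h2.1, h2.2, hle.1, hle.2]
  have h5 : (u x - u y) ^ 2 ≤ (15 * osc q l u n + X) ^ 2 := by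
    rw [← sq_abs]; exact pow_le_pow_left₀ (abs_nonneg _) habs 2
  have h6 : (15 * osc q l u n + X) ^ 2 ≤ 3 / 2 * (15 * osc q l u n) ^ 2 + 3 * X ^ 2 := by
    nlinarith [sq_nonneg (15 * osc q l u n - 2 * X)]
  have h7 : (k : ℝ) * (Rn l n * EForm q l u u) ≤ (Ln l n * s + 1) * (Rn l n * EForm q l u u) :=
    mul_le_mul_of_nonneg_right hk.le (by positivity)
  rw [mul_pow, ho] at h6
  linarith

lemma gdist_zero (hq : Equi q) (hl : ∀ m, 5 ≤ l m) {x y : E2} (hx : x ∈ Gasket q l) (hy : y ∈ Gasket q l)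
    (h : gdist q l x y ≤ 0) : x = y :=
  dist_le_zero.1 ((dist_le_gdist hq hl hx hy).trans h)

lemma sq_le_PsiR (hq : Equi q) (hl : ∀ m, 5 ≤ l m) {PsiR : ℝ → ℝ} (hPsiR : IsPsiR l PsiR)
    {x y : E2} (hx : x ∈ Gasket q l) (hy : y ∈ Gasket q l) {u : E2 → ℝ} (hu : u ∈ FDom q l)
    (huc : ContinuousOn u (Gasket q l)) :
    (u x - u y) ^ 2 ≤ (2 : ℝ) ^ 12 * PsiR (gdist q l x y) * EForm q l u u := by
  have hE := EForm_nonneg hl hu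
  set s := gdist q l x y with hs
  have h0 : 0 ≤ s := gdist_nonneg _ _
  rcases h0.eq_or_lt with h0 | h0
  · have : x = y := gdist_zero hq hl hx hy h0.ge
    rw [← h0, hPsiR.2.2, this]; simp
  rcases le_total s 1 with h1 | h1
  · obtain ⟨n, h2, h3⟩ := exists_scale hl h0 h1
    obtain ⟨h4, h5, -⟩ := scale_inv hl h2 h3
    have hd := diff_le hq hl hu huc (n + 1) hx hy (s := 2 * s) (by linarith)
    rw [hPsiR.1 n s h4 h5, psiRPiece]
    have hR := Rn_pos l (n + 1)
    have hc := (cR_bd hl n).1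
    set c := ((2 / 3) * (l n : ℝ) - 8 / 9) / ((l n : ℝ) - 1)
    set t := (Ln l (n + 1) : ℝ) * s with ht
    have e : (Ln l (n + 1) : ℝ) * (2 * s) = 2 * t := by rw [ht]; ring
    rw [e] at hd
    have hRE : 0 ≤ Rn l (n + 1) * EForm q l u u := by positivity
    have hct : 11 / 18 * (t - 1) ≤ c * (t - 1) := mul_le_mul_of_nonneg_right hc (by linarith)
    calc _ ≤ _ := hd
      _ ≤ (2 ^ 12 * (1 + c * (t - 1))) * (Rn l (n + 1) * EForm q l u u) :=
          mul_le_mul_of_nonneg_right (by linarith) hRE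
      _ = _ := by ring
  · have p1 := pt_osc hq hl hu huc hx (CF_zero l) (mem_zero hl hx) (v := (0, 0)) (Or.inl rfl)
    have p2 := pt_osc hq hl hu huc hy (CF_zero l) (mem_zero hl hy) (v := (0, 0)) (Or.inl rfl)
    have ho : osc q l u 0 ^ 2 = EForm q l u u := by
      unfold osc; rw [Rn_zero, one_mul, Real.sq_sqrt hE]
    have habs : |u x - u y| ≤ 15 * osc q l u 0 := by
      rw [abs_le] at *
      constructor <;> linarith [p1.1, p1.2, p2.1, p2.2]
    have h5 : (u x - u y) ^ 2 ≤ (15 * osc q l u 0) ^ 2 := by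
      rw [← sq_abs]; exact pow_le_pow_left₀ (abs_nonneg _) habs 2
    rw [mul_pow, ho] at h5
    rw [hPsiR.2.1 s h1]
    have h6 : 1 ≤ s ^ betaR l := Real.one_le_rpow h1 (betaR_le hl).1
    nlinarith

lemma R_upper (hq : Equi q) (hl : ∀ m, 5 ≤ l m) {PsiR : ℝ → ℝ} (hPsiR : IsPsiR l PsiR)
    {x y : E2} (hx : x ∈ Gasket q l) (hy : y ∈ Gasket q l) :
    ∀ t ∈ REcSet q l x y, t ≤ (2 : ℝ) ^ 12 * PsiR (gdist q l x y) := by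
  rintro t ⟨u, hu, huc, hE, rfl⟩
  rw [div_le_iff₀ hE]
  exact sq_le_PsiR hq hl hPsiR hx hy hu huc

lemma PsiR_nonneg (hl : ∀ m, 5 ≤ l m) {PsiR : ℝ → ℝ} (hPsiR : IsPsiR l PsiR) {s : ℝ} (h0 : 0 ≤ s) :
    0 ≤ PsiR s := by
  rcases h0.eq_or_lt with h0 | h0
  · rw [← h0, hPsiR.2.2]
  rcases le_total s 1 with h1 | h1
  · obtain ⟨n, h2, h3⟩ := exists_scale hl h0 h1
    obtain ⟨h4, h5, -⟩ := scale_inv hl h2 h3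
    rw [hPsiR.1 n s h4 h5, psiRPiece]
    have hR := Rn_pos l (n + 1)
    have hc := (cR_bd hl n).1
    have : 0 ≤ (Ln l (n + 1) : ℝ) * s - 1 := by linarith
    have hc0 : 0 ≤ ((2 / 3) * (l n : ℝ) - 8 / 9) / ((l n : ℝ) - 1) := by linarith
    positivity
  · rw [hPsiR.2.1 s h1]; positivity

/-- iterated harmonic extension of a lattice function from level `m` -/
def Us (l : ℕ → ℕ) (m : ℕ) (U : ℕ × ℕ → ℝ) : ℕ → ℕ × ℕ → ℝ
  | 0 => U
  | j + 1 => fun v => hex (l (m + j)) (Us l m U j (v.1 / l (m + j), v.2 / l (m + j)))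
      (Us l m U j (v.1 / l (m + j) + 1, v.2 / l (m + j)))
      (Us l m U j (v.1 / l (m + j), v.2 / l (m + j) + 1)) (v.1 % l (m + j), v.2 % l (m + j))

lemma Us_ch (hl : ∀ m, 5 ≤ l m) (m : ℕ) (U : ℕ × ℕ → ℝ) (j : ℕ) (P : ℕ × ℕ) {a : ℕ × ℕ} (h : a.1 + a.2 ≤ l (m + j)) :
    Us l m U (j + 1) (ch (l (m + j)) P a) =
      hex (l (m + j)) (Us l m U j P) (Us l m U j (P.1 + 1, P.2)) (Us l m U j (P.1, P.2 + 1)) a := by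
  obtain ⟨a, b⟩ := a
  obtain ⟨A, B⟩ := P
  have h5 := hl (m + j)
  simp only [Us, ch] at *
  set L := l (m + j)
  have hL : 0 < L := by omega
  have d1 : ∀ A a : ℕ, a < L → (L * A + a) / L = A ∧ (L * A + a) % L = a := fun A a h => by
    rw [Nat.mul_add_div hL, Nat.div_eq_of_lt h, Nat.mul_add_mod, Nat.mod_eq_of_lt h]; simp
  have d2 : ∀ A : ℕ, (L * A + L) / L = A + 1 ∧ (L * A + L) % L = 0 := fun A => by
    rw [Nat.mul_add_div hL, Nat.div_self hL, Nat.mul_add_mod, Nat.mod_self]; simp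
  obtain h1 | rfl := (show a ≤ L by omega).lt_or_eq
  · obtain h2 | rfl := (show b ≤ L by omega).lt_or_eq
    · rw [(d1 A a h1).1, (d1 A a h1).2, (d1 B b h2).1, (d1 B b h2).2]
    · obtain rfl : a = 0 := by omega
      rw [(d1 A 0 h1).1, (d1 A 0 h1).2, (d2 B).1, (d2 B).2, (hex_corner h5 _ _ _).1, (hex_corner h5 _ _ _).2.2]
  · obtain rfl : b = 0 := by omega
    rw [(d1 B 0 (by omega)).1, (d1 B 0 (by omega)).2, (d2 A).1, (d2 A).2, (hex_corner h5 _ _ _).1, (hex_corner h5 _ _ _).2.1]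

lemma Us_corner (hl : ∀ m, 5 ≤ l m) (m : ℕ) (U : ℕ × ℕ → ℝ) (j : ℕ) (v : ℕ × ℕ) :
    Us l m U (j + 1) (l (m + j) * v.1, l (m + j) * v.2) = Us l m U j v := by
  have := Us_ch hl m U j v (a := (0, 0)) (by simp)
  rw [(hex_corner (hl _) _ _ _).1] at this
  simpa [ch] using this

lemma isV_SF {m : ℕ} (hm : 5 ≤ m) {i v : ℕ × ℕ} (hi : i ∈ SF m) (hv : IsV v i) : v.1 + v.2 ≤ m := by
  rw [mem_SF' hm] at hi
  rcases hv with rfl | rfl | rfl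
  · omega
  · show i.1 + 1 + i.2 ≤ m; omega
  · show i.1 + (i.2 + 1) ≤ m; omega

lemma Us_energy1 (hl : ∀ m, 5 ≤ l m) (m : ℕ) (U : ℕ × ℕ → ℝ) (j : ℕ) (P : ℕ × ℕ) :
    ∑ i ∈ SF (l (m + j)), edl (Us l m U (j + 1)) (ch (l (m + j)) P i) = rl (l (m + j)) * edl (Us l m U j) P := by
  rw [edl, ← hex_energy (hl _)]
  refine Finset.sum_congr rfl fun i hi => ?_
  rw [← ch_edl]
  simp only [edl]
  rw [Us_ch hl m U j P (isV_SF (hl _) hi (Or.inl rfl)), Us_ch hl m U j P (isV_SF (hl _) hi (Or.inr (Or.inl rfl))),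
    Us_ch hl m U j P (isV_SF (hl _) hi (Or.inr (Or.inr rfl)))]

/-- energy of the initial data -/
def e0 (l : ℕ → ℕ) (m : ℕ) (U : ℕ × ℕ → ℝ) : ℝ := (Rn l m)⁻¹ * ∑ p ∈ CF l m, edl U p

lemma e0_nonneg (l : ℕ → ℕ) (m : ℕ) (U : ℕ × ℕ → ℝ) : 0 ≤ e0 l m U :=
  mul_nonneg (inv_nonneg.2 (Rn_pos l m).le) (Finset.sum_nonneg fun _ _ => edl_nonneg _ _)

lemma Us_energy (hl : ∀ m, 5 ≤ l m) (m : ℕ) (U : ℕ × ℕ → ℝ) (j : ℕ) :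
    ∑ p ∈ CF l (m + j), edl (Us l m U j) p = Rn l (m + j) * e0 l m U := by
  induction j with
  | zero =>
    unfold e0
    rw [← mul_assoc, add_zero, mul_inv_cancel₀ (Rn_pos l m).ne', one_mul]; rfl
  | succ j ih =>
    rw [← add_assoc, sum_CF_succ hl, Rn_succ]
    rw [Finset.sum_congr rfl fun P _ => Us_energy1 hl m U j P, ← Finset.mul_sum, ih]
    ring

def mx (g : ℕ × ℕ → ℝ) (p : ℕ × ℕ) : ℝ := max (g p) (max (g (p.1 + 1, p.2)) (g (p.1, p.2 + 1)))
def mn (g : ℕ × ℕ → ℝ) (p : ℕ × ℕ) : ℝ := min (g p) (min (g (p.1 + 1, p.2)) (g (p.1, p.2 + 1)))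

lemma isV_mem (g : ℕ × ℕ → ℝ) {v p : ℕ × ℕ} (hv : IsV v p) : g v ∈ Icc (mn g p) (mx g p) := by
  unfold mn mx
  rcases hv with h | h | h <;> rw [h] <;> simp

lemma mx_exists (g : ℕ × ℕ → ℝ) (p : ℕ × ℕ) : ∃ v, IsV v p ∧ g v = mx g p := by
  unfold mx
  rcases max_choice (g p) (max (g (p.1 + 1, p.2)) (g (p.1, p.2 + 1))) with h | h
  · exact ⟨p, Or.inl rfl, h.symm⟩
  · rw [h]
    rcases max_choice (g (p.1 + 1, p.2)) (g (p.1, p.2 + 1)) with h | h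
    · exact ⟨_, Or.inr (Or.inl rfl), h.symm⟩
    · exact ⟨_, Or.inr (Or.inr rfl), h.symm⟩

lemma mn_exists (g : ℕ × ℕ → ℝ) (p : ℕ × ℕ) : ∃ v, IsV v p ∧ g v = mn g p := by
  unfold mn
  rcases min_choice (g p) (min (g (p.1 + 1, p.2)) (g (p.1, p.2 + 1))) with h | h
  · exact ⟨p, Or.inl rfl, h.symm⟩
  · rw [h]
    rcases min_choice (g (p.1 + 1, p.2)) (g (p.1, p.2 + 1)) with h | h
    · exact ⟨_, Or.inr (Or.inl rfl), h.symm⟩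
    · exact ⟨_, Or.inr (Or.inr rfl), h.symm⟩

lemma mn_le_mx (g : ℕ × ℕ → ℝ) (p : ℕ × ℕ) : mn g p ≤ mx g p :=
  (isV_mem g (Or.inl rfl : IsV p p)).1.trans (isV_mem g (Or.inl rfl)).2

lemma Us_nest (hl : ∀ m, 5 ≤ l m) (m : ℕ) (U : ℕ × ℕ → ℝ) (j : ℕ) (P : ℕ × ℕ) {i : ℕ × ℕ} (hi : i ∈ SF (l (m + j))) :
    mn (Us l m U j) P ≤ mn (Us l m U (j + 1)) (ch (l (m + j)) P i) ∧
    mx (Us l m U (j + 1)) (ch (l (m + j)) P i) ≤ mx (Us l m U j) P := by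
  have key : ∀ v, IsV v (ch (l (m + j)) P i) → Us l m U (j + 1) v ∈ Icc (mn (Us l m U j) P) (mx (Us l m U j) P) := by
    intro v hv
    obtain ⟨w, hw, rfl⟩ : ∃ w, IsV w i ∧ v = ch (l (m + j)) P w := by
      rcases hv with h | h | h
      · exact ⟨i, Or.inl rfl, h⟩
      · exact ⟨_, Or.inr (Or.inl rfl), by rw [h]; simp [ch, add_assoc]⟩
      · exact ⟨_, Or.inr (Or.inr rfl), by rw [h]; simp [ch, add_assoc]⟩
    rw [Us_ch hl m U j P (isV_SF (hl _) hi hw)]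
    exact hex_mem (hl _) (isV_mem _ (Or.inl rfl)) (isV_mem _ (Or.inr (Or.inl rfl))) (isV_mem _ (Or.inr (Or.inr rfl))) hi hw
  obtain ⟨v, hv, h1⟩ := mn_exists (Us l m U (j + 1)) (ch (l (m + j)) P i)
  obtain ⟨w, hw, h2⟩ := mx_exists (Us l m U (j + 1)) (ch (l (m + j)) P i)
  rw [← h1, ← h2]
  exact ⟨(key v hv).1, (key w hw).2⟩

lemma Us_desc (hq : Equi q) (hl : ∀ m, 5 ≤ l m) (m : ℕ) (U : ℕ × ℕ → ℝ) {x : E2} (hx : x ∈ Gasket q l) {j : ℕ} {P : ℕ × ℕ}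
    (hP : P ∈ CF l (m + j)) (hxP : x ∈ tri q l (m + j) P) (k : ℕ) :
    ∃ p ∈ CF l (m + (j + k)), x ∈ tri q l (m + (j + k)) p ∧
      mn (Us l m U j) P ≤ mn (Us l m U (j + k)) p ∧ mx (Us l m U (j + k)) p ≤ mx (Us l m U j) P := by
  induction k with
  | zero => exact ⟨P, hP, hxP, le_rfl, le_rfl⟩
  | succ k ih =>
    obtain ⟨p, hp, hxp, h1, h2⟩ := ih
    obtain ⟨i, hi, hxi⟩ := desc hq hl hx hxp
    have := Us_nest hl m U (j + k) p hi
    exact ⟨_, ch_mem hp hi, hxi, h1.trans this.1, this.2.trans h2⟩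

lemma Us_meet (hq : Equi q) (hl : ∀ m, 5 ≤ l m) (m : ℕ) (U : ℕ × ℕ → ℝ) {x : E2} (hx : x ∈ Gasket q l) {j j' : ℕ} {P P' : ℕ × ℕ}
    (hP : P ∈ CF l (m + j)) (hxP : x ∈ tri q l (m + j) P) (hP' : P' ∈ CF l (m + j')) (hxP' : x ∈ tri q l (m + j') P') :
    mn (Us l m U j) P ≤ mx (Us l m U j') P' := by
  obtain ⟨p, hp, hxp, h1, -⟩ := Us_desc hq hl m U hx hP hxP j'
  obtain ⟨p', hp', hxp', -, h2⟩ := Us_desc hq hl m U hx hP' hxP' j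
  rw [add_comm j' j] at h2 hp' hxp'
  refine h1.trans (le_trans ?_ h2)
  by_cases h : p = p'
  · rw [h]; exact mn_le_mx _ _
  · obtain ⟨v, hv, hv', -⟩ := tri_inter hq hl h hxp hxp'
    exact (isV_mem _ hv).1.trans (isV_mem _ hv').2

def uset (q : Fin 3 → E2) (l : ℕ → ℕ) (m : ℕ) (U : ℕ × ℕ → ℝ) (x : E2) : Set ℝ :=
  {t | ∃ j p, p ∈ CF l (m + j) ∧ x ∈ tri q l (m + j) p ∧ t = mx (Us l m U j) p}

/-- the harmonic extension to `K` -/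
def uext (q : Fin 3 → E2) (l : ℕ → ℕ) (m : ℕ) (U : ℕ × ℕ → ℝ) (x : E2) : ℝ := sInf (uset q l m U x)

lemma uext_mem (hq : Equi q) (hl : ∀ m, 5 ≤ l m) (m : ℕ) (U : ℕ × ℕ → ℝ) {x : E2} (hx : x ∈ Gasket q l) {j : ℕ} {P : ℕ × ℕ}
    (hP : P ∈ CF l (m + j)) (hxP : x ∈ tri q l (m + j) P) :
    uext q l m U x ∈ Icc (mn (Us l m U j) P) (mx (Us l m U j) P) := by
  have hlow : ∀ t ∈ uset q l m U x, mn (Us l m U j) P ≤ t := by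
    rintro t ⟨j', p, hp, hxp, rfl⟩
    exact Us_meet hq hl m U hx hP hxP hp hxp
  exact ⟨le_csInf ⟨_, j, P, hP, hxP, rfl⟩ hlow, csInf_le ⟨_, hlow⟩ ⟨j, P, hP, hxP, rfl⟩⟩

lemma mx_sub_mn (hl : ∀ m, 5 ≤ l m) (m : ℕ) (U : ℕ × ℕ → ℝ) {j : ℕ} {P : ℕ × ℕ} (hP : P ∈ CF l (m + j)) :
    mx (Us l m U j) P - mn (Us l m U j) P ≤ Real.sqrt (Rn l (m + j) * e0 l m U) := by
  obtain ⟨v, hv, h1⟩ := mx_exists (Us l m U j) P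
  obtain ⟨w, hw, h2⟩ := mn_exists (Us l m U j) P
  rw [← h1, ← h2, ← Us_energy hl]
  refine Real.le_sqrt_of_sq_le ((edl_vert _ hv hw).trans ?_)
  exact Finset.single_le_sum (f := fun p => edl (Us l m U j) p) (fun _ _ => edl_nonneg _ _) hP

lemma Rn_le_pow (hl : ∀ m, 5 ≤ l m) (n : ℕ) : Rn l n ≤ (9 / 25 : ℝ) ^ n := by
  induction n with
  | zero => simp [Rn_zero]
  | succ n ih =>
    have : rl (l n) ≤ 9 / 25 := by
      unfold rl; rw [inv_le_comm₀ (by positivity) (by norm_num)]; have := l_ge hl n; linarith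
    rw [Rn_succ, pow_succ]
    exact mul_le_mul ih this (rl_pos _).le (by positivity)

lemma sqrt_tendsto (hl : ∀ m, 5 ≤ l m) (m : ℕ) (e : ℝ) :
    Tendsto (fun j => Real.sqrt (Rn l (m + j) * e)) atTop (nhds 0) := by
  have h : Tendsto (fun j => Rn l j) atTop (nhds 0) :=
    squeeze_zero (fun j => (Rn_pos l j).le) (Rn_le_pow hl)
      (tendsto_pow_atTop_nhds_zero_of_lt_one (by norm_num) (by norm_num))
  have h1 : Tendsto (fun j => Rn l (m + j) * e) atTop (nhds 0) := by
    have := (h.comp (tendsto_add_atTop_nat m)).mul_const e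
    simp only [zero_mul] at this
    refine this.congr fun j => ?_
    simp [add_comm]
  have := (Real.continuous_sqrt.tendsto 0).comp h1
  rw [Real.sqrt_zero] at this
  exact this

lemma uext_vert (hq : Equi q) (hl : ∀ m, 5 ≤ l m) (m : ℕ) (U : ℕ × ℕ → ℝ) {j : ℕ} {p v : ℕ × ℕ}
    (hp : p ∈ CF l (m + j)) (hv : IsV v p) : uext q l m U (lpt q l (m + j) v) = Us l m U j v := by
  have hK : lpt q l (m + j) v ∈ Gasket q l := per_sub_K hl hp (isV_per hv)
  have hsc : ∀ i, ∃ w, lpt q l (m + (j + i)) w = lpt q l (m + j) v ∧ Us l m U (j + i) w = Us l m U j v := by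
    intro i
    induction i with
    | zero => exact ⟨v, rfl, rfl⟩
    | succ i ih =>
      obtain ⟨w, h1, h2⟩ := ih
      exact ⟨_, (lpt_ch hl (m + (j + i)) w).trans h1, (Us_corner hl m U (j + i) w).trans h2⟩
  have hb : ∀ i, |uext q l m U (lpt q l (m + j) v) - Us l m U j v| ≤ Real.sqrt (Rn l (m + (j + i)) * e0 l m U) := by
    intro i
    obtain ⟨w, h1, h2⟩ := hsc i
    obtain ⟨p', hp', hxp'⟩ := (mem_K hl _).1 hK (m + (j + i))
    have hu := uext_mem hq hl m U hK hp' hxp'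
    rw [← h1] at hxp'
    have hw := isV_mem (Us l m U (j + i)) (isV_of_lpt_mem hq hl hxp')
    rw [h2] at hw
    refine le_trans ?_ (mx_sub_mn hl m U hp')
    rw [abs_le]
    constructor <;> linarith [hu.1, hu.2, hw.1, hw.2]
  have ht : Tendsto (fun i => Real.sqrt (Rn l (m + (j + i)) * e0 l m U)) atTop (nhds 0) := by
    have := sqrt_tendsto hl (m + j) (e0 l m U)
    simpa only [add_assoc] using this
  have := ge_of_tendsto' ht hb
  have := abs_nonpos_iff.1 this
  linarith

lemma uext_cont (hq : Equi q) (hl : ∀ m, 5 ≤ l m) (m : ℕ) (U : ℕ × ℕ → ℝ) :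
    ContinuousOn (uext q l m U) (Gasket q l) := by
  intro x hx
  rw [ContinuousWithinAt, Metric.tendsto_nhds]
  intro ε hε
  obtain ⟨j, hj⟩ := ((sqrt_tendsto hl m (e0 l m U)).eventually (gt_mem_nhds hε)).exists
  have hcl : IsClosed (⋃ p ∈ {p | p ∈ CF l (m + j) ∧ x ∉ tri q l (m + j) p}, tri q l (m + j) p) :=
    Set.Finite.isClosed_biUnion ((CF l (m + j)).finite_toSet.subset fun p hp => hp.1) fun p _ => isClosed_tri _ _
  have hxn : x ∉ ⋃ p ∈ {p | p ∈ CF l (m + j) ∧ x ∉ tri q l (m + j) p}, tri q l (m + j) p := by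
    simp only [mem_iUnion, not_exists]
    intro p hp h
    exact hp.2 h
  filter_upwards [self_mem_nhdsWithin, mem_nhdsWithin_of_mem_nhds (hcl.isOpen_compl.mem_nhds hxn)] with y hy hyn
  obtain ⟨p, hp, hyp⟩ := (mem_K hl y).1 hy (m + j)
  have hxp : x ∈ tri q l (m + j) p := by
    by_contra h
    exact hyn (mem_biUnion (show p ∈ {p | p ∈ CF l (m + j) ∧ x ∉ tri q l (m + j) p} from ⟨hp, h⟩) hyp)
  have h1 := uext_mem hq hl m U hx hp hxp
  have h2 := uext_mem hq hl m U hy hp hyp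
  refine lt_of_le_of_lt ?_ hj
  refine le_trans ?_ (mx_sub_mn hl m U hp)
  rw [Real.dist_eq, abs_le]
  constructor <;> linarith [h1.1, h1.2, h2.1, h2.2]

lemma uext_En (hq : Equi q) (hl : ∀ m, 5 ≤ l m) (m : ℕ) (U : ℕ × ℕ → ℝ) (j : ℕ) :
    En q l (m + j) (uext q l m U) (uext q l m U) = e0 l m U := by
  rw [En_eq hl]
  have : ∑ p ∈ CF l (m + j), edc q l (uext q l m U) (m + j) p = Rn l (m + j) * e0 l m U := by
    rw [← Us_energy hl]
    refine Finset.sum_congr rfl fun p hp => ?_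
    unfold edc edl
    rw [uext_vert hq hl m U hp (Or.inl rfl), uext_vert hq hl m U hp (Or.inr (Or.inl rfl)),
      uext_vert hq hl m U hp (Or.inr (Or.inr rfl))]
  rw [this, ← mul_assoc, inv_mul_cancel₀ (Rn_pos _ _).ne', one_mul]

lemma exists_ext (hq : Equi q) (hl : ∀ m, 5 ≤ l m) (m : ℕ) (U : ℕ × ℕ → ℝ) :
    ∃ u ∈ FDom q l, ContinuousOn u (Gasket q l) ∧ EForm q l u u = e0 l m U ∧
      ∀ x ∈ Gasket q l, ∀ p ∈ CF l m, x ∈ tri q l m p → ∀ lo hi : ℝ, (∀ v, IsV v p → U v ∈ Icc lo hi) →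
        u x ∈ Icc lo hi := by
  refine ⟨uext q l m U, ⟨e0 l m U, fun n => ?_⟩, uext_cont hq hl m U, ?_, ?_⟩
  · rw [← uext_En hq hl m U n]
    exact En_mono hl _ (by omega)
  · unfold EForm
    refine Tendsto.limUnder_eq ?_
    refine tendsto_const_nhds.congr' ?_
    filter_upwards [eventually_ge_atTop m] with n hn
    obtain ⟨j, rfl⟩ := Nat.exists_eq_add_of_le hn
    exact (uext_En hq hl m U j).symm
  · intro x hx p hp hxp lo hi h
    have h1 := uext_mem hq hl m U hx (j := 0) hp hxp
    obtain ⟨v, hv, e1⟩ := mx_exists (Us l m U 0) p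
    obtain ⟨w, hw, e2⟩ := mn_exists (Us l m U 0) p
    have a := h v hv
    have b := h w hw
    rw [← e1, ← e2] at h1
    exact ⟨b.1.trans h1.1, h1.2.trans a.2⟩

lemma vv_cn (hq : Equi q) (hl : ∀ m, 5 ≤ l m) {n : ℕ} {p v w : ℕ × ℕ} (hp : p ∈ CF l n)
    (hv : IsV v p) (hw : IsV w p) : Cn q l (lpt q l n v) (lpt q l n w) (1 / Ln l n) := by
  have hL := Ln_pos hl n
  have hs : ∀ v, IsV v p → ∃ i : Fin 3, lpt q l n v = side q l n p i 0 := by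
    intro v hv
    rcases hv with rfl | rfl | rfl
    · exact ⟨0, by simp [side, lpt]⟩
    · exact ⟨1, by simp [side, lpt]⟩
    · exact ⟨2, by simp [side, lpt]⟩
  have hc : ∀ i : Fin 3, Cn q l (side q l n p i 0) (side q l n p (i + 1) 0) (1 / Ln l n) := by
    intro i
    rw [← side_end]
    have := side_cn hq hl hp i (s := 0) (t := 1) le_rfl zero_le_one zero_le_one le_rfl
    simpa using this
  obtain ⟨i, hi⟩ := hs v hv
  obtain ⟨j, hj⟩ := hs w hw
  have hK : lpt q l n w ∈ Gasket q l := per_sub_K hl hp (isV_per hw)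
  rw [hi, hj]
  have h3 : j = i ∨ j = i + 1 ∨ i = j + 1 := by omega
  rcases h3 with rfl | rfl | rfl
  · exact (Cn.refl (hj ▸ hK)).mono (by positivity)
  · exact hc i
  · exact (hc j).symm

lemma ed_min_le {a b c h d : ℝ} (h1 : |a - b| ≤ d) (h2 : |b - c| ≤ d) (h3 : |c - a| ≤ d) :
    ed (min a h) (min b h) (min c h) ≤ 3 * d ^ 2 := by
  have k : ∀ a b : ℝ, |a - b| ≤ d → (min a h - min b h) ^ 2 ≤ d ^ 2 := by
    intro a b hab
    rw [← sq_abs]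
    refine pow_le_pow_left₀ (abs_nonneg _) (le_trans ?_ hab) 2
    have := abs_min_sub_min_le_max a h b h
    simpa using this
  unfold ed
  linarith [k a b h1, k b c h2, k c a h3]

lemma low_gen (hq : Equi q) (hl : ∀ m, 5 ≤ l m) {PsiR : ℝ → ℝ} (hPsiR : IsPsiR l PsiR)
    {x y : E2} (hx : x ∈ Gasket q l) (hy : y ∈ Gasket q l) (hs0 : 0 < gdist q l x y) {m : ℕ}
    (hm : 5 ≤ (Ln l m : ℝ) * gdist q l x y) {C : ℝ}
    (hC : ∀ S ⊆ CF l m, (∀ p ∈ S, Gasket q l ∩ tri q l m p ⊆ Bd q l x (gdist q l x y)) → (S.card : ℝ) ≤ C) :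
    (gdist q l x y) ^ 2 / 100 ≤ REc q l x y * ((Rn l m)⁻¹ * (C * (3 * (1 / (Ln l m : ℝ)) ^ 2))) := by
  set s := gdist q l x y with hs
  have hL := Ln_pos hl m
  have hLs : 1 / (Ln l m : ℝ) ≤ s / 5 := by
    rw [div_le_div_iff₀ hL (by norm_num)]; linarith
  set U : ℕ × ℕ → ℝ := fun v => min (gdist q l x (lpt q l m v)) (s / 2) with hU
  have hLd : 2 / (Ln l m : ℝ) = 2 * (1 / Ln l m) := by ring
  obtain ⟨u, hu, huc, hE, hb⟩ := exists_ext hq hl m U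
  have hvK : ∀ {p v}, p ∈ CF l m → IsV v p → lpt q l m v ∈ Gasket q l := fun hp hv =>
    per_sub_K hl hp (isV_per hv)
  obtain ⟨p, hp, hxp⟩ := (mem_K hl x).1 hx m
  obtain ⟨p', hp', hyp'⟩ := (mem_K hl y).1 hy m
  have hux : u x ≤ 2 * s / 5 := by
    refine (hb x hx p hp hxp 0 (2 * s / 5) fun v hv => ⟨?_, ?_⟩).2
    · exact le_min (gdist_nonneg _ _) (by linarith)
    · refine (min_le_left _ _).trans ?_
      have := (vert_cn hq hl hx hp hxp hv).symm.gdist_le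
      linarith
  have huy : s / 2 ≤ u y := by
    refine (hb y hy p' hp' hyp' (s / 2) (s / 2) fun v hv => ⟨?_, min_le_right _ _⟩).1
    refine le_min ?_ le_rfl
    have h1 := (vert_cn hq hl hy hp' hyp' hv).gdist_le
    have h2 := gdist_triangle hq hl hx (hvK hp' hv) hy
    linarith
  have hd : s ^ 2 / 100 ≤ (u x - u y) ^ 2 := by nlinarith
  -- energy positivity
  have he0 := e0_nonneg l m U
  have hup := sq_le_PsiR hq hl hPsiR hx hy hu huc
  have hepos : 0 < e0 l m U := by
    refine lt_of_le_of_ne he0 fun h => ?_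
    rw [hE, ← h, mul_zero] at hup
    have : 0 < s ^ 2 / 100 := by positivity
    linarith
  have hmem : (u x - u y) ^ 2 / e0 l m U ∈ REcSet q l x y :=
    ⟨u, hu, huc, by rw [hE]; exact hepos, by rw [hE]⟩
  have hle : (u x - u y) ^ 2 / e0 l m U ≤ REc q l x y := le_csSup ⟨_, R_upper hq hl hPsiR hx hy⟩ hmem
  have hR0 : 0 ≤ REc q l x y := le_trans (by positivity) hle
  rw [div_le_iff₀ hepos] at hle
  refine hd.trans (hle.trans (mul_le_mul_of_nonneg_left ?_ hR0))
  unfold e0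
  refine mul_le_mul_of_nonneg_left ?_ (inv_nonneg.2 (Rn_pos l m).le)
  -- counting
  set S := (CF l m).filter fun p => edl U p ≠ 0 with hSdef
  have hcard := hC S (Finset.filter_subset _ _) (by
    intro p hp z hz
    rw [hSdef, Finset.mem_filter] at hp
    obtain ⟨hp, hne⟩ := hp
    refine ⟨hz.1, ?_⟩
    obtain ⟨v, hv, hlt⟩ : ∃ v, IsV v p ∧ gdist q l x (lpt q l m v) < s / 2 := by
      by_contra hcon
      push Not at hcon
      apply hne
      have h1 := hcon _ (Or.inl rfl)
      have h2 := hcon _ (Or.inr (Or.inl rfl))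
      have h3 := hcon _ (Or.inr (Or.inr rfl))
      simp [edl, ed, hU, min_eq_right h1, min_eq_right h2, min_eq_right h3]
    have h1 := (vert_cn hq hl hz.1 hp hz.2 hv).gdist_le
    have h2 := gdist_triangle hq hl hx (hvK hp hv) hz.1
    linarith)
  rw [← Finset.sum_filter_ne_zero]
  calc ∑ p ∈ CF l m with edl U p ≠ 0, edl U p ≤ ∑ p ∈ S, 3 * (1 / (Ln l m : ℝ)) ^ 2 := by
        refine Finset.sum_le_sum fun p hp => ?_
        have hp := (Finset.mem_filter.1 hp).1
        have lip : ∀ {v w}, IsV v p → IsV w p →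
            |gdist q l x (lpt q l m v) - gdist q l x (lpt q l m w)| ≤ 1 / Ln l m := by
          intro v w hv hw
          have h1 := (vv_cn hq hl hp hv hw).gdist_le
          have h2 := (vv_cn hq hl hp hw hv).gdist_le
          have h3 := gdist_triangle hq hl hx (hvK hp hv) (hvK hp hw)
          have h4 := gdist_triangle hq hl hx (hvK hp hw) (hvK hp hv)
          rw [abs_le]; constructor <;> linarith
        exact ed_min_le (lip (Or.inl rfl) (Or.inr (Or.inl rfl))) (lip (Or.inr (Or.inl rfl)) (Or.inr (Or.inr rfl)))
          (lip (Or.inr (Or.inr rfl)) (Or.inl rfl))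
    _ = S.card * (3 * (1 / (Ln l m : ℝ)) ^ 2) := by rw [Finset.sum_const, nsmul_eq_mul]
    _ ≤ _ := mul_le_mul_of_nonneg_right hcard (by positivity)

set_option maxHeartbeats 1000000 in
lemma R_lower (hq : Equi q) (hl : ∀ m, 5 ≤ l m) {μ : Measure E2} (hμ : IsUnif q l μ) {PsiM PsiR : ℝ → ℝ}
    (hPsiM : IsPsiM l PsiM) (hPsiR : IsPsiR l PsiR)
    {x y : E2} (hx : x ∈ Gasket q l) (hy : y ∈ Gasket q l) (hs0 : 0 < gdist q l x y) :
    ((2 : ℝ) ^ 14)⁻¹ * PsiR (gdist q l x y) ≤ REc q l x y := by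
  have hs3 : gdist q l x y ≤ 3 := by
    have := (cell_cn hq hl hx (CF_zero l) (mem_zero hl hx) hy (mem_zero hl hy)).gdist_le
    rw [Ln_zero] at this
    linarith
  set s := gdist q l x y with hs
  rcases le_total s 1 with h1 | h1
  · obtain ⟨n, h2, h3⟩ := exists_scale hl hs0 h1
    obtain ⟨h4, h5, -⟩ := scale_inv hl h2 h3
    have hN := l_ge hl (n + 1)
    have hL := Ln_pos hl (n + 1)
    have hM := Mn_pos hl (n + 1)
    have hR := Rn_pos l (n + 1)
    have hg := low_gen hq hl hPsiR hx hy hs0 (m := n + 1 + 1) (C := Mn l (n + 1 + 1) * (12 * PsiM s)) (by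
        rw [Ln_succ, ← hs]; nlinarith) (by
      intro S hS h
      have h6 := meas_ge_card hl hμ (B := Bd q l x s) (fun y hy => hy.1) hS h
      have h7 := (part1 hq hl hμ hPsiM hx hs0 hs3).2.1
      have h8 := h6.trans h7
      rw [← div_eq_mul_inv, div_le_iff₀ (Mn_pos hl _)] at h8
      linarith)
    rw [← hs, hPsiM.1 n s h4 h5, psiMPiece, Mn_succ hl (n + 1), Ln_succ l (n + 1), Rn_succ l (n + 1), mul_inv, rl_inv] at hg
    rw [hPsiR.1 n s h4 h5, psiRPiece]
    have hcM := (cM_bd hl n).2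
    have hcR := (cR_bd hl n).2
    set cM := (3 * (l n : ℝ) - 4) / ((l n : ℝ) - 1)
    set cR := ((2 / 3) * (l n : ℝ) - 8 / 9) / ((l n : ℝ) - 1)
    set N : ℝ := (l (n + 1) : ℝ)
    set L : ℝ := (Ln l (n + 1) : ℝ)
    set M : ℝ := (Mn l (n + 1) : ℝ)
    set R := Rn l (n + 1)
    obtain ⟨t, ht⟩ : ∃ t, t = L * s := ⟨_, rfl⟩
    rw [← ht] at hg h2 ⊢
    have hst : s = t / L := by rw [ht]; field_simp
    set X := REc q l x y
    have hX : t ^ 2 * N ^ 2 * R ≤ X * (3600 * ((2 * N / 3 + 1 / 9) * (3 * N - 3)) * (1 + cM * (t - 1))) := by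
      rw [hst] at hg
      have e : X * (R⁻¹ * (2 * N / 3 + 1 / 9) * (M * (3 * N - 3) * (12 * (M⁻¹ * (1 + cM * (t - 1)))) * (3 * (1 / (L * N)) ^ 2)))
          = X * (36 * ((2 * N / 3 + 1 / 9) * (3 * N - 3)) * (1 + cM * (t - 1))) / (R * L ^ 2 * N ^ 2) := by
        field_simp
        ring
      rw [e, div_pow, le_div_iff₀ (by positivity)] at hg
      have e2 : t ^ 2 / L ^ 2 / 100 * (R * L ^ 2 * N ^ 2) = t ^ 2 * N ^ 2 * R / 100 := by field_simp
      rw [e2] at hg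
      linarith
    have hA : (2 * N / 3 + 1 / 9) * (3 * N - 3) ≤ 2 * N ^ 2 := by nlinarith
    have hA0 : 0 < (2 * N / 3 + 1 / 9) * (3 * N - 3) := mul_pos (by linarith) (by linarith)
    have hB : 1 + cM * (t - 1) ≤ 3 * t - 2 := by nlinarith
    have hB0 : 0 < 1 + cM * (t - 1) := by
      have := (cM_bd hl n).1
      nlinarith
    have hD : 1 + cR * (t - 1) ≤ (2 * t + 1) / 3 := by nlinarith
    have hX0 : 0 ≤ X := by
      by_contra hneg
      push Not at hneg
      have : X * (3600 * ((2 * N / 3 + 1 / 9) * (3 * N - 3)) * (1 + cM * (t - 1))) ≤ 0 :=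
        mul_nonpos_of_nonpos_of_nonneg hneg.le (by positivity)
      have : 0 < t ^ 2 * N ^ 2 * R := by positivity
      linarith
    have hX2 : t ^ 2 * N ^ 2 * R ≤ X * (3600 * (2 * N ^ 2) * (3 * t - 2)) := by
      refine hX.trans (mul_le_mul_of_nonneg_left ?_ hX0)
      refine mul_le_mul ?_ hB hB0.le (by positivity)
      linarith
    have hN2 : 0 < N ^ 2 := by positivity
    have hX3 : t ^ 2 * R ≤ X * (7200 * (3 * t - 2)) := by
      refine le_of_mul_le_mul_right ?_ hN2
      linarith
    rw [inv_mul_le_iff₀ (by norm_num)]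
    have h9 : R * (1 + cR * (t - 1)) ≤ R * ((2 * t + 1) / 3) := mul_le_mul_of_nonneg_left hD hR.le
    refine h9.trans ?_
    have h10 : 0 < 3 * t - 2 := by linarith
    refine le_of_mul_le_mul_right ?_ h10
    have h11 : (2 * t + 1) / 3 * (3 * t - 2) ≤ 2 ^ 14 / 7200 * t ^ 2 := by nlinarith
    have h12 := mul_le_mul_of_nonneg_left h11 hR.le
    linarith
  · have hN := l_ge hl 0
    have hg := low_gen hq hl hPsiR hx hy hs0 (m := 0 + 1) (C := Mn l (0 + 1)) (by
        rw [Ln_succ, Ln_zero, ← hs]; nlinarith) (by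
      intro S hS _
      rw [← card_CF hl]
      exact_mod_cast Finset.card_le_card hS)
    rw [← hs, Mn_succ hl 0, Ln_succ l 0, Rn_succ l 0, Mn_zero, Ln_zero, Rn_zero, one_mul, one_mul, one_mul, rl_inv] at hg
    rw [hPsiR.2.1 s h1]
    obtain ⟨b0, b1, -⟩ := betaR_le hl
    have hb : s ^ betaR l ≤ s := by
      calc _ ≤ s ^ (1 : ℝ) := Real.rpow_le_rpow_of_exponent_le h1 b1
        _ = s := Real.rpow_one s
    set N : ℝ := (l 0 : ℝ)
    set X := REc q l x y
    have hN0 : 0 < N := by linarith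
    have hc0 : 0 ≤ (2 * N / 3 + 1 / 9) * ((3 * N - 3) * (3 * (1 / N) ^ 2)) :=
      mul_nonneg (by positivity) (mul_nonneg (by linarith) (by positivity))
    have hc : (2 * N / 3 + 1 / 9) * ((3 * N - 3) * (3 * (1 / N) ^ 2)) ≤ 6 := by
      have e : (2 * N / 3 + 1 / 9) * ((3 * N - 3) * (3 * (1 / N) ^ 2)) =
        3 * ((2 * N / 3 + 1 / 9) * (3 * N - 3)) / N ^ 2 := by field_simp
      rw [e, div_le_iff₀ (by positivity)]
      nlinarith
    have hX0 : 0 ≤ X := by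
      by_contra hneg
      push Not at hneg
      have := mul_nonpos_of_nonpos_of_nonneg hneg.le hc0
      have : 0 < s ^ 2 / 100 := by positivity
      linarith
    have := mul_le_mul_of_nonneg_left hc hX0
    rw [inv_mul_le_iff₀ (by norm_num)]
    nlinarith

/-- Comparison of `m(B_d(x,s))` with `Ψᴹ(s)`, of
`Ψ(s)/m(B_d(x,s))` with `Ψᴿ(s)`, and of `R_E(x,y)` with `Ψᴿ(d(x,y))`. -/
theorem stmt13 (q : Fin 3 → E2) (hq : ∀ j k : Fin 3, j ≠ k → dist (q j) (q k) = 1)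
    (l : ℕ → ℕ) (hl : ∀ m, 5 ≤ l m)
    (μ : Measure E2) (hμ : IsUnif q l μ) (Psi PsiM PsiR : ℝ → ℝ)
    (hPsi : IsPsi l Psi) (hPsiM : IsPsiM l PsiM) (hPsiR : IsPsiR l PsiR)
    (x : E2) (hx : x ∈ Gasket q l) (y : E2) (hy : y ∈ Gasket q l)
    (s : ℝ) (hs0 : 0 < s) (hs3 : s ≤ 3) :
    ((1 / 16) * PsiM s ≤ (μ (Bd q l x s)).toReal ∧
     (μ (Bd q l x s)).toReal ≤ 12 * PsiM s) ∧
    ((1 / 12) * PsiR s ≤ Psi s / (μ (Bd q l x s)).toReal ∧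
     Psi s / (μ (Bd q l x s)).toReal ≤ 16 * PsiR s) ∧
    (((2 : ℝ) ^ 14)⁻¹ * PsiR (gdist q l x y) ≤ REc q l x y ∧
     REc q l x y ≤ (2 : ℝ) ^ 12 * PsiR (gdist q l x y)) := by
  have p1 := part1 hq hl hμ hPsiM hx hs0 hs3
  refine ⟨⟨p1.1, p1.2.1⟩, part2 hq hl hμ hPsi hPsiM hPsiR hx hs0 hs3, ?_, ?_⟩
  · rcases (gdist_nonneg (q := q) (l := l) x y).eq_or_lt with h | h
    · rw [← h, hPsiR.2.2, mul_zero]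
      refine Real.sSup_nonneg ?_
      rintro t ⟨u, -, -, hE, rfl⟩
      positivity
    · exact R_lower hq hl hμ hPsiM hPsiR hx hy h
  · exact Real.sSup_le (R_upper hq hl hPsiR hx hy)
      (mul_nonneg (by norm_num) (PsiR_nonneg hl hPsiR (gdist_nonneg _ _)))

end
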